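/- Let d ≥ 3. There exist positive constants c, c_0, c_1, c_2 depending only on d such that for every integer L_0 ≥ c, every n ≥ 0, and all u, u' with 0 < u' ≤ (1 + c_0/ℓ_n^{d−2})^{−1}·u, one has q_{n+1}(u') ≤ c_1·ℓ_n²·( q_n(u)² + u'·L_n^{−2} + exp(−c_2(u − u')·L_n^{d−2}) ), where q_{n+1}(u') and q_n(u) are taken with respect to any vacant-set laws at levels u' and u respectively. -/

import Mathlib

open MeasureTheory Filter

namespace RI

/-- Points of `ℤ^d`. -/
abbrev Zd (d : ℕ) := Fin d → ℤ

/-- `x` and `y` are nearest neighbours: `|x - y| = 1`. -/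
def adj {d : ℕ} (x y : Zd d) : Prop := (∑ i, |x i - y i|) = 1

/-- `x` and `y` are `*`-neighbours: `|x - y|_∞ = 1`. -/
def starAdj {d : ℕ} (x y : Zd d) : Prop := x ≠ y ∧ ∀ i, |x i - y i| ≤ 1

/-- `x` belongs to the plane `ℤ e₁ + ℤ e₂ ⊆ ℤ^d`. -/
def inPlane {d : ℕ} (x : Zd d) : Prop := ∀ i : Fin d, 2 ≤ (i : ℕ) → x i = 0

/-- The `k`-th coordinate of `x`, with value `0` for out-of-range indices. -/
def coord {d : ℕ} (x : Zd d) (k : ℕ) : ℤ := if h : k < d then x ⟨k, h⟩ else 0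

/-- `P` is the family of laws of the simple random walks on `ℤ^d` started at the points of
`ℤ^d`: each `P x` is a probability measure on the path space `ℕ → ℤ^d`, and the cylinder
probabilities are those of the walk with i.i.d. increments uniform on `{± e_i}`. -/
def IsSRW (d : ℕ) (P : Zd d → Measure (ℕ → Zd d)) : Prop :=
  (∀ x, IsProbabilityMeasure (P x)) ∧
  (∀ (x : Zd d) (n : ℕ) (w : ℕ → Zd d),
      (w 0 = x ∧ ∀ k < n, adj (w k) (w (k + 1))) →
        P x {ω | ∀ k ≤ n, ω k = w k} = ((2 * d : ENNReal))⁻¹ ^ n) ∧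
  (∀ (x : Zd d) (n : ℕ) (w : ℕ → Zd d),
      ¬(w 0 = x ∧ ∀ k < n, adj (w k) (w (k + 1))) →
        P x {ω | ∀ k ≤ n, ω k = w k} = 0)

/-- The equilibrium measure of a set `V ⊆ ℤ^d`:
`e_V(x) = P_x[H̃_V = ∞]` for `x ∈ V`, and `0` otherwise. -/
noncomputable def eqm {d : ℕ} (P : Zd d → Measure (ℕ → Zd d)) (V : Set (Zd d)) : Zd d → ℝ :=
  V.indicator fun x => (P x {ω | ∀ n, 1 ≤ n → ω n ∉ V}).toReal

/-- The capacity of a finite set `K ⊆ ℤ^d`. -/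
noncomputable def capa {d : ℕ} (P : Zd d → Measure (ℕ → Zd d)) (K : Finset (Zd d)) : ℝ :=
  ∑ x ∈ K, eqm P (↑K) x

/-- `Q` is a vacant-set law at level `u`: a probability measure on `{0,1}^{ℤ^d}`
(with `true = 1` standing for "vacant") such that
`Q[Y_x = 1 ∀ x ∈ K] = exp(-u cap K)` for every finite `K`. -/
def IsVacantLaw {d : ℕ} (P : Zd d → Measure (ℕ → Zd d)) (u : ℝ)
    (Q : Measure (Zd d → Bool)) : Prop :=
  IsProbabilityMeasure Q ∧
  ∀ K : Finset (Zd d),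
    Q {Y | ∀ x ∈ K, Y x = true} = ENNReal.ofReal (Real.exp (-(u * capa P K)))

/-- There is a `*`-path starting in `S`, ending in `T`, all of whose points lie in `A`. -/
def HasStarPath {d : ℕ} (S T A : Set (Zd d)) : Prop :=
  ∃ (N : ℕ) (w : ℕ → Zd d), w 0 ∈ S ∧ w N ∈ T ∧ (∀ k ≤ N, w k ∈ A) ∧
    ∀ k < N, starAdj (w k) (w (k + 1))

/-- Interior boundary `∂_int U`. -/
def intBdry {d : ℕ} (U : Set (Zd d)) : Set (Zd d) := {x | x ∈ U ∧ ∃ y, y ∉ U ∧ adj x y}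

/-- (Exterior) boundary `∂U`. -/
def bdry {d : ℕ} (U : Set (Zd d)) : Set (Zd d) := {x | x ∉ U ∧ ∃ y ∈ U, adj x y}

/-- `ℓ = 100 ⌊L^{1/100}⌋ + 1`. -/
noncomputable def ellOf (L : ℕ) : ℕ := 100 * ⌊(L : ℝ) ^ ((1 : ℝ) / 100)⌋₊ + 1

/-- The scales `L_{n+1} = ℓ_n L_n`. -/
noncomputable def Lseq (L0 : ℕ) : ℕ → ℕ
  | 0 => L0
  | n + 1 => ellOf (Lseq L0 n) * Lseq L0 n

/-- The levels `u_{n+1} = (1 + 1/log L_n)⁻¹ u_n`. -/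
noncomputable def useq (L0 : ℕ) (u0 : ℝ) : ℕ → ℝ
  | 0 => u0
  | n + 1 => (1 + 1 / Real.log (Lseq L0 n))⁻¹ * useq L0 u0 n

/-- The event (on the configuration space `{0,1}^{ℤ^d}`) that there is a `*`-path from
`[-L,L]² ∩ ℤ²` to `∂_int ([-3L,3L]^d ∩ ℤ^d)` all of whose points lie in `{x ∈ ℤ² : Y_x = 0}`. -/
def qEvent (d : ℕ) (L : ℕ) : Set (Zd d → Bool) :=
  {Y | HasStarPath
    {x : Zd d | inPlane x ∧ ∀ i, |x i| ≤ (L : ℤ)}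
    (intBdry {x : Zd d | ∀ i, |x i| ≤ (3 * L : ℤ)})
    {x : Zd d | inPlane x ∧ Y x = false}}


end RI

open RI MeasureTheory Filter

namespace RI

open scoped NNReal

section Harmonic

variable {d : ℕ}

/-- The transition operator of simple random walk on `ℤ^d`. -/
noncomputable def avg (f : Zd d → ℝ) (x : Zd d) : ℝ :=
  (2 * d : ℝ)⁻¹ * ∑ i : Fin d, (f (x + Pi.single i 1) + f (x - Pi.single i 1))

lemma avg_add (f g : Zd d → ℝ) (x : Zd d) :
    avg (fun y => f y + g y) x = avg f x + avg g x := by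
  simp only [avg, ← mul_add, ← Finset.sum_add_distrib]
  congr 1; exact Finset.sum_congr rfl fun i _ => by ring

lemma avg_const_mul (c : ℝ) (f : Zd d → ℝ) (x : Zd d) :
    avg (fun y => c * f y) x = c * avg f x := by
  simp only [avg, Finset.mul_sum]
  exact Finset.sum_congr rfl fun i _ => by ring

lemma avg_sub (f g : Zd d → ℝ) (x : Zd d) :
    avg (fun y => f y - g y) x = avg f x - avg g x := by
  simp only [avg, ← mul_sub, ← Finset.sum_sub_distrib]
  congr 1; exact Finset.sum_congr rfl fun i _ => by ring

lemma avg_sum {ι : Type*} (s : Finset ι) (f : ι → Zd d → ℝ) (x : Zd d) :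
    avg (fun y => ∑ j ∈ s, f j y) x = ∑ j ∈ s, avg (f j) x := by
  classical
  induction s using Finset.induction_on with
  | empty => simp [avg]
  | insert a s ha ih => simp only [Finset.sum_insert ha, avg_add, ih]

lemma avg_const [NeZero d] (c : ℝ) (x : Zd d) : avg (fun _ => c) x = c := by
  have : (d : ℝ) ≠ 0 := by exact_mod_cast NeZero.ne d
  simp only [avg, Finset.sum_const, Finset.card_univ, Fintype.card_fin, nsmul_eq_mul]
  field_simp; ring

lemma avg_mono {f g : Zd d → ℝ} (h : ∀ y, f y ≤ g y) (x : Zd d) : avg f x ≤ avg g x := by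
  unfold avg
  gcongr <;> apply h

lemma avg_nonneg {f : Zd d → ℝ} (h : ∀ y, 0 ≤ f y) (x : Zd d) : 0 ≤ avg f x :=
  mul_nonneg (by positivity) (Finset.sum_nonneg fun i _ => add_nonneg (h _) (h _))

lemma avg_tendsto {f : ℕ → Zd d → ℝ} {g : Zd d → ℝ}
    (h : ∀ y, Tendsto (fun n => f n y) atTop (nhds (g y))) (x : Zd d) :
    Tendsto (fun n => avg (f n) x) atTop (nhds (avg g x)) :=
  (tendsto_finsetSum _ fun _ _ => (h _).add (h _)).const_mul _

lemma avg_translate (f : Zd d → ℝ) (a x : Zd d) :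
    avg (fun y => f (y + a)) x = avg f (x + a) := by
  simp only [avg]
  congr 1
  exact Finset.sum_congr rfl fun i _ => by
    rw [add_right_comm, sub_add_eq_add_sub]

lemma avg_neg (f : Zd d → ℝ) (x : Zd d) :
    avg (fun y => f (-y)) x = avg f (-x) := by
  simp only [avg]
  congr 1
  refine Finset.sum_congr rfl fun i _ => ?_
  rw [add_comm]
  congr 2 <;> abel

/-- Maximum principle: a function that is subharmonic on `W`, nonpositive on the outer boundary of
`W`, and with finite positive level sets in `W`, is nonpositive on `W`. -/
lemma max_principle [NeZero d] {F : Zd d → ℝ} {W : Set (Zd d)}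
    (hfin : ∀ ε > 0, {x | x ∈ W ∧ ε ≤ F x}.Finite)
    (hsub : ∀ x ∈ W, F x ≤ avg F x)
    (hout : ∀ y ∉ W, (∃ x ∈ W, ∃ i, y = x + Pi.single i 1 ∨ y = x - Pi.single i 1) → F y ≤ 0) :
    ∀ x ∈ W, F x ≤ 0 := by
  by_contra hcon
  push Not at hcon
  obtain ⟨x0, hx0, hpos⟩ := hcon
  obtain ⟨x1, hx1, hmax⟩ := Set.exists_max_image _ F (hfin _ hpos) ⟨x0, hx0, le_rfl⟩
  have hM : 0 < F x1 := hpos.trans_le hx1.2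
  have hle : ∀ x ∈ W, F x ≤ F x1 := fun x hx => by
    by_cases h : F x0 ≤ F x
    · exact hmax x ⟨hx, h⟩
    · exact (not_le.mp h).le.trans hx1.2
  obtain ⟨x2, hx2, hmax2⟩ := Set.exists_max_image _ (fun x : Zd d => x 0) (hfin _ hM)
    ⟨x1, hx1.1, le_rfl⟩
  have hx2e : F x2 = F x1 := le_antisymm (hle _ hx2.1) hx2.2
  have hnb : ∀ y, (∃ i, y = x2 + Pi.single i 1 ∨ y = x2 - Pi.single i 1) → F y ≤ F x1 := by
    intro y hy
    by_cases h : y ∈ W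
    · exact hle y h
    · exact (hout y h ⟨x2, hx2.1, hy⟩).trans hM.le
  set y := x2 + Pi.single (0 : Fin d) 1 with hy
  have hylt : F y < F x1 := by
    rcases (hnb y ⟨0, Or.inl rfl⟩).lt_or_eq with h | h
    · exact h
    · exfalso
      have hyW : y ∈ W := by
        by_contra hyW
        exact (hout y hyW ⟨x2, hx2.1, 0, Or.inl rfl⟩).not_gt (h ▸ hM)
      have := hmax2 y ⟨hyW, h.ge⟩
      simp [hy] at this
  have hd : (0 : ℝ) < d := by exact_mod_cast Nat.pos_of_ne_zero (NeZero.ne d)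
  have hlt : avg F x2 < F x1 := by
    have : ∑ i : Fin d, (F (x2 + Pi.single i 1) + F (x2 - Pi.single i 1))
        < ∑ i : Fin d, (F x1 + F x1) :=
      Finset.sum_lt_sum
        (fun i _ => add_le_add (hnb _ ⟨i, Or.inl rfl⟩) (hnb _ ⟨i, Or.inr rfl⟩))
        ⟨0, Finset.mem_univ _, add_lt_add_of_lt_of_le hylt (hnb _ ⟨0, Or.inr rfl⟩)⟩
    calc avg F x2 < (2 * d : ℝ)⁻¹ * ∑ i : Fin d, (F x1 + F x1) := by
          unfold avg; gcongr
      _ = F x1 := by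
          simp only [Finset.sum_const, Finset.card_univ, Fintype.card_fin, nsmul_eq_mul]
          field_simp; norm_num
  have := hsub x2 hx2.1
  linarith

lemma finite_of_le_tendsto {F G : Zd d → ℝ} (hle : ∀ x, F x ≤ G x)
    (hG : Tendsto G cofinite (nhds 0)) (W : Set (Zd d)) {ε : ℝ} (hε : 0 < ε) :
    {x | x ∈ W ∧ ε ≤ F x}.Finite := by
  have : ∀ᶠ x in cofinite, G x < ε := hG.eventually (gt_mem_nhds hε)
  refine Set.Finite.subset (eventually_cofinite.mp this) fun x hx => ?_
  simpa using hx.2.trans (hle x)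

/-- Maximum principle off a set `V` for functions dominated by one vanishing at infinity. -/
lemma max_principle_compl [NeZero d] {F G : Zd d → ℝ} (V : Set (Zd d)) (hle : ∀ x, F x ≤ G x)
    (hG : Tendsto G cofinite (nhds 0)) (hV : ∀ x ∈ V, F x ≤ 0)
    (hsub : ∀ x ∉ V, F x ≤ avg F x) (x : Zd d) : F x ≤ 0 := by
  by_cases hx : x ∈ V
  · exact hV x hx
  · exact max_principle (W := Vᶜ) (fun ε hε => finite_of_le_tendsto hle hG _ hε) hsub
      (fun y hy _ => hV y (by simpa using hy)) x hx

/-- Uniqueness in the exterior Dirichlet problem. -/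
lemma dirichlet_unique [NeZero d] {F G : Zd d → ℝ} (V : Set (Zd d))
    (hF : Tendsto F cofinite (nhds 0)) (hG : Tendsto G cofinite (nhds 0))
    (hV : ∀ x ∈ V, F x = G x) (hh : ∀ x ∉ V, F x - avg F x = G x - avg G x) : F = G := by
  funext x
  have h1 := max_principle_compl (F := fun x => F x - G x) V (fun _ => le_rfl)
    (by simpa using hF.sub hG) (fun x hx => by simp [hV x hx])
    (fun x hx => by rw [avg_sub]; linarith [hh x hx]) x
  have h2 := max_principle_compl (F := fun x => G x - F x) V (fun _ => le_rfl)
    (by simpa using hG.sub hF) (fun x hx => by simp [hV x hx])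
    (fun x hx => by rw [avg_sub]; linarith [hh x hx]) x
  linarith

end Harmonic

section Supersolution

lemma inv_sqrt_one_add_le {r : ℝ} (hr : |r| ≤ 1 / 2) :
    (√(1 + r))⁻¹ ≤ 1 - r / 2 + 3 / 8 * r ^ 2 - 5 / 16 * r ^ 3 + r ^ 4 := by
  obtain ⟨h1, h2⟩ := abs_le.mp hr
  set p := 1 - r / 2 + 3 / 8 * r ^ 2 - 5 / 16 * r ^ 3 + r ^ 4 with hp
  have hr2 : r ^ 2 ≤ 1 / 4 := by nlinarith
  have hp0 : 0 < p := by
    have : r ^ 3 ≤ 1 / 8 := by nlinarith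
    nlinarith [sq_nonneg (r ^ 2)]
  have hs : 0 < √(1 + r) := Real.sqrt_pos.mpr (by linarith)
  have hsq : √(1 + r) ^ 2 = 1 + r := Real.sq_sqrt (by linarith)
  have hrem : 0 ≤ 93 / 64 + 39 / 32 * r - 99 / 256 * r ^ 2 + 57 / 256 * r ^ 3
      + 3 / 8 * r ^ 4 + r ^ 5 := by
    have h3 : -(1 / 8) ≤ r ^ 3 := by nlinarith
    have h5 : -(1 / 32) ≤ r ^ 5 := by
      have : |r| ^ 5 ≤ (1 / 2) ^ 5 := by gcongr
      rw [← abs_pow] at this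
      have := (abs_le.mp this).1
      norm_num at this; linarith
    have h4 : 0 ≤ r ^ 4 := by positivity
    linarith
  have hid : (1 + r) * p ^ 2 = 1 + r ^ 4 * (93 / 64 + 39 / 32 * r - 99 / 256 * r ^ 2
      + 57 / 256 * r ^ 3 + 3 / 8 * r ^ 4 + r ^ 5) := by rw [hp]; ring
  have hge : 1 ≤ (√(1 + r) * p) ^ 2 := by
    rw [mul_pow, hsq, hid]
    have : 0 ≤ r ^ 4 := by positivity
    nlinarith [mul_nonneg this hrem]
  rw [inv_le_iff_one_le_mul₀ hs, mul_comm]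
  exact (one_le_sq_iff₀ (by positivity)).mp hge

lemma inv_sqrt_one_add_pow_le (q : ℕ) : ∃ b C : ℝ, ∀ r : ℝ, |r| ≤ 1 / 2 →
    (√(1 + r))⁻¹ ^ q ≤ 1 - q / 2 * r + q * (q + 2) / 8 * r ^ 2 + b * r ^ 3 + C * r ^ 4 := by
  induction q with
  | zero => exact ⟨0, 0, fun r _ => by simp⟩
  | succ q ih =>
    obtain ⟨b, C, h⟩ := ih
    set A : ℝ := q * (q + 2) / 8 with hA
    set k0 : ℝ := 1 + 5 / 16 * (q / 2) + 3 / 8 * A - b / 2 + C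
    set k1 : ℝ := -(q / 2) - 5 / 16 * A + 3 / 8 * b - C / 2
    set k2 : ℝ := A - 5 / 16 * b + 3 / 8 * C
    set k3 : ℝ := b - 5 / 16 * C
    refine ⟨b - q * (q + 2) / 16 - 3 * q / 16 - 5 / 16, |k0| + |k1| + |k2| + |k3| + |C|, ?_⟩
    intro r hr
    have h1 := inv_sqrt_one_add_le hr
    have h2 := h r hr
    have hφ : 0 ≤ (√(1 + r))⁻¹ := by positivity
    have hφq : 0 ≤ (√(1 + r))⁻¹ ^ q := by positivity
    have hr1 : |r| ≤ 1 := by linarith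
    have bd : ∀ (k : ℝ) (n : ℕ), k * r ^ n ≤ |k| := fun k n => by
      calc k * r ^ n ≤ |k * r ^ n| := le_abs_self _
        _ = |k| * |r| ^ n := by rw [abs_mul, abs_pow]
        _ ≤ |k| * 1 := by gcongr; exact pow_le_one₀ (abs_nonneg _) hr1
        _ = |k| := mul_one _
    have hr4 : 0 ≤ r ^ 4 := by positivity
    have hrem := mul_le_mul_of_nonneg_left (add_le_add (add_le_add (add_le_add
      (add_le_add (bd k0 0) (bd k1 1)) (bd k2 2)) (bd k3 3)) (bd C 4)) hr4
    calc (√(1 + r))⁻¹ ^ (q + 1) = (√(1 + r))⁻¹ ^ q * (√(1 + r))⁻¹ := pow_succ _ _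
      _ ≤ (1 - q / 2 * r + A * r ^ 2 + b * r ^ 3 + C * r ^ 4)
          * (1 - r / 2 + 3 / 8 * r ^ 2 - 5 / 16 * r ^ 3 + r ^ 4) :=
          mul_le_mul h2 h1 hφ (hφq.trans h2)
      _ = 1 - ((q + 1 : ℕ) : ℝ) / 2 * r + ((q + 1 : ℕ) : ℝ) * (((q + 1 : ℕ) : ℝ) + 2) / 8 * r ^ 2
          + (b - q * (q + 2) / 16 - 3 * q / 16 - 5 / 16) * r ^ 3
          + r ^ 4 * (k0 * r ^ 0 + k1 * r ^ 1 + k2 * r ^ 2 + k3 * r ^ 3 + C * r ^ 4) := by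
          simp only [k0, k1, k2, k3, A]; push_cast; ring
      _ ≤ _ := by linarith [hrem]

lemma inv_sqrt_one_add_pow_symm_le (q : ℕ) : ∃ C : ℝ, 0 ≤ C ∧ ∀ r : ℝ, |r| ≤ 1 / 2 →
    (√(1 + r))⁻¹ ^ q + (√(1 - r))⁻¹ ^ q ≤ 2 + q * (q + 2) / 4 * r ^ 2 + C * r ^ 4 := by
  obtain ⟨b, C, h⟩ := inv_sqrt_one_add_pow_le q
  refine ⟨2 * |C|, by positivity, fun r hr => ?_⟩
  have h1 := h r hr
  have h2 := h (-r) (by rwa [abs_neg])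
  rw [← sub_eq_add_neg] at h2
  have h3 : C * r ^ 4 ≤ |C| * r ^ 4 := by gcongr; exact le_abs_self C
  have e : (-r) ^ 4 = r ^ 4 := by ring
  have e3 : (-r) ^ 3 = -r ^ 3 := by ring
  have e2 : (-r) ^ 2 = r ^ 2 := by ring
  rw [e, e3, e2] at h2
  linarith

lemma one_add_le_inv_sqrt_one_sub_pow (q : ℕ) {s : ℝ} (hs0 : 0 ≤ s) (hs : s < 1) :
    1 + q / 2 * s ≤ (√(1 - s))⁻¹ ^ q := by
  have h1 : 1 + s / 2 ≤ (√(1 - s))⁻¹ := by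
    have hpos : 0 < √(1 - s) := Real.sqrt_pos.mpr (by linarith)
    rw [le_inv_comm₀ (by linarith) hpos, Real.sqrt_le_left (by positivity), inv_pow,
      le_inv_comm₀ (by linarith) (by positivity)]
    rw [← one_div, le_div_iff₀ (by linarith)]
    nlinarith [mul_nonneg hs0 hs0, mul_nonneg hs0 (mul_nonneg hs0 hs0)]
  calc 1 + q / 2 * s = 1 + q * (s / 2) := by ring
    _ ≤ (1 + s / 2) ^ q := one_add_mul_le_pow (by linarith) q
    _ ≤ _ := by gcongr

variable {d : ℕ}

/-- The squared Euclidean norm of a lattice point. -/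
def nsq (x : Zd d) : ℝ := ∑ i, (x i : ℝ) ^ 2

lemma nsq_nonneg (x : Zd d) : 0 ≤ nsq x := Finset.sum_nonneg fun _ _ => sq_nonneg _

lemma sq_le_nsq (x : Zd d) (i : Fin d) : (x i : ℝ) ^ 2 ≤ nsq x :=
  Finset.single_le_sum (f := fun i => (x i : ℝ) ^ 2) (fun _ _ => sq_nonneg _) (Finset.mem_univ i)

lemma nsq_add_single (x : Zd d) (i : Fin d) (c : ℤ) :
    nsq (x + Pi.single i c) = nsq x + 2 * c * x i + c ^ 2 := by
  have h : ∀ j, ((x + Pi.single i c : Zd d) j : ℝ) ^ 2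
      = (x j : ℝ) ^ 2 + if j = i then (2 * c * x i + c ^ 2 : ℝ) else 0 := fun j => by
    by_cases hj : j = i
    · subst hj; simp; ring
    · simp [hj]
  simp only [nsq, h, Finset.sum_add_distrib, Finset.sum_ite_eq', Finset.mem_univ, if_true]
  ring

lemma nsq_sub_single (x : Zd d) (i : Fin d) :
    nsq (x - Pi.single i 1) = nsq x - 2 * x i + 1 := by
  have := nsq_add_single x i (-1)
  rw [Pi.single_neg, ← sub_eq_add_neg] at this
  rw [this]; push_cast; ring

lemma avg_nsq [NeZero d] (x : Zd d) : avg nsq x = nsq x + 1 := by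
  have : (d : ℝ) ≠ 0 := by exact_mod_cast NeZero.ne d
  have h : ∀ i : Fin d, nsq (x + Pi.single i 1) + nsq (x - Pi.single i 1) = 2 * nsq x + 2 :=
    fun i => by rw [nsq_add_single, nsq_sub_single]; push_cast; ring
  simp only [avg, h, Finset.sum_const, Finset.card_univ, Fintype.card_fin, nsmul_eq_mul]
  field_simp

/-- The function `x ↦ (|x|² + a)^{-(d-2)/2}`. -/
noncomputable def bump (a : ℝ) (x : Zd d) : ℝ := (√(nsq x + a))⁻¹ ^ (d - 2)

lemma bump_nonneg (a : ℝ) (x : Zd d) : 0 ≤ bump a x := by unfold bump; positivity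

/-- `bump a` is strictly superharmonic when `a` is large. -/
lemma bump_sub_avg_ge (hd : 3 ≤ d) : ∃ C : ℝ, 0 ≤ C ∧ ∀ a : ℝ, 3 ≤ a → ∀ x : Zd d,
    (√(nsq x + a + 1))⁻¹ ^ (d - 2) * ((((d : ℝ) - 2) / 2 * (a + 1) - C) / (nsq x + a + 1) ^ 2)
      ≤ bump a x - avg (bump a) x := by
  obtain ⟨C, hC, hb⟩ := inv_sqrt_one_add_pow_symm_le (d - 2)
  have hd0 : (0 : ℝ) < d := by exact_mod_cast (by omega : 0 < d)
  have hq : ((d - 2 : ℕ) : ℝ) = d - 2 := by rw [Nat.cast_sub (by omega)]; norm_num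
  refine ⟨8 * C / d, by positivity, fun a ha x => ?_⟩
  have hn := nsq_nonneg x
  set t := nsq x + a + 1 with ht
  have ht0 : 0 < t := by positivity
  have hst : 0 < √t := Real.sqrt_pos.mpr ht0
  have key : ∀ r : ℝ, (√(t * (1 + r)))⁻¹ ^ (d - 2)
      = (√t)⁻¹ ^ (d - 2) * (√(1 + r))⁻¹ ^ (d - 2) := fun r => by
    rw [Real.sqrt_mul ht0.le, mul_inv, mul_pow]
  have e0 : bump a x = (√t)⁻¹ ^ (d - 2) * (√(1 - 1 / t))⁻¹ ^ (d - 2) := by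
    rw [sub_eq_add_neg, ← key, bump]
    congr 3; field_simp; rw [ht]; ring
  have lower : (√t)⁻¹ ^ (d - 2) * (1 + ((d : ℝ) - 2) / 2 * (1 / t)) ≤ bump a x := by
    rw [e0, ← hq]
    gcongr
    exact one_add_le_inv_sqrt_one_sub_pow _ (by positivity)
      (by rw [div_lt_one ht0]; linarith)
  have hr : ∀ i, |2 * (x i : ℝ) / t| ≤ 1 / 2 := fun i => by
    rw [abs_div, abs_of_pos ht0, div_le_iff₀ ht0, abs_le]
    have := sq_le_nsq x i
    constructor <;> nlinarith [sq_nonneg ((x i : ℝ) - 2), sq_nonneg ((x i : ℝ) + 2)]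
  have nb : ∀ i : Fin d, bump a (x + Pi.single i 1) + bump a (x - Pi.single i 1)
      ≤ (√t)⁻¹ ^ (d - 2) * (2 + ((d - 2 : ℕ) : ℝ) * (((d - 2 : ℕ) : ℝ) + 2) / 4
        * (2 * (x i : ℝ) / t) ^ 2 + C * (2 * (x i : ℝ) / t) ^ 4) := fun i => by
    have e1 : bump a (x + Pi.single i 1)
        = (√t)⁻¹ ^ (d - 2) * (√(1 + 2 * (x i : ℝ) / t))⁻¹ ^ (d - 2) := by
      rw [← key, bump, nsq_add_single]
      congr 3; field_simp; rw [ht]; push_cast; ring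
    have e2 : bump a (x - Pi.single i 1)
        = (√t)⁻¹ ^ (d - 2) * (√(1 - 2 * (x i : ℝ) / t))⁻¹ ^ (d - 2) := by
      rw [sub_eq_add_neg 1 (2 * (x i : ℝ) / t), ← key, bump, nsq_sub_single]
      congr 3; field_simp; rw [ht]; ring
    rw [e1, e2, ← mul_add]
    exact mul_le_mul_of_nonneg_left (hb _ (hr i)) (by positivity)
  have s2 : ∑ i, (2 * (x i : ℝ) / t) ^ 2 = 4 * (t - a - 1) / t ^ 2 := by
    have : ∀ i, (2 * (x i : ℝ) / t) ^ 2 = 4 / t ^ 2 * (x i : ℝ) ^ 2 := fun i => by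
      field_simp; ring
    simp only [this, ← Finset.mul_sum]
    rw [show ∑ i, (x i : ℝ) ^ 2 = t - a - 1 by rw [ht, nsq]; ring]; ring
  have s4 : ∑ i, (2 * (x i : ℝ) / t) ^ 4 ≤ 16 / t ^ 2 := by
    have h1 : ∑ i, (2 * (x i : ℝ) / t) ^ 4 ≤ (∑ i, (2 * (x i : ℝ) / t) ^ 2) ^ 2 := by
      rw [sq (∑ i, (2 * (x i : ℝ) / t) ^ 2), Finset.mul_sum]
      refine Finset.sum_le_sum fun i _ => ?_
      have := Finset.single_le_sum (f := fun i => (2 * (x i : ℝ) / t) ^ 2)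
        (fun _ _ => sq_nonneg _) (Finset.mem_univ i)
      calc (2 * (x i : ℝ) / t) ^ 4 = (2 * (x i : ℝ) / t) ^ 2 * (2 * (x i : ℝ) / t) ^ 2 := by ring
        _ ≤ _ := mul_le_mul_of_nonneg_right this (sq_nonneg _)
    refine h1.trans ?_
    rw [s2, div_pow, div_le_div_iff₀ (by positivity) (by positivity)]
    have : t - a - 1 ≤ t := by linarith
    have h0 : 0 ≤ t - a - 1 := by rw [ht]; linarith
    have : (4 * (t - a - 1)) ^ 2 ≤ (4 * t) ^ 2 := by gcongr
    nlinarith [sq_nonneg t, mul_le_mul_of_nonneg_right this (sq_nonneg t)]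
  have upper : avg (bump a) x ≤ (√t)⁻¹ ^ (d - 2) * (1 + ((d : ℝ) - 2) / 2 * ((t - a - 1) / t ^ 2)
      + 8 * C / d / t ^ 2) := by
    calc avg (bump a) x ≤ (2 * d : ℝ)⁻¹ * ∑ i : Fin d, ((√t)⁻¹ ^ (d - 2) *
          (2 + ((d - 2 : ℕ) : ℝ) * (((d - 2 : ℕ) : ℝ) + 2) / 4
        * (2 * (x i : ℝ) / t) ^ 2 + C * (2 * (x i : ℝ) / t) ^ 4)) := by
          unfold avg
          gcongr with i
          exact nb i
      _ = (√t)⁻¹ ^ (d - 2) * ((2 * d : ℝ)⁻¹ * (2 * d + ((d : ℝ) - 2) * d / 4 *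
          ∑ i, (2 * (x i : ℝ) / t) ^ 2 + C * ∑ i, (2 * (x i : ℝ) / t) ^ 4)) := by
          rw [← Finset.mul_sum, Finset.sum_add_distrib, Finset.sum_add_distrib,
            ← Finset.mul_sum, ← Finset.mul_sum, hq]
          simp only [Finset.sum_const, Finset.card_univ, Fintype.card_fin, nsmul_eq_mul]
          ring
      _ ≤ (√t)⁻¹ ^ (d - 2) * ((2 * d : ℝ)⁻¹ * (2 * d + ((d : ℝ) - 2) * d / 4 *
          (4 * (t - a - 1) / t ^ 2) + C * (16 / t ^ 2))) := by
          rw [s2]; gcongr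
      _ = _ := by
          field_simp
          ring
  refine le_trans (le_of_eq ?_) (sub_le_sub lower upper)
  field_simp
  ring

lemma bump_tendsto (hd : 3 ≤ d) (a : ℝ) :
    Tendsto (bump a : Zd d → ℝ) cofinite (nhds 0) := by
  have h1 : Tendsto (nsq : Zd d → ℝ) cofinite atTop := by
    rw [tendsto_atTop]
    intro b
    rw [eventually_cofinite]
    refine Set.Finite.subset (Set.finite_Icc (fun _ => -⌈|b|⌉) (fun _ => ⌈|b|⌉)) fun x hx => ?_
    have hx : nsq x < b := not_le.mp hx
    have : ∀ i, |x i| ≤ ⌈|b|⌉ := fun i => by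
      by_contra hc
      push Not at hc
      have h2 : |b| < |(x i : ℝ)| := by
        have : (⌈|b|⌉ : ℝ) < |(x i : ℝ)| := by exact_mod_cast hc
        exact (Int.le_ceil _).trans_lt this
      have h3 : (1 : ℝ) ≤ |(x i : ℝ)| := by
        have : (0 : ℤ) ≤ ⌈|b|⌉ := Int.ceil_nonneg (abs_nonneg b)
        have : (1 : ℤ) ≤ |x i| := by omega
        exact_mod_cast this
      have h4 := sq_le_nsq x i
      rw [← sq_abs] at h4
      nlinarith [le_abs_self b]
    exact ⟨fun i => (abs_le.mp (this i)).1, fun i => (abs_le.mp (this i)).2⟩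
  have h2 : Tendsto (fun x : Zd d => √(nsq x + a)) cofinite atTop :=
    Real.tendsto_sqrt_atTop.comp (tendsto_atTop_add_const_right _ _ h1)
  have h3 := (tendsto_inv_atTop_zero.comp h2).pow (d - 2)
  rwa [zero_pow (by omega)] at h3

end Supersolution

section Green

variable {d : ℕ}

/-- The `n`-step transition probabilities from the origin. -/
noncomputable def stepProb : ℕ → Zd d → ℝ
  | 0 => fun x => if x = 0 then 1 else 0
  | n + 1 => avg (stepProb n)

/-- The Green function of simple random walk. -/
noncomputable def green (x : Zd d) : ℝ := ∑' n, stepProb n x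

lemma stepProb_nonneg (n : ℕ) (x : Zd d) : 0 ≤ stepProb n x := by
  induction n generalizing x with
  | zero => unfold stepProb; split_ifs <;> norm_num
  | succ n ih => exact avg_nonneg ih x

lemma stepProb_neg (n : ℕ) (x : Zd d) : stepProb n (-x) = stepProb n x := by
  induction n generalizing x with
  | zero => simp [stepProb]
  | succ n ih => rw [stepProb, ← avg_neg]; simp only [ih]

lemma green_nonneg (x : Zd d) : 0 ≤ green x := tsum_nonneg fun n => stepProb_nonneg n x

lemma green_neg (x : Zd d) : green (-x) = green x := by simp only [green, stepProb_neg]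

lemma green_sub_comm (x y : Zd d) : green (x - y) = green (y - x) := by
  rw [← neg_sub, green_neg]

lemma sum_stepProb_le (hd : 3 ≤ d) : ∃ a C : ℝ, 3 ≤ a ∧ 0 < C ∧
    ∀ N (x : Zd d), ∑ n ∈ Finset.range N, stepProb n x ≤ C * bump a x := by
  obtain ⟨C, hC, h⟩ := bump_sub_avg_ge hd
  have hd2 : (1 : ℝ) ≤ (d : ℝ) - 2 := by
    have : (3 : ℝ) ≤ d := by exact_mod_cast hd
    linarith
  set a := 3 + 2 * C with ha
  have hnum : 0 < ((d : ℝ) - 2) / 2 * (a + 1) - C := by rw [ha]; nlinarith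
  have hpos : ∀ x : Zd d, 0 < (√(nsq x + a + 1))⁻¹ ^ (d - 2) *
      ((((d : ℝ) - 2) / 2 * (a + 1) - C) / (nsq x + a + 1) ^ 2) := fun x => by
    have := nsq_nonneg x
    positivity
  have hs : ∀ x : Zd d, 0 < bump a x - avg (bump a) x := fun x =>
    (hpos x).trans_le (h a (by linarith) x)
  set δ := bump a (0 : Zd d) - avg (bump a) 0 with hδ
  have hδ0 : 0 < δ := hs 0
  refine ⟨a, δ⁻¹, by linarith, by positivity, fun N => ?_⟩
  induction N with
  | zero => intro x; simpa using mul_nonneg (by positivity) (bump_nonneg a x)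
  | succ N ih =>
    intro x
    rw [Finset.sum_range_succ']
    have h1 : ∑ n ∈ Finset.range N, stepProb (n + 1) x
        = avg (fun y => ∑ n ∈ Finset.range N, stepProb n y) x := (avg_sum _ _ _).symm
    have h2 := avg_mono ih x
    rw [avg_const_mul] at h2
    have h3 : stepProb 0 x ≤ δ⁻¹ * (bump a x - avg (bump a) x) := by
      unfold stepProb
      split_ifs with hx
      · subst hx; rw [← hδ, inv_mul_cancel₀ hδ0.ne']
      · exact mul_nonneg (by positivity) (hs x).le
    rw [h1]; linarith

lemma summable_stepProb (hd : 3 ≤ d) (x : Zd d) : Summable fun n => stepProb n x := by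
  obtain ⟨a, C, -, -, h⟩ := sum_stepProb_le hd
  exact summable_of_sum_range_le (fun n => stepProb_nonneg n x) fun N => h N x

lemma green_le_bump (hd : 3 ≤ d) : ∃ a C : ℝ, 3 ≤ a ∧ 0 < C ∧
    ∀ x : Zd d, green x ≤ C * bump a x := by
  obtain ⟨a, C, ha, hC, h⟩ := sum_stepProb_le hd
  exact ⟨a, C, ha, hC, fun x =>
    Real.tsum_le_of_sum_range_le (fun n => stepProb_nonneg n x) fun N => h N x⟩

lemma green_eq (hd : 3 ≤ d) (x : Zd d) : green x = (if x = 0 then 1 else 0) + avg green x := by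
  have h1 : green x = (if x = 0 then 1 else 0) + ∑' n, avg (stepProb n) x :=
    (summable_stepProb hd x).tsum_eq_zero_add
  have h3 : Tendsto (fun N => avg (fun y => ∑ n ∈ Finset.range N, stepProb n y) x) atTop
      (nhds (avg green x)) :=
    avg_tendsto (fun y => (summable_stepProb hd y).hasSum.tendsto_sum_nat) x
  have h4 : Summable fun n => avg (stepProb n) x :=
    (summable_nat_add_iff (f := fun n => stepProb n x) 1).mpr (summable_stepProb hd x)
  have h5 : ∑' n, avg (stepProb n) x = avg green x :=
    tendsto_nhds_unique h4.hasSum.tendsto_sum_nat (h3.congr fun N => avg_sum _ _ _)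
  rw [h1, h5]

lemma green_tendsto (hd : 3 ≤ d) : Tendsto (green : Zd d → ℝ) cofinite (nhds 0) := by
  obtain ⟨a, C, -, -, h⟩ := green_le_bump hd
  refine squeeze_zero green_nonneg h ?_
  simpa using (bump_tendsto hd a).const_mul C

lemma green_sub_tendsto (hd : 3 ≤ d) (b : Zd d) :
    Tendsto (fun x => green (x - b)) cofinite (nhds 0) :=
  (green_tendsto hd).comp (sub_left_injective (b := b)).tendsto_cofinite

lemma green_sub_avg (hd : 3 ≤ d) (b x : Zd d) :
    green (x - b) - avg (fun y => green (y - b)) x = if x = b then 1 else 0 := by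
  have h := avg_translate green (-b) x
  simp only [← sub_eq_add_neg] at h
  rw [h]
  have := green_eq hd (x - b)
  simp only [sub_eq_zero] at this
  linarith

lemma one_le_green_zero (hd : 3 ≤ d) : 1 ≤ green (0 : Zd d) := by
  have := green_eq hd (0 : Zd d)
  have h2 := avg_nonneg green_nonneg (0 : Zd d)
  simp at this
  linarith

end Green

section Hitting

variable {d : ℕ}

/-- The probability, starting from `x`, of entering `V` within `n` steps, at the point `b`. -/
noncomputable def hitAtWithin (V : Finset (Zd d)) (b : Zd d) : ℕ → Zd d → ℝ
  | 0 => fun x => if x = b then 1 else 0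
  | n + 1 => fun x => if x ∈ V then (if x = b then 1 else 0) else avg (hitAtWithin V b n) x

/-- The probability, starting from `x`, of entering `V` at the point `b`. -/
noncomputable def hitAt (V : Finset (Zd d)) (b x : Zd d) : ℝ := ⨆ n, hitAtWithin V b n x

lemma hitAtWithin_nonneg (V : Finset (Zd d)) (b : Zd d) (n : ℕ) (x : Zd d) :
    0 ≤ hitAtWithin V b n x := by
  induction n generalizing x with
  | zero => unfold hitAtWithin; split_ifs <;> norm_num
  | succ n ih =>
    unfold hitAtWithin
    split_ifs
    · norm_num
    · exact le_rfl
    · exact avg_nonneg ih x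

lemma hitAtWithin_mono {V : Finset (Zd d)} {b : Zd d} (hb : b ∈ V) (n : ℕ) (x : Zd d) :
    hitAtWithin V b n x ≤ hitAtWithin V b (n + 1) x := by
  induction n generalizing x with
  | zero =>
    by_cases hx : x ∈ V
    · simp [hitAtWithin, hx]
    · have : x ≠ b := fun h => hx (h ▸ hb)
      have h2 := hitAtWithin_nonneg V b 1 x
      simpa [hitAtWithin, this] using h2
  | succ n ih =>
    by_cases hx : x ∈ V
    · simp [hitAtWithin, hx]
    · rw [hitAtWithin, hitAtWithin]
      simp only [hx, if_false]
      exact avg_mono ih x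

lemma hitAtWithin_le_green (hd : 3 ≤ d) (V : Finset (Zd d)) (b : Zd d) (n : ℕ) (x : Zd d) :
    hitAtWithin V b n x ≤ green (x - b) := by
  have h0 : ∀ x : Zd d, (if x = b then (1 : ℝ) else 0) ≤ green (x - b) := fun x => by
    split_ifs with h
    · rw [h, sub_self]; exact one_le_green_zero hd
    · exact green_nonneg _
  induction n generalizing x with
  | zero => exact h0 x
  | succ n ih =>
    simp only [hitAtWithin]
    split_ifs with h1 h2
    · simpa [h2] using h0 x
    · exact green_nonneg _
    · have h3 := green_sub_avg hd b x
      have h4 : (0 : ℝ) ≤ if x = b then 1 else 0 := by split_ifs <;> norm_num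
      exact (avg_mono ih x).trans (by linarith)

lemma hitAtWithin_tendsto (hd : 3 ≤ d) {V : Finset (Zd d)} {b : Zd d} (hb : b ∈ V) (x : Zd d) :
    Tendsto (fun n => hitAtWithin V b n x) atTop (nhds (hitAt V b x)) :=
  tendsto_atTop_ciSup (monotone_nat_of_le_succ fun n => hitAtWithin_mono hb n x)
    ⟨green (x - b), by rintro _ ⟨n, rfl⟩; exact hitAtWithin_le_green hd V b n x⟩

lemma hitAt_nonneg (V : Finset (Zd d)) (b x : Zd d) : 0 ≤ hitAt V b x :=
  Real.iSup_nonneg fun n => hitAtWithin_nonneg V b n x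

lemma hitAt_le_green (hd : 3 ≤ d) (V : Finset (Zd d)) (b x : Zd d) :
    hitAt V b x ≤ green (x - b) :=
  ciSup_le fun n => hitAtWithin_le_green hd V b n x

lemma hitAt_vanish (hd : 3 ≤ d) (V : Finset (Zd d)) (b : Zd d) :
    Tendsto (hitAt V b) cofinite (nhds 0) :=
  squeeze_zero (hitAt_nonneg V b) (hitAt_le_green hd V b) (green_sub_tendsto hd b)

lemma hitAt_of_mem {V : Finset (Zd d)} {x : Zd d} (b : Zd d) (hx : x ∈ V) :
    hitAt V b x = if x = b then 1 else 0 := by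
  have : ∀ n, hitAtWithin V b n x = if x = b then 1 else 0 := fun n => by
    cases n <;> simp [hitAtWithin, hx]
  simp [hitAt, this]

lemma hitAt_of_notMem (hd : 3 ≤ d) {V : Finset (Zd d)} {b x : Zd d} (hb : b ∈ V) (hx : x ∉ V) :
    hitAt V b x = avg (hitAt V b) x := by
  have h1 := (tendsto_add_atTop_iff_nat 1).mpr (hitAtWithin_tendsto hd hb x)
  have h2 := avg_tendsto (hitAtWithin_tendsto hd hb) x
  refine tendsto_nhds_unique h1 (h2.congr fun n => ?_)
  simp [hitAtWithin, hx]

/-- The trace of the walk on `V`: one-step transition probabilities of the walk watched on `V`. -/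
noncomputable def trace (V : Finset (Zd d)) (a b : Zd d) : ℝ := avg (hitAt V b) a

/-- The probability of ever hitting `V`. -/
noncomputable def hit (V : Finset (Zd d)) (x : Zd d) : ℝ := ∑ b ∈ V, hitAt V b x

/-- The escape probability. -/
noncomputable def esc (V : Finset (Zd d)) (x : Zd d) : ℝ := 1 - ∑ b ∈ V, trace V x b

/-- The capacity, in terms of escape probabilities. -/
noncomputable def cap (V : Finset (Zd d)) : ℝ := ∑ x ∈ V, esc V x

lemma trace_nonneg (V : Finset (Zd d)) (a b : Zd d) : 0 ≤ trace V a b :=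
  avg_nonneg (hitAt_nonneg V b) a

lemma avg_hit (V : Finset (Zd d)) (x : Zd d) : avg (hit V) x = 1 - esc V x := by
  simp only [esc, trace, sub_sub_cancel, ← avg_sum]; rfl

lemma hit_vanish (hd : 3 ≤ d) (V : Finset (Zd d)) : Tendsto (hit V) cofinite (nhds 0) := by
  have := tendsto_finsetSum V fun b _ => hitAt_vanish hd V b
  simp only [Finset.sum_const_zero] at this
  exact this

lemma hit_of_mem {V : Finset (Zd d)} {x : Zd d} (hx : x ∈ V) : hit V x = 1 := by
  simp [hit, hitAt_of_mem _ hx, hx]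

lemma hit_of_notMem (hd : 3 ≤ d) {V : Finset (Zd d)} {x : Zd d} (hx : x ∉ V) :
    hit V x = avg (hit V) x := by
  have : avg (hit V) x = ∑ b ∈ V, avg (hitAt V b) x := avg_sum V (hitAt V) x
  rw [this, hit]
  exact Finset.sum_congr rfl fun b hb => hitAt_of_notMem hd hb hx

/-- The iterates of the trace kernel applied to the constant function `1`. -/
noncomputable def traceIter (V : Finset (Zd d)) : ℕ → Zd d → ℝ
  | 0 => fun _ => 1
  | n + 1 => fun x => ∑ b ∈ V, trace V x b * traceIter V n b

lemma traceIter_nonneg (V : Finset (Zd d)) (n : ℕ) (x : Zd d) : 0 ≤ traceIter V n x := by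
  induction n generalizing x with
  | zero => exact zero_le_one
  | succ n ih => exact Finset.sum_nonneg fun b _ => mul_nonneg (trace_nonneg _ _ _) (ih b)

variable [NeZero d]

lemma hit_le_of_superharmonic (hd : 3 ≤ d) (V : Finset (Zd d)) {f : Zd d → ℝ}
    (h0 : ∀ x, 0 ≤ f x) (hs : ∀ x, avg f x ≤ f x) (h1 : ∀ x ∈ V, 1 ≤ f x) (x : Zd d) :
    hit V x ≤ f x := by
  have := max_principle_compl (F := fun x => hit V x - f x) (G := hit V) (V : Set (Zd d))
    (fun x => by linarith [h0 x]) (hit_vanish hd V)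
    (fun x hx => by rw [hit_of_mem hx]; linarith [h1 x hx])
    (fun x hx => by rw [avg_sub, ← hit_of_notMem hd hx]; linarith [hs x]) x
  linarith

lemma hit_le_one (hd : 3 ≤ d) (V : Finset (Zd d)) (x : Zd d) : hit V x ≤ 1 :=
  hit_le_of_superharmonic hd V (f := fun _ => 1) (fun _ => zero_le_one)
    (fun x => by rw [avg_const]) (fun _ _ => le_rfl) x

lemma esc_nonneg (hd : 3 ≤ d) (V : Finset (Zd d)) (x : Zd d) : 0 ≤ esc V x := by
  have h1 := avg_mono (hit_le_one hd V) x
  rw [avg_const, avg_hit] at h1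
  linarith

lemma cap_nonneg (hd : 3 ≤ d) (V : Finset (Zd d)) : 0 ≤ cap V :=
  Finset.sum_nonneg fun x _ => esc_nonneg hd V x

/-- A function vanishing at infinity, harmonic off `V`, is determined by its values on `V`. -/
lemma eq_sum_hitAt (hd : 3 ≤ d) {V : Finset (Zd d)} {F : Zd d → ℝ}
    (hF : Tendsto F cofinite (nhds 0)) (hh : ∀ x ∉ V, F x = avg F x) (x : Zd d) :
    F x = ∑ b ∈ V, F b * hitAt V b x := by
  refine congrFun (dirichlet_unique (V : Set (Zd d)) hF ?_ ?_ ?_ :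
    F = fun x => ∑ b ∈ V, F b * hitAt V b x) x
  · simpa using tendsto_finsetSum V fun b _ => (hitAt_vanish hd V b).const_mul (F b)
  · intro x hx
    rw [Finset.sum_congr rfl fun b _ => by rw [hitAt_of_mem b hx]]
    simp only [mul_ite, mul_one, mul_zero, Finset.sum_ite_eq]
    exact (if_pos hx).symm
  · intro x hx
    rw [avg_sum, Finset.sum_congr rfl fun b _ => avg_const_mul (F b) (hitAt V b) x,
      Finset.sum_congr rfl fun b hb => by rw [hitAt_of_notMem hd hb hx]]
    linarith [hh x hx]

/-- The Green representation of a function vanishing at infinity and harmonic off `V`. -/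
lemma eq_sum_green (hd : 3 ≤ d) {V : Finset (Zd d)} {F : Zd d → ℝ}
    (hF : Tendsto F cofinite (nhds 0)) (hh : ∀ x ∉ V, F x = avg F x) (x : Zd d) :
    F x = ∑ c ∈ V, (F c - avg F c) * green (x - c) := by
  refine congrFun (dirichlet_unique (∅ : Set (Zd d)) hF ?_ (by simp) ?_ :
    F = fun x => ∑ c ∈ V, (F c - avg F c) * green (x - c)) x
  · simpa using tendsto_finsetSum V fun c _ => (green_sub_tendsto hd c).const_mul (F c - avg F c)
  · intro x _
    rw [avg_sum, ← Finset.sum_sub_distrib]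
    have : ∀ c ∈ V, (F c - avg F c) * green (x - c)
        - avg (fun y => (F c - avg F c) * green (y - c)) x
        = if x = c then F c - avg F c else 0 := fun c _ => by
      rw [avg_const_mul, ← mul_sub, green_sub_avg hd]; simp
    rw [Finset.sum_congr rfl this, Finset.sum_ite_eq]
    split_ifs with hx
    · rfl
    · linarith [hh x hx]

lemma hit_eq_sum_green (hd : 3 ≤ d) (V : Finset (Zd d)) (x : Zd d) :
    hit V x = ∑ c ∈ V, esc V c * green (x - c) := by
  rw [eq_sum_green hd (hit_vanish hd V) (fun x hx => hit_of_notMem hd hx) x]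
  refine Finset.sum_congr rfl fun c hc => ?_
  rw [hit_of_mem hc, avg_hit]; ring

lemma hitAt_eq_sum_green (hd : 3 ≤ d) {V : Finset (Zd d)} {b : Zd d} (hb : b ∈ V) (x : Zd d) :
    hitAt V b x = ∑ c ∈ V, ((if c = b then 1 else 0) - trace V c b) * green (x - c) := by
  rw [eq_sum_green hd (hitAt_vanish hd V b) (fun x hx => hitAt_of_notMem hd hb hx) x]
  exact Finset.sum_congr rfl fun c hc => by rw [hitAt_of_mem b hc]; rfl

lemma trace_symm (hd : 3 ≤ d) {V : Finset (Zd d)} {a b : Zd d} (ha : a ∈ V) (hb : b ∈ V) :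
    trace V a b = trace V b a := by
  classical
  let g : Matrix V V ℝ := fun x y => green (x.1 - y.1)
  let A : Matrix V V ℝ := fun x y => (if x = y then 1 else 0) - trace V x.1 y.1
  have hgA : g * A = 1 := by
    ext x y
    have h := hitAt_eq_sum_green hd y.2 x.1
    rw [hitAt_of_mem _ x.2] at h
    rw [Matrix.mul_apply, Matrix.one_apply]
    simp only [Subtype.ext_iff, g, A]
    rw [h, ← Finset.sum_coe_sort V]
    exact Finset.sum_congr rfl fun c _ => by ring
  have hg : g.transpose = g := by
    ext x y
    exact green_sub_comm _ _
  have hA : A.transpose = A := by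
    have h1 : A * g = 1 := mul_eq_one_comm.mp hgA
    have h2 : A.transpose * g = 1 := by
      have := congrArg Matrix.transpose hgA
      rwa [Matrix.transpose_mul, hg, Matrix.transpose_one] at this
    calc A.transpose = A.transpose * (g * A) := by rw [hgA, mul_one]
      _ = A := by rw [← mul_assoc, h2, one_mul]
  have h : A ⟨b, hb⟩ ⟨a, ha⟩ = A ⟨a, ha⟩ ⟨b, hb⟩ := congrFun (congrFun hA ⟨a, ha⟩) ⟨b, hb⟩
  simp only [A, Subtype.mk.injEq] at h
  by_cases hab : a = b
  · rw [hab]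
  · rw [if_neg hab, if_neg (Ne.symm hab)] at h
    linarith

/-- The sweeping identity for capacities. -/
lemma sum_esc_hit (hd : 3 ≤ d) {B V : Finset (Zd d)} (hBV : B ⊆ V) :
    ∑ a ∈ V, esc V a * hit B a = cap B := by
  calc ∑ a ∈ V, esc V a * hit B a
      = ∑ c ∈ B, esc B c * ∑ a ∈ V, esc V a * green (c - a) := by
        simp only [hit_eq_sum_green hd B, Finset.mul_sum]
        rw [Finset.sum_comm]
        exact Finset.sum_congr rfl fun c _ => Finset.sum_congr rfl fun a _ => by
          rw [green_sub_comm]; ring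
    _ = cap B := Finset.sum_congr rfl fun c hc => by
        rw [← hit_eq_sum_green hd, hit_of_mem (hBV hc), mul_one]

lemma hit_eq_sum_hitAt (hd : 3 ≤ d) {B V : Finset (Zd d)} (hBV : B ⊆ V) (x : Zd d) :
    hit B x = ∑ z ∈ V, hit B z * hitAt V z x :=
  eq_sum_hitAt hd (hit_vanish hd B) (fun _ hx => hit_of_notMem hd fun h => hx (hBV h)) x

/-- The equation for the escape probabilities in terms of the trace on a larger set. -/
lemma esc_eq_trace (hd : 3 ≤ d) {B V : Finset (Zd d)} (hBV : B ⊆ V) (x : Zd d) :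
    esc B x = esc V x + ∑ z ∈ V, trace V x z * (1 - hit B z) := by
  have h1 : avg (hit B) x = ∑ z ∈ V, hit B z * trace V x z := by
    conv_lhs => rw [show hit B = fun x => ∑ z ∈ V, hit B z * hitAt V z x from
      funext (hit_eq_sum_hitAt hd hBV)]
    rw [avg_sum]
    exact Finset.sum_congr rfl fun z _ => avg_const_mul _ _ _
  rw [avg_hit] at h1
  simp only [mul_sub, mul_one, Finset.sum_sub_distrib]
  have h2 : ∑ z ∈ V, trace V x z * hit B z = ∑ z ∈ V, hit B z * trace V x z :=
    Finset.sum_congr rfl fun z _ => mul_comm _ _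
  have h3 : esc V x = 1 - ∑ z ∈ V, trace V x z := rfl
  rw [h2, ← h1, h3]
  ring

lemma trace_mono (hd : 3 ≤ d) {B V : Finset (Zd d)} (hBV : B ⊆ V) {b : Zd d} (hb : b ∈ B)
    (a : Zd d) : trace V a b ≤ trace B a b := by
  refine avg_mono (fun x => ?_) a
  have := max_principle_compl (F := fun x => hitAt V b x - hitAt B b x) (G := hitAt V b)
    (V : Set (Zd d)) (fun x => by linarith [hitAt_nonneg B b x]) (hitAt_vanish hd V b)
    (fun x hx => by
      rw [hitAt_of_mem b hx]
      split_ifs with h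
      · rw [h, hitAt_of_mem b hb, if_pos rfl]; simp
      · linarith [hitAt_nonneg B b x])
    (fun x hx => by
      rw [avg_sub, ← hitAt_of_notMem hd (hBV hb) hx,
        ← hitAt_of_notMem hd hb fun h => hx (hBV h)]) x
  linarith

lemma esc_anti (hd : 3 ≤ d) {B V : Finset (Zd d)} (hBV : B ⊆ V) (x : Zd d) :
    esc V x ≤ esc B x := by
  rw [esc_eq_trace hd hBV x]
  exact le_add_of_nonneg_right (Finset.sum_nonneg fun z _ =>
    mul_nonneg (trace_nonneg _ _ _) (by linarith [hit_le_one hd B z]))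

lemma traceIter_anti (hd : 3 ≤ d) (V : Finset (Zd d)) (n : ℕ) (x : Zd d) :
    traceIter V (n + 1) x ≤ traceIter V n x := by
  induction n generalizing x with
  | zero =>
    have := esc_nonneg hd V x
    simp only [traceIter, mul_one]
    simp only [esc] at this
    linarith
  | succ n ih =>
    rw [traceIter, traceIter]
    exact Finset.sum_le_sum fun b _ => mul_le_mul_of_nonneg_left (ih b) (trace_nonneg _ _ _)

lemma traceIter_tendsto (hd : 3 ≤ d) (V : Finset (Zd d)) {x : Zd d} (hx : x ∈ V) :
    Tendsto (fun n => traceIter V n x) atTop (nhds 0) := by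
  have hlim : ∀ x, Tendsto (fun n => traceIter V n x) atTop (nhds (⨅ n, traceIter V n x)) :=
    fun x => tendsto_atTop_ciInf (antitone_nat_of_succ_le fun n => traceIter_anti hd V n x)
      ⟨0, by rintro _ ⟨n, rfl⟩; exact traceIter_nonneg V n x⟩
  set p : Zd d → ℝ := fun x => ⨅ n, traceIter V n x with hp
  have hfix : ∀ x, p x = ∑ b ∈ V, trace V x b * p b := fun x =>
    tendsto_nhds_unique ((tendsto_add_atTop_iff_nat 1).mpr (hlim x))
      (tendsto_finsetSum V fun b _ => (hlim b).const_mul (trace V x b))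
  have hF : Tendsto (fun x => ∑ b ∈ V, p b * hitAt V b x) cofinite (nhds 0) := by
    simpa using tendsto_finsetSum V fun b _ => (hitAt_vanish hd V b).const_mul (p b)
  have hval : ∀ x ∈ V, ∑ b ∈ V, p b * hitAt V b x = p x := fun x hx => by
    rw [Finset.sum_congr rfl fun b _ => by rw [hitAt_of_mem b hx]]
    simp [hx]
  have hzero : (fun x => ∑ b ∈ V, p b * hitAt V b x) = fun _ => (0 : ℝ) := by
    refine dirichlet_unique (∅ : Set (Zd d)) hF tendsto_const_nhds (by simp) fun x _ => ?_
    rw [avg_const, sub_self, avg_sum, Finset.sum_congr rfl fun b _ => avg_const_mul (p b) _ x,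
      sub_eq_zero]
    by_cases hx : x ∈ V
    · rw [hval x hx, hfix x]
      exact Finset.sum_congr rfl fun b _ => mul_comm _ _
    · exact Finset.sum_congr rfl fun b hb => by rw [hitAt_of_notMem hd hb hx]
  have := hlim x
  rwa [show (⨅ n, traceIter V n x) = 0 from (hval x hx).symm.trans (congrFun hzero x)] at this

end Hitting

section Walk

variable {d : ℕ}

/-- The probability of not visiting `V` at times `1, …, n`. -/
noncomputable def avoid (V : Finset (Zd d)) : ℕ → Zd d → ℝ
  | 0 => fun _ => 1
  | n + 1 => avg fun y => if y ∈ V then 0 else avoid V n y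

lemma avoid_nonneg (V : Finset (Zd d)) (n : ℕ) (x : Zd d) : 0 ≤ avoid V n x := by
  induction n generalizing x with
  | zero => exact zero_le_one
  | succ n ih =>
    refine avg_nonneg (fun y => ?_) x
    split_ifs
    · exact le_rfl
    · exact ih y

lemma ite_avoid [NeZero d] (V : Finset (Zd d)) (n : ℕ) (y : Zd d) :
    (if y ∈ V then 0 else avoid V n y) = 1 - ∑ b ∈ V, hitAtWithin V b n y := by
  induction n generalizing y with
  | zero => by_cases hy : y ∈ V <;> simp [hy, avoid, hitAtWithin]
  | succ n ih =>
    by_cases hy : y ∈ V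
    · simp [hy, hitAtWithin]
    · simp only [hy, if_false, avoid, ih, hitAtWithin, avg_sub, avg_const, avg_sum]

lemma avoid_tendsto [NeZero d] (hd : 3 ≤ d) (V : Finset (Zd d)) (x : Zd d) :
    Tendsto (fun n => avoid V n x) atTop (nhds (esc V x)) := by
  rw [← tendsto_add_atTop_iff_nat 1]
  have h1 : ∀ y, Tendsto (fun n => 1 - ∑ b ∈ V, hitAtWithin V b n y) atTop
      (nhds (1 - hit V y)) := fun y =>
    tendsto_const_nhds.sub (tendsto_finsetSum V fun b hb => hitAtWithin_tendsto hd hb y)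
  have h2 := avg_tendsto h1 x
  rw [avg_sub, avg_const, avg_hit, sub_sub_cancel] at h2
  simpa only [avoid, ite_avoid] using h2

/-- The neighbours of a point, indexed by a coordinate and a sign. -/
def nbr (x : Zd d) (p : Fin d × Bool) : Zd d :=
  if p.2 then x + Pi.single p.1 1 else x - Pi.single p.1 1

lemma nbr_apply (x : Zd d) (p : Fin d × Bool) (j : Fin d) :
    nbr x p j = x j + if j = p.1 then (if p.2 then 1 else -1) else 0 := by
  obtain ⟨i, b⟩ := p
  cases b <;> by_cases h : j = i <;> simp [nbr, h]; ring

lemma nbr_injective (x : Zd d) : Function.Injective (nbr x) := by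
  intro p q h
  have h1 := congrFun h p.1
  rw [nbr_apply, nbr_apply, if_pos rfl] at h1
  have h2 : p.1 = q.1 := by
    by_contra hne
    rw [if_neg hne] at h1
    split_ifs at h1 <;> omega
  rw [if_pos h2] at h1
  refine Prod.ext h2 ?_
  cases hp : p.2 <;> cases hq : q.2 <;> simp_all

lemma adj_iff (x y : Zd d) : adj x y ↔ y ∈ Set.range (nbr x) := by
  constructor
  · intro h
    have hne : ∃ i, x i - y i ≠ 0 := by
      by_contra hcon
      push Not at hcon
      simp [adj, hcon] at h
    obtain ⟨i, hi⟩ := hne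
    have hs := Finset.add_sum_erase Finset.univ (fun i => |x i - y i|) (Finset.mem_univ i)
    have h0 : 0 ≤ ∑ j ∈ Finset.univ.erase i, |x j - y j| :=
      Finset.sum_nonneg fun _ _ => abs_nonneg _
    have h1 : 1 ≤ |x i - y i| := Int.one_le_abs hi
    simp only [adj] at h
    have h2 : ∑ j ∈ Finset.univ.erase i, |x j - y j| = 0 := by linarith
    have h3 : |x i - y i| = 1 := by linarith
    have h4 : ∀ j, j ≠ i → y j = x j := fun j hj => by
      have := (Finset.sum_eq_zero_iff_of_nonneg fun _ _ => abs_nonneg _).mp h2 j (by simp [hj])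
      rw [abs_eq_zero] at this
      omega
    refine ⟨(i, decide (y i = x i + 1)), funext fun j => ?_⟩
    rw [nbr_apply]
    by_cases hj : j = i
    · subst hj
      rcases abs_eq (zero_le_one) |>.mp h3 with h5 | h5
      · have : y j ≠ x j + 1 := by omega
        simp [this]; omega
      · have : y j = x j + 1 := by omega
        simp [this]
    · simp [hj, h4 j hj]
  · rintro ⟨p, rfl⟩
    simp only [adj, nbr_apply, sub_add_cancel_left, abs_neg]
    rw [Finset.sum_eq_single p.1 (fun j _ hj => by simp [hj]) (by simp)]
    cases p.2 <;> simp

lemma avg_eq_sum_nbr (f : Zd d → ℝ) (x : Zd d) :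
    avg f x = (2 * d : ℝ)⁻¹ * ∑ p, f (nbr x p) := by
  rw [Fintype.sum_prod_type]
  simp [avg, nbr]

lemma measurableSet_forall_mem (p : ℕ → Prop) (T : ℕ → Set (Zd d)) :
    MeasurableSet {ω : ℕ → Zd d | ∀ k, p k → ω k ∈ T k} := by
  simp only [Set.ofPred_forall]
  exact MeasurableSet.iInter fun k => MeasurableSet.iInter fun _ =>
    measurable_pi_apply k (MeasurableSet.of_discrete)

lemma measurableSet_eval_eq (m : ℕ) (y : Zd d) : MeasurableSet {ω : ℕ → Zd d | ω m = y} :=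
  (measurable_pi_apply m : Measurable fun ω : ℕ → Zd d => ω m) (measurableSet_singleton y)

lemma measure_avoid [NeZero d] {P : Zd d → Measure (ℕ → Zd d)} (hP : IsSRW d P) (V : Finset (Zd d))
    (x : Zd d) (n m : ℕ) (w : ℕ → Zd d) (hw : w 0 = x ∧ ∀ k < m, adj (w k) (w (k + 1))) :
    P x ({ω | ∀ k, k ≤ m → ω k ∈ ({w k} : Set (Zd d))} ∩
        {ω | ∀ k, (m < k ∧ k ≤ m + n) → ω k ∈ ((V : Set (Zd d))ᶜ)})
      = ENNReal.ofReal ((2 * d : ℝ)⁻¹ ^ m * avoid V n (w m)) := by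
  have h2d : ((2 * d : ENNReal))⁻¹ = ENNReal.ofReal (2 * d : ℝ)⁻¹ := by
    have : (0 : ℝ) < d := by exact_mod_cast Nat.pos_of_ne_zero (NeZero.ne d)
    rw [ENNReal.ofReal_inv_of_pos (by positivity), ENNReal.ofReal_mul (by norm_num)]
    simp
  induction n generalizing m w with
  | zero =>
    rw [avoid, mul_one, ENNReal.ofReal_pow (by positivity), ← h2d, ← hP.2.1 x m w hw]
    congr 1
    ext ω
    simp only [Set.mem_inter_iff, Set.mem_ofPred_eq, Set.mem_singleton_iff, and_iff_left_iff_imp]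
    intro _ k hk
    omega
  | succ n ih =>
    set S := {ω : ℕ → Zd d | ∀ k, k ≤ m → ω k ∈ ({w k} : Set (Zd d))} ∩
        {ω | ∀ k, (m < k ∧ k ≤ m + (n + 1)) → ω k ∈ ((V : Set (Zd d))ᶜ)} with hS
    have hSm : MeasurableSet S :=
      (measurableSet_forall_mem _ _).inter (measurableSet_forall_mem _ _)
    have hSy : ∀ y, MeasurableSet (S ∩ {ω | ω (m + 1) = y}) := fun y =>
      hSm.inter (measurableSet_eval_eq (m + 1) y)
    have hunion : P x S = ∑' y, P x (S ∩ {ω | ω (m + 1) = y}) := by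
      rw [← measure_iUnion _ hSy]
      · congr 1
        ext ω
        simp
      · intro y z hyz
        refine Set.disjoint_left.mpr fun ω h1 h2 => hyz ?_
        exact h1.2.symm.trans h2.2
    let w' : Zd d → ℕ → Zd d := fun y => Function.update w (m + 1) y
    have hw' : ∀ y, ∀ k ≤ m, w' y k = w k := fun y k hk =>
      Function.update_of_ne (by omega) _ _
    have hw'' : ∀ y, w' y (m + 1) = y := fun y => Function.update_self _ _ _
    have hterm : ∀ p, P x (S ∩ {ω | ω (m + 1) = nbr (w m) p})
        = ENNReal.ofReal ((2 * d : ℝ)⁻¹ ^ (m + 1) *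
          if nbr (w m) p ∈ V then 0 else avoid V n (nbr (w m) p)) := by
      intro p
      set y := nbr (w m) p with hy
      by_cases hyV : y ∈ V
      · rw [if_pos hyV, mul_zero, ENNReal.ofReal_zero]
        convert measure_empty (μ := P x)
        ext ω
        simp only [Set.mem_inter_iff, Set.mem_ofPred_eq, Set.mem_empty_iff_false, iff_false, not_and,
          hS]
        rintro ⟨-, h⟩ h1
        exact h (m + 1) (by omega) (by rw [h1]; exact hyV)
      · rw [if_neg hyV]
        have := ih (m + 1) (w' y) ⟨by rw [hw' y 0 (by omega)]; exact hw.1, fun k hk => by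
          rcases Nat.lt_succ_iff_lt_or_eq.mp hk with h | h
          · rw [hw' y k h.le, hw' y (k + 1) h]; exact hw.2 k h
          · rw [h, hw' y m le_rfl, hw'', adj_iff]; exact ⟨p, rfl⟩⟩
        rw [hw''] at this
        rw [← this]
        congr 1
        ext ω
        simp only [hS, Set.mem_inter_iff, Set.mem_ofPred_eq, Set.mem_singleton_iff]
        constructor
        · rintro ⟨⟨h1, h2⟩, h3⟩
          refine ⟨fun k hk => ?_, fun k hk => h2 k (by omega)⟩
          rcases Nat.le_succ_iff.mp hk with h | h
          · rw [hw' y k h]; exact h1 k h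
          · rw [h, hw'']; exact h3
        · rintro ⟨h1, h2⟩
          have h3 : ω (m + 1) = y := by rw [h1 (m + 1) le_rfl, hw'']
          refine ⟨⟨fun k hk => ?_, fun k hk => ?_⟩, h3⟩
          · rw [h1 k (by omega), hw' y k hk]
          · by_cases hk1 : k = m + 1
            · rw [hk1, h3]; exact hyV
            · exact h2 k (by omega)
    have hsupp : Function.support (fun y => P x (S ∩ {ω | ω (m + 1) = y}))
        ⊆ Set.range (nbr (w m)) := by
      intro y hy
      rw [← adj_iff]
      by_contra hadj
      refine hy (measure_mono_null ?_ (hP.2.2 x (m + 1) (w' y) fun h => hadj ?_))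
      · rintro ω ⟨⟨h1, -⟩, h3⟩ k hk
        rcases Nat.le_succ_iff.mp hk with h | h
        · rw [hw' y k h]; exact h1 k h
        · rw [h, hw'']; exact h3
      · have := h.2 m (Nat.lt_succ_self m)
        rwa [hw' y m le_rfl, hw''] at this
    rw [hunion, ← (nbr_injective (w m)).tsum_eq hsupp, tsum_fintype,
      Finset.sum_congr rfl fun p _ => hterm p, ← ENNReal.ofReal_sum_of_nonneg, ← Finset.mul_sum,
      avoid, avg_eq_sum_nbr, ← mul_assoc, pow_succ]
    intro p _
    have := avoid_nonneg V n (nbr (w m) p)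
    split_ifs <;> positivity

lemma capa_eq_cap [NeZero d] (hd : 3 ≤ d) {P : Zd d → Measure (ℕ → Zd d)} (hP : IsSRW d P)
    (K : Finset (Zd d)) : capa P K = cap K := by
  refine Finset.sum_congr rfl fun x hx => ?_
  have := hP.1 x
  rw [eqm, Set.indicator_of_mem (by exact_mod_cast hx)]
  set S : ℕ → Set (ℕ → Zd d) := fun n =>
    {ω | ∀ k, k ≤ 0 → ω k ∈ ({x} : Set (Zd d))} ∩
      {ω | ∀ k, (0 < k ∧ k ≤ 0 + n) → ω k ∈ ((K : Set (Zd d))ᶜ)} with hS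
  have hval : ∀ n, P x (S n) = ENNReal.ofReal (avoid K n x) := fun n => by
    have := measure_avoid hP K x n 0 (fun _ => x) ⟨rfl, by simp⟩
    rwa [pow_zero, one_mul] at this
  have hlim : Tendsto (fun n => P x (S n)) atTop (nhds (P x (⋂ n, S n))) :=
    tendsto_measure_iInter_atTop
      (fun n => ((measurableSet_forall_mem _ _).inter
        (measurableSet_forall_mem _ _)).nullMeasurableSet)
      (fun m n hmn ω h => ⟨h.1, fun k hk => h.2 k (by omega)⟩) ⟨0, measure_ne_top _ _⟩
  have hlim2 : Tendsto (fun n => P x (S n)) atTop (nhds (ENNReal.ofReal (esc K x))) := by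
    simp only [hval]
    exact ENNReal.tendsto_ofReal (avoid_tendsto hd K x)
  have hnull : P x {ω | ω 0 ≠ x} = 0 := by
    have h1 : P x {ω | ω 0 = x} = 1 := by
      simpa using hP.2.1 x 0 (fun _ => x) ⟨rfl, by simp⟩
    exact (prob_compl_eq_zero_iff (measurableSet_eval_eq 0 x)).mpr h1
  have heq : P x {ω | ∀ n, 1 ≤ n → ω n ∉ (K : Set (Zd d))} = P x (⋂ n, S n) := by
    refine le_antisymm ?_ (measure_mono fun ω h n hn => ?_)
    · calc _ ≤ P x ((⋂ n, S n) ∪ {ω | ω 0 ≠ x}) := measure_mono fun ω h => by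
            by_cases h0 : ω 0 = x
            · refine Or.inl (Set.mem_iInter.mpr fun n => ⟨fun k hk => ?_, fun k hk => h k hk.1⟩)
              rw [Nat.le_zero.mp hk]; exact h0
            · exact Or.inr h0
        _ ≤ _ := (measure_union_le _ _).trans (by rw [hnull, add_zero])
    · exact (Set.mem_iInter.mp h n).2 n ⟨hn, by omega⟩
  rw [heq, tendsto_nhds_unique hlim hlim2, ENNReal.toReal_ofReal (esc_nonneg hd K x)]

end Walk

section Translation

variable {d : ℕ}

lemma hitAtWithin_translate (V : Finset (Zd d)) (a b : Zd d) (n : ℕ) (x : Zd d) :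
    hitAtWithin (V.map (addRightEmbedding a)) (b + a) n (x + a) = hitAtWithin V b n x := by
  induction n generalizing x with
  | zero => simp [hitAtWithin]
  | succ n ih =>
    have h : x + a ∈ V.map (addRightEmbedding a) ↔ x ∈ V := by simp
    simp only [hitAtWithin, h, add_left_inj, ← avg_translate, ih]

lemma cap_translate (V : Finset (Zd d)) (a : Zd d) :
    cap (V.map (addRightEmbedding a)) = cap V := by
  have h : ∀ x b, trace (V.map (addRightEmbedding a)) (x + a) (b + a) = trace V x b := fun x b => by
    simp only [trace, ← avg_translate, hitAt, hitAtWithin_translate]; rfl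
  simp only [cap, esc, Finset.sum_map, addRightEmbedding_apply, h]

end Translation

section Cone

variable {X : Type*}

/-- The closed cone of pointwise limits of polynomials with nonnegative coefficients in `s`. -/
noncomputable def cone (s : Set (X → ℝ)) : Subalgebra ℝ≥0 (X → ℝ) :=
  (Algebra.adjoin ℝ≥0 s).topologicalClosure

variable {s t : Set (X → ℝ)} {F G : X → ℝ}

lemma subset_cone (hF : F ∈ s) : F ∈ cone s :=
  Subalgebra.le_topologicalClosure _ (Algebra.subset_adjoin hF)

lemma cone_mono (h : s ⊆ t) : cone s ≤ cone t :=
  Subalgebra.topologicalClosure_mono (Algebra.adjoin_mono h)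

lemma cone_const {c : ℝ} (hc : 0 ≤ c) : (fun _ => c) ∈ cone s :=
  (cone s).algebraMap_mem ⟨c, hc⟩

lemma cone_const_mul {c : ℝ} (hc : 0 ≤ c) (hF : F ∈ cone s) : (fun x => c * F x) ∈ cone s :=
  (cone s).mul_mem (cone_const hc) hF

lemma cone_of_tendsto {f : ℕ → X → ℝ} (hf : ∀ n, f n ∈ cone s)
    (h : ∀ x, Tendsto (fun n => f n x) atTop (nhds (F x))) : F ∈ cone s :=
  (Subalgebra.isClosed_topologicalClosure (Algebra.adjoin ℝ≥0 s)).mem_of_tendsto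
    (tendsto_pi_nhds.mpr h) (Eventually.of_forall hf)

lemma cone_tsum {a : ℕ → ℝ} (ha : ∀ n, 0 ≤ a n) (hF : F ∈ cone s)
    (h : ∀ x, HasSum (fun n => a n * F x ^ n) (G x)) : G ∈ cone s := by
  refine cone_of_tendsto (f := fun N x => ∑ n ∈ Finset.range N, a n * F x ^ n) (fun N => ?_)
    fun x => (h x).tendsto_sum_nat
  have : (fun x => ∑ n ∈ Finset.range N, a n * F x ^ n)
      = ∑ n ∈ Finset.range N, (fun _ => a n) * F ^ n := by
    ext x; simp
  rw [this]
  exact Subalgebra.sum_mem _ fun n _ => mul_mem (cone_const (ha n)) (pow_mem hF n)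

lemma cone_exp (hF : F ∈ cone s) : (fun x => Real.exp (F x)) ∈ cone s := by
  refine cone_tsum (a := fun n => ((n.factorial : ℝ))⁻¹) (fun n => by positivity) hF fun x => ?_
  have := NormedSpace.expSeries_div_hasSum_exp (F x)
  rw [← Real.exp_eq_exp_ℝ] at this
  simpa [div_eq_inv_mul] using this

lemma cone_exp_sub {c : ℝ} (hF : F ∈ cone s) : (fun x => Real.exp (F x - c)) ∈ cone s := by
  have h := cone_const_mul (Real.exp_pos (-c)).le (cone_exp hF)
  simpa only [← Real.exp_add, neg_add_eq_sub] using h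

lemma cone_geom (hF : F ∈ cone s) (h : ∀ x, |F x| < 1) : (fun x => (1 - F x)⁻¹) ∈ cone s :=
  cone_tsum (a := fun _ => 1) (fun _ => zero_le_one) hF fun x => by
    simpa using hasSum_geometric_of_abs_lt_one (h x)

/-- A continuous linear functional that is nonnegative on monomials is nonnegative on the cone. -/
lemma cone_pos {φ : (X → ℝ) → ℝ} (hc : Continuous φ) (ha : ∀ F G, φ (F + G) = φ F + φ G)
    (hs : ∀ (c : ℝ) F, φ (c • F) = c * φ F) (hm : ∀ F ∈ Submonoid.closure s, 0 ≤ φ F)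
    (hF : F ∈ cone s) : 0 ≤ φ F := by
  have hcl : IsClosed {F | 0 ≤ φ F} := isClosed_le continuous_const hc
  have hsub : (Algebra.adjoin ℝ≥0 s : Set (X → ℝ)) ⊆ {F | 0 ≤ φ F} := by
    intro F hF
    have hF' : F ∈ Submodule.span ℝ≥0 (Submonoid.closure s : Set (X → ℝ)) := by
      rw [← Algebra.adjoin_eq_span]; exact hF
    change 0 ≤ φ F
    clear hF
    induction hF' using Submodule.span_induction with
    | mem F h => exact hm F h
    | zero => have := hs 0 0; simp at this; exact this.ge
    | add F G _ _ h1 h2 => rw [ha]; exact add_nonneg h1 h2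
    | smul c F _ h =>
      have : φ (c • F) = c * φ F := hs c F
      rw [this]; exact mul_nonneg c.2 h
  exact (closure_minimal hsub hcl) hF

/-- Solutions of linear equations with nonnegative coefficients belong to the cone. -/
lemma cone_fixed_point {α : Type*} {J : Finset α} {Y f z : α → X → ℝ} {p : α → α → ℝ}
    {q : ℕ → α → ℝ}
    (hY : ∀ j ∈ J, ∀ x, Y j x = f j x + ∑ l ∈ J, p j l * (z l x * Y l x))
    (hf : ∀ j ∈ J, f j ∈ cone s) (hz : ∀ j ∈ J, z j ∈ cone s) (hz1 : ∀ j ∈ J, ∀ x, |z j x| ≤ 1)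
    (hp : ∀ i j, 0 ≤ p i j) (hq0 : ∀ j ∈ J, 1 ≤ q 0 j)
    (hq : ∀ n, ∀ j ∈ J, ∑ l ∈ J, p j l * q n l ≤ q (n + 1) j)
    (hlim : ∀ j ∈ J, Tendsto (fun n => q n j) atTop (nhds 0)) :
    ∀ j ∈ J, Y j ∈ cone s := by
  let S : ℕ → α → X → ℝ := fun n => Nat.rec (fun _ _ => 0)
    (fun _ g j x => f j x + ∑ l ∈ J, p j l * (z l x * g l x)) n
  have hS : ∀ n j x, S (n + 1) j x = f j x + ∑ l ∈ J, p j l * (z l x * S n l x) :=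
    fun _ _ _ => rfl
  have hmem : ∀ n, ∀ j ∈ J, S n j ∈ cone s := by
    intro n
    induction n with
    | zero => exact fun j _ => cone_const le_rfl
    | succ n ih =>
      intro j hj
      have : S (n + 1) j = f j + ∑ l ∈ J, (fun x => p j l * (z l * S n l) x) := by
        ext x; simp [hS]
      rw [this]
      exact add_mem (hf j hj) (Subalgebra.sum_mem _ fun l hl =>
        cone_const_mul (hp j l) (mul_mem (hz l hl) (ih l hl)))
  intro j hj
  refine cone_of_tendsto (fun n => hmem n j hj) fun x => ?_
  set C := ∑ l ∈ J, |Y l x| with hC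
  have hC0 : 0 ≤ C := Finset.sum_nonneg fun _ _ => abs_nonneg _
  have herr : ∀ n, ∀ j ∈ J, |S n j x - Y j x| ≤ C * q n j := by
    intro n
    induction n with
    | zero =>
      intro j hj
      calc |S 0 j x - Y j x| = |Y j x| := by simp [S]
        _ ≤ C := Finset.single_le_sum (f := fun l => |Y l x|) (fun _ _ => abs_nonneg _) hj
        _ ≤ C * q 0 j := le_mul_of_one_le_right hC0 (hq0 j hj)
    | succ n ih =>
      intro j hj
      calc |S (n + 1) j x - Y j x|
          = |∑ l ∈ J, p j l * (z l x * (S n l x - Y l x))| := by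
            rw [hS, hY j hj, add_sub_add_left_eq_sub, ← Finset.sum_sub_distrib]
            congr 1
            exact Finset.sum_congr rfl fun l _ => by ring
        _ ≤ ∑ l ∈ J, p j l * (C * q n l) := by
            refine (Finset.abs_sum_le_sum_abs _ _).trans (Finset.sum_le_sum fun l hl => ?_)
            rw [abs_mul, abs_mul, abs_of_nonneg (hp j l)]
            refine mul_le_mul_of_nonneg_left ?_ (hp j l)
            calc |z l x| * |S n l x - Y l x| ≤ 1 * |S n l x - Y l x| :=
                  mul_le_mul_of_nonneg_right (hz1 l hl x) (abs_nonneg _)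
              _ ≤ C * q n l := by rw [one_mul]; exact ih l hl
        _ = C * ∑ l ∈ J, p j l * q n l := by
            rw [Finset.mul_sum]; exact Finset.sum_congr rfl fun l _ => by ring
        _ ≤ C * q (n + 1) j := mul_le_mul_of_nonneg_left (hq n j hj) hC0
  have h0 : Tendsto (fun n => C * q n j) atTop (nhds 0) := by
    simpa using (hlim j hj).const_mul C
  exact tendsto_iff_dist_tendsto_zero.mpr
    (squeeze_zero (fun _ => dist_nonneg) (fun n => herr n j hj) h0)

end Cone

section Vacant

variable {α : Type*} [DecidableEq α]

/-- The indicator function that `S` does not meet the (random) set. -/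
def vac (S B : Finset α) : ℝ := if Disjoint S B then 1 else 0

/-- The cone generated by the indicators of the points of `K`. -/
noncomputable def vcone (K : Finset α) : Subalgebra ℝ≥0 (Finset α → ℝ) :=
  cone ((fun x => vac {x}) '' (K : Set α))

open Classical in
/-- Inclusion-exclusion: if `F B` is the probability that a random subset `S` of `K` contains
no point of `B`, then `ev K A F` is the probability that `S` satisfies `A`. -/
noncomputable def ev (K : Finset α) (A : Finset α → Prop) (F : Finset α → ℝ) : ℝ :=
  ∑ S ∈ K.powerset with A S, ∑ T ∈ S.powerset, (-1) ^ T.card * F (T ∪ K \ S)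

lemma ev_add (K : Finset α) (A : Finset α → Prop) (F G : Finset α → ℝ) :
    ev K A (F + G) = ev K A F + ev K A G := by
  simp only [ev, Pi.add_apply, mul_add, Finset.sum_add_distrib]

lemma ev_smul (K : Finset α) (A : Finset α → Prop) (c : ℝ) (F : Finset α → ℝ) :
    ev K A (c • F) = c * ev K A F := by
  simp only [ev, Pi.smul_apply, smul_eq_mul, Finset.mul_sum]
  exact Finset.sum_congr rfl fun _ _ => Finset.sum_congr rfl fun _ _ => by ring

@[fun_prop]
lemma continuous_ev (K : Finset α) (A : Finset α → Prop) : Continuous (ev K A) := by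
  unfold ev
  fun_prop

lemma vac_mul (S T : Finset α) : vac S * vac T = vac (S ∪ T) := by
  ext B
  by_cases h1 : Disjoint S B <;> by_cases h2 : Disjoint T B <;>
    simp [vac, Finset.disjoint_union_left, h1, h2]

lemma exists_eq_vac {K : Finset α} {F : Finset α → ℝ}
    (hF : F ∈ Submonoid.closure ((fun x => vac {x}) '' (K : Set α))) :
    ∃ S ⊆ K, F = vac S := by
  induction hF using Submonoid.closure_induction with
  | mem F h =>
    obtain ⟨x, hx, rfl⟩ := h
    exact ⟨{x}, by simpa using hx, rfl⟩
  | one => exact ⟨∅, by simp, by ext; simp [vac]⟩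
  | mul F G _ _ h1 h2 =>
    obtain ⟨S, hS, rfl⟩ := h1
    obtain ⟨T, hT, rfl⟩ := h2
    exact ⟨S ∪ T, Finset.union_subset hS hT, vac_mul S T⟩

lemma vac_empty_right (S : Finset α) : vac S ∅ = 1 := by simp [vac]

open Classical in
lemma ev_vac {K S : Finset α} (A : Finset α → Prop) (hS : S ⊆ K) :
    ev K A (vac S) = if A S then 1 else 0 := by
  have key : ∀ R ∈ K.powerset, ∑ T ∈ R.powerset, (-1 : ℝ) ^ T.card * vac S (T ∪ K \ R)
      = if R = S then 1 else 0 := by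
    intro R hR
    rw [Finset.mem_powerset] at hR
    by_cases hSR : S ⊆ R
    · have h1 : ∀ T ∈ R.powerset, (-1 : ℝ) ^ T.card * vac S (T ∪ K \ R)
          = if T ∈ (R \ S).powerset then (-1) ^ T.card else 0 := by
        intro T hT
        rw [Finset.mem_powerset] at hT
        have h2 : Disjoint S (T ∪ K \ R) ↔ T ∈ (R \ S).powerset := by
          rw [Finset.disjoint_union_right, Finset.mem_powerset, Finset.subset_sdiff,
            disjoint_comm (a := T)]
          have : Disjoint S (K \ R) := Finset.disjoint_sdiff.mono_left hSR
          tauto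
        simp [vac, h2]
      rw [Finset.sum_congr rfl h1, ← Finset.sum_filter,
        Finset.filter_mem_eq_inter, Finset.inter_eq_right.mpr
          (Finset.powerset_mono.mpr Finset.sdiff_subset)]
      have h3 := congrArg (Int.cast : ℤ → ℝ) (Finset.sum_powerset_neg_one_pow_card (x := R \ S))
      push_cast at h3
      rw [h3]
      congr 1
      rw [Finset.sdiff_eq_empty_iff_subset, eq_iff_iff]
      exact ⟨fun h => Finset.Subset.antisymm h hSR, fun h => h.le⟩
    · rw [if_neg fun h => hSR h.ge]
      refine Finset.sum_eq_zero fun T _ => ?_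
      have : ¬ Disjoint S (T ∪ K \ R) := fun h => hSR fun x hx => by
        by_contra hxR
        exact Finset.disjoint_left.mp h hx
          (Finset.mem_union_right _ (Finset.mem_sdiff.mpr ⟨hS hx, hxR⟩))
      simp [vac, this]
  rw [ev, Finset.sum_congr rfl fun R hR => key R (Finset.mem_filter.mp hR).1,
    Finset.sum_ite_eq']
  simp [hS]

variable {K : Finset α} {A : Finset α → Prop} {F G : Finset α → ℝ}

lemma vac_mem_vcone {x : α} (hx : x ∈ K) : vac {x} ∈ vcone K := subset_cone ⟨x, hx, rfl⟩

lemma vcone_mono {K' : Finset α} (h : K ⊆ K') : vcone K ≤ vcone K' :=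
  cone_mono (Set.image_mono (by exact_mod_cast h))

lemma vcone_exp {v c : ℝ} (hv : 0 ≤ v) (hF : F ∈ vcone K) :
    (fun B => Real.exp (v * (F B - c))) ∈ vcone K := by
  simp only [mul_sub]
  exact cone_exp_sub (cone_const_mul hv hF)

lemma ev_nonneg (A : Finset α → Prop) (hF : F ∈ vcone K) : 0 ≤ ev K A F :=
  cone_pos (continuous_ev K A) (ev_add K A) (ev_smul K A) (fun F hF => by
    obtain ⟨S, hS, rfl⟩ := exists_eq_vac hF
    rw [ev_vac A hS]; split_ifs <;> norm_num) hF

lemma ev_le (A : Finset α → Prop) (hF : F ∈ vcone K) : ev K A F ≤ F ∅ := by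
  have := cone_pos (φ := fun F => F ∅ - ev K A F)
    ((continuous_apply _).sub (continuous_ev K A))
    (fun F G => by rw [ev_add, Pi.add_apply]; ring)
    (fun c F => by rw [ev_smul, Pi.smul_apply, smul_eq_mul]; ring) (fun F hF => by
      obtain ⟨S, hS, rfl⟩ := exists_eq_vac hF
      rw [ev_vac A hS, vac_empty_right]; split_ifs <;> norm_num) hF
  linarith

lemma ev_mul_le (hA : ∀ S T, A S → A (S ∪ T)) (hF : F ∈ vcone K) (hG : G ∈ vcone K) :
    ev K A F * G ∅ ≤ ev K A (F * G) := by
  have h1 : ∀ S ⊆ K, 0 ≤ ev K A (vac S * G) - ev K A (vac S) * G ∅ := fun S hS =>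
    cone_pos (φ := fun G => ev K A (vac S * G) - ev K A (vac S) * G ∅)
      (((continuous_ev K A).comp (continuous_const.mul continuous_id)).sub
        (continuous_const.mul (continuous_apply _)))
      (fun F G => by rw [mul_add, ev_add, Pi.add_apply]; ring)
      (fun c F => by rw [mul_smul_comm, ev_smul, Pi.smul_apply, smul_eq_mul]; ring) (fun F hF => by
        obtain ⟨T, hT, rfl⟩ := exists_eq_vac hF
        rw [vac_mul, ev_vac A hS, ev_vac A (Finset.union_subset hS hT), vac_empty_right]
        have := hA S T
        by_cases h3 : A S <;> by_cases h4 : A (S ∪ T) <;> simp_all) hG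
  have := cone_pos (φ := fun F => ev K A (F * G) - ev K A F * G ∅)
    (((continuous_ev K A).comp (continuous_id.mul continuous_const)).sub
      ((continuous_ev K A).mul continuous_const))
    (fun F F' => by rw [add_mul, ev_add, ev_add]; ring)
    (fun c F => by rw [smul_mul_assoc, ev_smul, ev_smul]; ring) (fun F hF => by
      obtain ⟨S, hS, rfl⟩ := exists_eq_vac hF
      exact h1 S hS) hF
  linarith

/-- Factorization over disjoint sets. -/
lemma ev_union_le {K₁ K₂ : Finset α} (hK : Disjoint K₁ K₂) (A₁ A₂ : Finset α → Prop)
    {F₁ F₂ : Finset α → ℝ} (hF₁ : F₁ ∈ vcone K₁) (hF₂ : F₂ ∈ vcone K₂) :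
    ev (K₁ ∪ K₂) (fun S => A₁ (S ∩ K₁) ∧ A₂ (S ∩ K₂)) (F₁ * F₂) ≤ ev K₁ A₁ F₁ * ev K₂ A₂ F₂ := by
  generalize hA : (fun S => A₁ (S ∩ K₁) ∧ A₂ (S ∩ K₂)) = A
  generalize hK' : K₁ ∪ K₂ = K
  have h1 : ∀ S ⊆ K₁, 0 ≤ ev K₁ A₁ (vac S) * ev K₂ A₂ F₂ - ev K A (vac S * F₂) := fun S hS =>
    cone_pos (φ := fun G => ev K₁ A₁ (vac S) * ev K₂ A₂ G - ev K A (vac S * G))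
      ((continuous_const.mul (continuous_ev K₂ A₂)).sub
        ((continuous_ev K A).comp (continuous_const.mul continuous_id)))
      (fun F G => by rw [mul_add, ev_add, ev_add]; ring)
      (fun c F => by rw [mul_smul_comm, ev_smul, ev_smul]; ring) (fun F hF => by
        obtain ⟨T, hT, rfl⟩ := exists_eq_vac hF
        have h2 : A (S ∪ T) ↔ A₁ S ∧ A₂ T := by
          rw [← hA]
          beta_reduce
          rw [Finset.union_inter_distrib_right, Finset.union_inter_distrib_right,
            Finset.inter_eq_left.mpr hS, Finset.inter_eq_left.mpr hT,
            Finset.disjoint_iff_inter_eq_empty.mp (hK.mono_left hS),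
            Finset.disjoint_iff_inter_eq_empty.mp (hK.symm.mono_left hT)]
          simp
        rw [vac_mul, ev_vac A₁ hS, ev_vac A₂ hT,
          ev_vac A (hK' ▸ Finset.union_subset_union hS hT)]
        by_cases h5 : A (S ∪ T)
        · rw [if_pos h5, if_pos (h2.mp h5).1, if_pos (h2.mp h5).2]; norm_num
        · rw [if_neg h5]; split_ifs <;> norm_num) hF₂
  have := cone_pos (φ := fun F => ev K₁ A₁ F * ev K₂ A₂ F₂ - ev K A (F * F₂))
    (((continuous_ev K₁ A₁).mul continuous_const).sub
      ((continuous_ev K A).comp (continuous_id.mul continuous_const)))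
    (fun F F' => by rw [add_mul, ev_add, ev_add]; ring)
    (fun c F => by rw [smul_mul_assoc, ev_smul, ev_smul]; ring) (fun F hF => by
      obtain ⟨S, hS, rfl⟩ := exists_eq_vac hF
      exact h1 S hS) hF₁
  linarith

lemma vcone_nonneg (hF : F ∈ vcone K) (B : Finset α) : 0 ≤ F B :=
  cone_pos (φ := fun F => F B) (continuous_apply B) (fun _ _ => rfl) (fun _ _ => rfl) (fun F hF => by
    obtain ⟨S, -, rfl⟩ := exists_eq_vac hF
    unfold vac; split_ifs <;> norm_num) hF

lemma vcone_le (hF : F ∈ vcone K) (B : Finset α) : F B ≤ F ∅ := by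
  have := cone_pos (φ := fun F => F ∅ - F B) ((continuous_apply _).sub (continuous_apply _))
    (fun _ _ => by simp only [Pi.add_apply]; ring)
    (fun _ _ => by simp only [Pi.smul_apply, smul_eq_mul]; ring) (fun F hF => by
      obtain ⟨S, -, rfl⟩ := exists_eq_vac hF
      rw [vac_empty_right]; unfold vac; split_ifs <;> norm_num) hF
  linarith

end Vacant

section Decoupling

variable {α : Type*} [DecidableEq α] {K : Finset α} {A : Finset α → Prop}

lemma ev_exp_mul_pow_le (hA : ∀ S T, A S → A (S ∪ T)) {M : Finset α → ℝ} {c : ℝ} (hc : 0 < c)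
    (hM : M ∈ vcone K) (hMc : M ∅ = c) {u u' : ℝ} (hu' : 0 ≤ u') (hu : u' ≤ u) (i : ℕ) :
    ev K A ((fun B => Real.exp (u' * (M B - c))) * (fun B => c⁻¹ * M B) ^ i)
      ≤ ev K A (fun B => Real.exp (u * (M B - c))) + 2 ^ i * Real.exp (-((u - u') * c / 2)) := by
  set E : Finset α → ℝ := fun B => Real.exp (u' * (M B - c)) with hE
  set η : Finset α → ℝ := fun B => c⁻¹ * M B with hη
  have hEm : E ∈ vcone K := vcone_exp hu' hM
  have hηm : η ∈ vcone K := cone_const_mul (by positivity) hM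
  have hη0 : η ∅ = 1 := by simp only [hη, hMc]; field_simp
  have hE0 : E ∅ = 1 := by simp [hE, hMc]
  have ha0 : ∀ j, 0 ≤ ev K A (E * η ^ j) := fun j => ev_nonneg A (mul_mem hEm (pow_mem hηm j))
  have ha1 : ∀ j, ev K A (E * η ^ j) ≤ 1 := fun j => by
    refine (ev_le A (mul_mem hEm (pow_mem hηm j))).trans ?_
    simp [hE0, hη0]
  let s : Finset α ⊕ Unit → ℝ := Sum.elim η (fun _ => 1 / 2)
  have hG : (fun x => Real.exp ((u - u') * c * s x - (u - u') * c)) ∈ cone {s} :=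
    cone_exp_sub (cone_const_mul (mul_nonneg (by linarith) hc.le) (subset_cone rfl))
  have := cone_pos (φ := fun F => ev K A (E * fun B => F (Sum.inl B)) + 2 ^ i * F (Sum.inr ())
      - ev K A (E * η ^ i) * F (Sum.inl ∅))
    (by fun_prop)
    (fun F G => by
      have : (E * fun B => (F + G) (Sum.inl B))
        = (E * fun B => F (Sum.inl B)) + (E * fun B => G (Sum.inl B)) := by
          ext B; simp [mul_add]
      rw [this, ev_add]; simp only [Pi.add_apply]; ring)
    (fun r F => by
      have : (E * fun B => (r • F) (Sum.inl B)) = r • (E * fun B => F (Sum.inl B)) := by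
          ext B; simp only [Pi.mul_apply, Pi.smul_apply, smul_eq_mul]; ring
      rw [this, ev_smul]; simp only [Pi.smul_apply, smul_eq_mul]; ring)
    (fun F hF => by
      obtain ⟨j, rfl⟩ := Submonoid.mem_closure_singleton.mp hF
      have h1 : (E * fun B => (s ^ j) (Sum.inl B)) = E * η ^ j := by ext B; simp [s]
      rw [h1]
      simp only [Pi.pow_apply, s, Sum.elim_inl, Sum.elim_inr, hη0, one_pow, mul_one]
      rcases le_total i j with hij | hij
      · have h2 := ev_mul_le hA (mul_mem hEm (pow_mem hηm i)) (pow_mem hηm (j - i))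
        rw [mul_assoc, ← pow_add, Nat.add_sub_cancel' hij, Pi.pow_apply, hη0, one_pow,
          mul_one] at h2
        have : (0 : ℝ) ≤ 2 ^ i * (1 / 2) ^ j := by positivity
        linarith
      · have h2 : (1 : ℝ) ≤ 2 ^ i * (1 / 2) ^ j := by
          rw [one_div, inv_pow, ← div_eq_mul_inv, one_le_div (by positivity)]
          exact pow_le_pow_right₀ (by norm_num) hij
        linarith [ha0 j, ha1 i])
    hG
  have h1 : (E * fun B => Real.exp ((u - u') * c * s (Sum.inl B) - (u - u') * c))
      = fun B => Real.exp (u * (M B - c)) := by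
    ext B
    simp only [Pi.mul_apply, hE, s, Sum.elim_inl, hη, ← Real.exp_add]
    congr 1
    field_simp
    ring
  have h2 : (u - u') * c * s (Sum.inr ()) - (u - u') * c = -((u - u') * c / 2) := by
    simp only [s, Sum.elim_inr]; ring
  have h3 : (u - u') * c * s (Sum.inl ∅) - (u - u') * c = 0 := by
    simp only [s, Sum.elim_inl, hη0]; ring
  simp only [h1, h2, h3, Real.exp_zero, mul_one] at this
  linarith

/-- The interaction term appearing in the decoupling inequality. -/
noncomputable def interaction (κ m₁ m₂ : ℝ) : ℝ :=
  κ * m₁ * m₂ * (2 + κ * (m₁ + m₂)) * (1 - κ ^ 2 * m₁ * m₂)⁻¹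

lemma interaction_le {κ c₁ c₂ : ℝ} (hκ : 0 ≤ κ) (h₁ : 0 < c₁) (h₂ : 0 < c₂) (hκ₁ : κ * c₁ ≤ 1 / 2)
    (hκ₂ : κ * c₂ ≤ 1 / 2) : interaction κ (2 * c₁) c₂ ≤ 14 * κ * c₁ * c₂ := by
  have h3 : κ ^ 2 * c₁ * c₂ ≤ 1 / 4 := by
    calc κ ^ 2 * c₁ * c₂ = (κ * c₁) * (κ * c₂) := by ring
      _ ≤ 1 / 2 * (1 / 2) := by gcongr
      _ = 1 / 4 := by norm_num
  have h4 : (1 - κ ^ 2 * (2 * c₁) * c₂)⁻¹ ≤ 2 := by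
    rw [inv_le_comm₀ (by linarith) (by norm_num)]; linarith
  have h5 : 0 ≤ (1 - κ ^ 2 * (2 * c₁) * c₂)⁻¹ := inv_nonneg.mpr (by linarith)
  have h6 : 2 + κ * (2 * c₁ + c₂) ≤ 7 / 2 := by linarith
  calc interaction κ (2 * c₁) c₂
      ≤ κ * (2 * c₁) * c₂ * (7 / 2) * 2 := by unfold interaction; gcongr
    _ = 14 * κ * c₁ * c₂ := by ring

lemma interaction_comm (κ m₁ m₂ : ℝ) : interaction κ m₁ m₂ = interaction κ m₂ m₁ := by
  unfold interaction; ring_nf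

lemma interaction_nonneg {κ c₁ c₂ : ℝ} (hκ : 0 ≤ κ) (h₁ : 0 < c₁) (h₂ : 0 < c₂)
    (hκ₁ : κ * c₁ ≤ 1 / 2) (hκ₂ : κ * c₂ ≤ 1 / 2) : 0 ≤ interaction κ c₁ c₂ := by
  have h3 : κ ^ 2 * c₁ * c₂ ≤ 1 / 4 := by
    calc κ ^ 2 * c₁ * c₂ = (κ * c₁) * (κ * c₂) := by ring
      _ ≤ 1 / 2 * (1 / 2) := by gcongr
      _ = 1 / 4 := by norm_num
  have h5 : 0 ≤ (1 - κ ^ 2 * c₁ * c₂)⁻¹ := inv_nonneg.mpr (by linarith)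
  unfold interaction
  positivity

lemma cone_interaction {X : Type*} {s : Set (X → ℝ)} {κ : ℝ} (hκ : 0 ≤ κ) {m₁ m₂ : X → ℝ}
    (h₁ : m₁ ∈ cone s) (h₂ : m₂ ∈ cone s) (hlt : ∀ x, |κ ^ 2 * m₁ x * m₂ x| < 1) :
    (fun x => interaction κ (m₁ x) (m₂ x)) ∈ cone s := by
  have h3 : (fun x => κ ^ 2 * m₁ x * m₂ x) ∈ cone s :=
    mul_mem (cone_const_mul (by positivity) h₁) h₂
  exact mul_mem (mul_mem (mul_mem (cone_const_mul hκ h₁) h₂)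
    (add_mem (cone_const zero_le_two) (cone_const_mul hκ (add_mem h₁ h₂)))) (cone_geom h3 hlt)

variable {K₁ K₂ : Finset α} {A₁ A₂ : Finset α → Prop}

lemma decoupling (hK : Disjoint K₁ K₂) (hA₁ : ∀ S T, A₁ S → A₁ (S ∪ T))
    (hA₂ : ∀ S T, A₂ S → A₂ (S ∪ T)) {N M₁ M₂ : Finset α → ℝ} {c₁ c₂ κ u u' : ℝ}
    (hκ : 0 ≤ κ) (h₁ : 0 < c₁) (h₂ : 0 < c₂) (hκ₁ : κ * c₁ ≤ 1 / 2) (hκ₂ : κ * c₂ ≤ 1 / 2)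
    (hM₁ : M₁ ∈ vcone K₁) (hM₂ : M₂ ∈ vcone K₂) (hN : N ∈ vcone (K₁ ∪ K₂))
    (hc₁ : M₁ ∅ = c₁) (hc₂ : M₂ ∅ = c₂)
    (hD : (fun B => M₁ B + M₂ B + interaction κ (M₁ B) (M₂ B) - N B) ∈ vcone (K₁ ∪ K₂))
    (hu' : 0 ≤ u') (hu : u' ≤ u) :
    ev (K₁ ∪ K₂) (fun S => A₁ (S ∩ K₁) ∧ A₂ (S ∩ K₂)) (fun B => Real.exp (u' * (N B - N ∅)))
      ≤ ev K₁ A₁ (fun B => Real.exp (u * (M₁ B - c₁))) * ev K₂ A₂ (fun B => Real.exp (u * (M₂ B - c₂)))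
        + Real.exp (14 * u' * κ * c₁ * c₂ - (u - u') * c₁ / 2)
        + Real.exp (14 * u' * κ * c₁ * c₂ - (u - u') * c₂ / 2) := by
  set A : Finset α → Prop := fun S => A₁ (S ∩ K₁) ∧ A₂ (S ∩ K₂) with hAdef
  set K := K₁ ∪ K₂ with hKdef
  have hA : ∀ S T, A S → A (S ∪ T) := fun S T h => by
    simp only [hAdef, Finset.union_inter_distrib_right]
    exact ⟨hA₁ _ _ h.1, hA₂ _ _ h.2⟩
  set D : Finset α → ℝ := fun B => M₁ B + M₂ B + interaction κ (M₁ B) (M₂ B) - N B with hDdef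
  set E₁ : Finset α → ℝ := fun B => Real.exp (u' * (M₁ B - c₁)) with hE₁
  set E₂ : Finset α → ℝ := fun B => Real.exp (u' * (M₂ B - c₂)) with hE₂
  set η₁ : Finset α → ℝ := fun B => c₁⁻¹ * M₁ B with hη₁
  set η₂ : Finset α → ℝ := fun B => c₂⁻¹ * M₂ B with hη₂
  set R₀ := interaction κ c₁ c₂ with hR₀
  set a := ev K₁ A₁ (fun B => Real.exp (u * (M₁ B - c₁)))
  set b := ev K₂ A₂ (fun B => Real.exp (u * (M₂ B - c₂)))
  set p := Real.exp (-((u - u') * c₁ / 2))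
  set q := Real.exp (-((u - u') * c₂ / 2))
  have hstep : ev K A (fun B => Real.exp (u' * (N B - N ∅)))
      ≤ ev K A ((E₁ * E₂) * fun B => Real.exp (u' * (interaction κ (M₁ B) (M₂ B) - R₀))) := by
    have h := ev_mul_le hA (vcone_exp (c := N ∅) hu' hN) (vcone_exp (c := D ∅) hu' hD)
    rw [sub_self, mul_zero, Real.exp_zero, mul_one] at h
    refine h.trans_eq (congrArg _ (funext fun B => ?_))
    simp only [Pi.mul_apply, hE₁, hE₂, ← Real.exp_add]
    congr 1
    simp only [hDdef, hc₁, hc₂, hR₀]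
    ring
  let s : Finset α ⊕ Bool → ℝ := Sum.elim (fun B => η₁ B) (fun t => if t then 2 else 1)
  let t : Finset α ⊕ Bool → ℝ := Sum.elim (fun B => η₂ B) (fun t => if t then 1 else 2)
  have hη0 : ∀ B, 0 ≤ η₁ B ∧ η₁ B ≤ 1 := fun B =>
    ⟨mul_nonneg (by positivity) (vcone_nonneg hM₁ B), by
      have := vcone_le hM₁ B
      simp only [hη₁]; rw [inv_mul_le_iff₀ h₁]; linarith⟩
  have hη0' : ∀ B, 0 ≤ η₂ B ∧ η₂ B ≤ 1 := fun B =>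
    ⟨mul_nonneg (by positivity) (vcone_nonneg hM₂ B), by
      have := vcone_le hM₂ B
      simp only [hη₂]; rw [inv_mul_le_iff₀ h₂]; linarith⟩
  have hst : ∀ x, 0 ≤ s x * t x ∧ s x * t x ≤ 2 := by
    rintro (B | (_ | _))
    · have := hη0 B
      have := hη0' B
      simp only [s, t, Sum.elim_inl]
      constructor <;> nlinarith
    · simp [s, t]
    · simp [s, t]
  have hG : (fun x => Real.exp (u' * (interaction κ (c₁ * s x) (c₂ * t x)) - u' * R₀))
      ∈ cone {s, t} := by
    refine cone_exp_sub (cone_const_mul hu' (cone_interaction hκ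
      (cone_const_mul h₁.le (subset_cone (by simp)))
      (cone_const_mul h₂.le (subset_cone (by simp))) fun x => ?_))
    have h3 : κ ^ 2 * (c₁ * s x) * (c₂ * t x) = (κ * c₁) * (κ * c₂) * (s x * t x) := by ring
    have h4 : 0 ≤ (κ * c₁) * (κ * c₂) := by positivity
    have h5 := (hst x).1
    rw [h3, abs_of_nonneg (mul_nonneg h4 h5)]
    calc (κ * c₁) * (κ * c₂) * (s x * t x) ≤ 1 / 2 * (1 / 2) * 2 := by
          have := (hst x).2
          gcongr
      _ < 1 := by norm_num
  have hη₁0 : η₁ ∅ = 1 := by simp only [hη₁, hc₁]; field_simp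
  have hη₂0 : η₂ ∅ = 1 := by simp only [hη₂, hc₂]; field_simp
  have hm : ∀ i j, ev K A ((E₁ * E₂) * (η₁ ^ i * η₂ ^ j)) ≤ a * b + 2 ^ i * p + 2 ^ j * q := by
    intro i j
    have hF₁ : E₁ * η₁ ^ i ∈ vcone K₁ :=
      mul_mem (vcone_exp hu' hM₁) (pow_mem (cone_const_mul (by positivity) hM₁) i)
    have hF₂ : E₂ * η₂ ^ j ∈ vcone K₂ :=
      mul_mem (vcone_exp hu' hM₂) (pow_mem (cone_const_mul (by positivity) hM₂) j)
    have h3 := ev_union_le hK A₁ A₂ hF₁ hF₂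
    have h4 := ev_exp_mul_pow_le hA₁ h₁ hM₁ hc₁ hu' hu i
    have h5 := ev_exp_mul_pow_le hA₂ h₂ hM₂ hc₂ hu' hu j
    have h6 : 0 ≤ a := ev_nonneg A₁ (vcone_exp (hu'.trans hu) hM₁)
    have h7 : a ≤ 1 := (ev_le A₁ (vcone_exp (hu'.trans hu) hM₁)).trans_eq (by simp [hc₁])
    have h8 : ev K₂ A₂ (E₂ * η₂ ^ j) ≤ 1 := (ev_le A₂ hF₂).trans_eq (by simp [hE₂, hc₂, hη₂0])
    have h9 := ev_nonneg A₂ hF₂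
    have h10 : 0 ≤ 2 ^ i * p := by positivity
    have h11 : 0 ≤ 2 ^ j * q := by positivity
    calc ev K A ((E₁ * E₂) * (η₁ ^ i * η₂ ^ j)) = ev K A ((E₁ * η₁ ^ i) * (E₂ * η₂ ^ j)) := by
          congr 1; ring
      _ ≤ ev K₁ A₁ (E₁ * η₁ ^ i) * ev K₂ A₂ (E₂ * η₂ ^ j) := h3
      _ ≤ (a + 2 ^ i * p) * ev K₂ A₂ (E₂ * η₂ ^ j) := by gcongr
      _ ≤ a * (b + 2 ^ j * q) + 2 ^ i * p * 1 := by
          rw [add_mul]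
          gcongr
      _ ≤ a * b + 2 ^ i * p + 2 ^ j * q := by nlinarith
  have := cone_pos (φ := fun F => a * b * F (Sum.inl ∅) + p * F (Sum.inr true)
      + q * F (Sum.inr false) - ev K A ((E₁ * E₂) * fun B => F (Sum.inl B)))
    (by fun_prop)
    (fun F G => by
      have : ((E₁ * E₂) * fun B => (F + G) (Sum.inl B))
        = ((E₁ * E₂) * fun B => F (Sum.inl B)) + ((E₁ * E₂) * fun B => G (Sum.inl B)) := by
          ext B; simp [mul_add]
      rw [this, ev_add]; simp only [Pi.add_apply]; ring)
    (fun r F => by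
      have : ((E₁ * E₂) * fun B => (r • F) (Sum.inl B))
        = r • ((E₁ * E₂) * fun B => F (Sum.inl B)) := by
          ext B; simp only [Pi.mul_apply, Pi.smul_apply, smul_eq_mul]; ring
      rw [this, ev_smul]; simp only [Pi.smul_apply, smul_eq_mul]; ring)
    (fun F hF => by
      obtain ⟨i, j, rfl⟩ := (Submonoid.mem_closure_pair _ _ _).mp hF
      have h3 : (fun B => (s ^ i * t ^ j) (Sum.inl B)) = η₁ ^ i * η₂ ^ j := by
        ext B; simp [s, t]
      rw [h3]
      have := hm i j
      simp [s, t, hη₁0, hη₂0]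
      linarith)
    hG
  have hval : (fun B => Real.exp (u' * (interaction κ (c₁ * s (Sum.inl B)) (c₂ * t (Sum.inl B)))
      - u' * R₀)) = fun B => Real.exp (u' * (interaction κ (M₁ B) (M₂ B) - R₀)) := by
    funext B
    simp only [s, t, Sum.elim_inl, hη₁, hη₂, mul_inv_cancel_left₀ h₁.ne',
      mul_inv_cancel_left₀ h₂.ne', mul_sub]
  have h0 : u' * (interaction κ (c₁ * s (Sum.inl ∅)) (c₂ * t (Sum.inl ∅))) - u' * R₀ = 0 := by
    simp only [s, t, Sum.elim_inl, hη₁0, hη₂0, mul_one, hR₀]; ring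
  have hR0 : 0 ≤ R₀ := interaction_nonneg hκ h₁ h₂ hκ₁ hκ₂
  have hb : ∀ r ≤ 14 * κ * c₁ * c₂, ∀ y, Real.exp (-y) * Real.exp (u' * r - u' * R₀)
      ≤ Real.exp (14 * u' * κ * c₁ * c₂ - y) := fun r hr y => by
    rw [← Real.exp_add]
    refine Real.exp_le_exp.mpr ?_
    have h3 := mul_le_mul_of_nonneg_left hr hu'
    have h4 := mul_nonneg hu' hR0
    linarith
  have hp := hb (interaction κ (c₁ * s (Sum.inr true)) (c₂ * t (Sum.inr true)))
    (by simpa [s, t, mul_comm c₁] using interaction_le hκ h₁ h₂ hκ₁ hκ₂) ((u - u') * c₁ / 2)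
  have hq := hb (interaction κ (c₁ * s (Sum.inr false)) (c₂ * t (Sum.inr false)))
    (by
      have := interaction_le hκ h₂ h₁ hκ₂ hκ₁
      rw [interaction_comm] at this
      simp only [s, t, Sum.elim_inr, mul_one, Bool.false_eq_true, if_false, mul_comm c₂ 2]
      linarith) ((u - u') * c₂ / 2)
  simp only [hval, h0, Real.exp_zero, mul_one] at this
  linarith

end Decoupling

section Domination

variable {d : ℕ}

/-- The escape probability at `a` of the unoccupied part of `V`, on the event that `a` is vacant. -/
noncomputable def escVac (V : Finset (Zd d)) (a : Zd d) (B : Finset (Zd d)) : ℝ :=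
  vac {a} B * esc (B ∩ V) a

/-- The decrease of the capacity of `V` when `V` is replaced by its intersection with `B`. -/
noncomputable def capDrop (V B : Finset (Zd d)) : ℝ := cap V - cap (B ∩ V)

lemma one_sub_hit (hd : 3 ≤ d) {V : Finset (Zd d)} {a : Zd d} (ha : a ∈ V) (B : Finset (Zd d)) :
    1 - hit (B ∩ V) a = escVac V a B := by
  by_cases h : a ∈ B
  · rw [hit_of_mem (Finset.mem_inter.mpr ⟨h, ha⟩)]; simp [escVac, vac, h]
  · have h1 : a ∉ B ∩ V := fun h2 => h (Finset.mem_inter.mp h2).1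
    rw [hit_of_notMem hd h1, avg_hit]; simp [escVac, vac, h]

lemma capDrop_empty (V : Finset (Zd d)) : capDrop V ∅ = cap V := by simp [capDrop, cap]

lemma abs_vac_le (S B : Finset (Zd d)) : |vac S B| ≤ 1 := by
  unfold vac; split_ifs <;> norm_num

lemma vcone_sum {ι : Type*} {K : Finset (Zd d)} (J : Finset ι) {f : ι → Finset (Zd d) → ℝ}
    (h : ∀ j ∈ J, f j ∈ vcone K) : (fun B => ∑ j ∈ J, f j B) ∈ vcone K := by
  have : (fun B => ∑ j ∈ J, f j B) = ∑ j ∈ J, f j := by ext; simp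
  rw [this]
  exact Subalgebra.sum_mem _ h

variable [NeZero d]

lemma esc_inter (hd : 3 ≤ d) (V B : Finset (Zd d)) (a : Zd d) :
    esc (B ∩ V) a = esc V a + ∑ b ∈ V, trace V a b * escVac V b B := by
  rw [esc_eq_trace hd Finset.inter_subset_right]
  congr 1
  exact Finset.sum_congr rfl fun b hb => by rw [one_sub_hit hd hb]

lemma capDrop_eq (hd : 3 ≤ d) (V B : Finset (Zd d)) :
    capDrop V B = ∑ a ∈ V, esc V a * escVac V a B := by
  rw [Finset.sum_congr rfl fun a ha => by rw [← one_sub_hit hd ha]]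
  simp only [mul_sub, mul_one, Finset.sum_sub_distrib, sum_esc_hit hd Finset.inter_subset_right]
  rfl

lemma vcone_trace_fixed_point (hd : 3 ≤ d) {J K : Finset (Zd d)} (hJK : J ⊆ K)
    {Y f : Zd d → Finset (Zd d) → ℝ}
    (hY : ∀ a ∈ J, ∀ B, Y a B = f a B + ∑ b ∈ J, trace K a b * (vac {b} B * Y b B))
    (hf : ∀ a ∈ J, f a ∈ vcone K) : ∀ a ∈ J, Y a ∈ vcone K :=
  cone_fixed_point (z := fun b => vac {b}) (q := traceIter K) hY hf
    (fun _ hb => vac_mem_vcone (hJK hb)) (fun _ _ B => abs_vac_le _ B) (trace_nonneg K)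
    (fun _ _ => le_rfl)
    (fun _ _ _ => Finset.sum_le_sum_of_subset_of_nonneg hJK fun _ _ _ =>
      mul_nonneg (trace_nonneg _ _ _) (traceIter_nonneg _ _ _))
    (fun _ ha => traceIter_tendsto hd K (hJK ha))

lemma esc_inter_mem_vcone (hd : 3 ≤ d) (V : Finset (Zd d)) :
    ∀ a ∈ V, (fun B => esc (B ∩ V) a) ∈ vcone V :=
  vcone_trace_fixed_point (Y := fun a B => esc (B ∩ V) a) hd subset_rfl
    (fun a _ B => esc_inter hd V B a) fun a _ => cone_const (esc_nonneg hd V a)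

lemma escVac_mem_vcone (hd : 3 ≤ d) {V : Finset (Zd d)} {a : Zd d} (ha : a ∈ V) :
    escVac V a ∈ vcone V :=
  mul_mem (vac_mem_vcone ha) (esc_inter_mem_vcone hd V a ha)

lemma capDrop_mem_vcone (hd : 3 ≤ d) (V : Finset (Zd d)) : capDrop V ∈ vcone V := by
  rw [funext (capDrop_eq hd V)]
  exact vcone_sum V fun a ha => cone_const_mul (esc_nonneg hd V a) (escVac_mem_vcone hd ha)

variable {K₁ K₂ : Finset (Zd d)} {κ : ℝ}

/-- The flux from `K₁` in the presence of the other set. -/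
noncomputable def flux (V K B : Finset (Zd d)) : ℝ := ∑ a ∈ V, esc V a * escVac K a B

lemma flux_mem_vcone (hd : 3 ≤ d) {V K : Finset (Zd d)} (hV : V ⊆ K) : flux V K ∈ vcone K :=
  vcone_sum V fun a ha => cone_const_mul (esc_nonneg hd V a) (escVac_mem_vcone hd (hV ha))

lemma flux_dominated (hd : 3 ≤ d) (hdisj : Disjoint K₁ K₂) (hκ : 0 ≤ κ)
    (htr : ∀ a ∈ K₁, ∀ b ∈ K₂, trace (K₁ ∪ K₂) a b ≤ κ * esc K₁ a * esc K₂ b) :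
    (fun B => capDrop K₁ B * (1 + κ * flux K₂ (K₁ ∪ K₂) B) - flux K₁ (K₁ ∪ K₂) B)
      ∈ vcone (K₁ ∪ K₂) := by
  set K := K₁ ∪ K₂ with hK
  have h1K : K₁ ⊆ K := Finset.subset_union_left
  have h2K : K₂ ⊆ K := Finset.subset_union_right
  have hw2 : flux K₂ K ∈ vcone K := flux_mem_vcone hd h2K
  have hw2' : (fun B => 1 + κ * flux K₂ K B) ∈ vcone K :=
    add_mem (cone_const zero_le_one) (cone_const_mul hκ hw2)
  have hmem : ∀ a ∈ K₁, (fun B => esc (B ∩ K₁) a * (1 + κ * flux K₂ K B) - esc (B ∩ K) a)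
      ∈ vcone K := by
    refine vcone_trace_fixed_point hd h1K (f := fun a B => (esc K₁ a - esc K a)
      + (∑ b ∈ K₂, (κ * esc K₁ a * esc K₂ b - trace K a b) * escVac K b B
      + ∑ b ∈ K₁, (trace K₁ a b - trace K a b) * (escVac K₁ b B * (1 + κ * flux K₂ K B))))
      (fun a ha B => ?_) fun a ha => ?_
    · rw [esc_inter hd K₁ B a, esc_inter hd K B a]
      rw [hK, Finset.sum_union hdisj, ← hK]
      have h3 : flux K₂ K B = ∑ b ∈ K₂, esc K₂ b * escVac K b B := rfl
      simp only [sub_mul, mul_sub, Finset.sum_sub_distrib]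
      have h4 : ∑ b ∈ K₂, κ * esc K₁ a * esc K₂ b * escVac K b B
          = κ * esc K₁ a * flux K₂ K B := by
        rw [h3, Finset.mul_sum]; exact Finset.sum_congr rfl fun b _ => by ring
      have h5 : ∀ x y : Zd d → ℝ, ∑ b ∈ K₁, x b * (y b * (1 + κ * flux K₂ K B))
          = (∑ b ∈ K₁, x b * y b) * (1 + κ * flux K₂ K B) := fun x y => by
        rw [Finset.sum_mul]; exact Finset.sum_congr rfl fun b _ => by ring
      have h6 : ∑ b ∈ K₁, trace K a b * (vac {b} B * (esc (B ∩ K₁) b * (1 + κ * flux K₂ K B)))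
          = (∑ b ∈ K₁, trace K a b * escVac K₁ b B) * (1 + κ * flux K₂ K B) := by
        rw [Finset.sum_mul]
        exact Finset.sum_congr rfl fun b _ => by simp only [escVac]; ring
      rw [h4, h5, h5, h6]
      have h7 : ∑ b ∈ K₁, trace K a b * (vac {b} B * esc (B ∩ K) b)
          = ∑ b ∈ K₁, trace K a b * escVac K b B := rfl
      rw [h7]
      ring
    · refine add_mem (cone_const (sub_nonneg.mpr (esc_anti hd h1K a))) (add_mem ?_ ?_)
      · exact vcone_sum K₂ fun b hb => cone_const_mul (sub_nonneg.mpr (htr a ha b hb))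
          (escVac_mem_vcone hd (h2K hb))
      · exact vcone_sum K₁ fun b hb => cone_const_mul
          (sub_nonneg.mpr (trace_mono hd h1K hb a))
          (mul_mem (vcone_mono h1K (escVac_mem_vcone hd hb)) hw2')
  have := vcone_sum (K := K) K₁ fun a ha => cone_const_mul (esc_nonneg hd K₁ a)
    (mul_mem (vac_mem_vcone (h1K ha)) (hmem a ha))
  convert this using 2 with B
  have h8 : flux K₁ K B = ∑ a ∈ K₁, esc K₁ a * escVac K a B := rfl
  rw [capDrop_eq hd, h8, Finset.sum_mul, ← Finset.sum_sub_distrib]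
  refine Finset.sum_congr rfl fun a _ => ?_
  simp only [Pi.mul_apply, escVac]
  ring

lemma capDrop_dominated (hd : 3 ≤ d) (hdisj : Disjoint K₁ K₂) (hκ : 0 ≤ κ)
    (htr : ∀ a ∈ K₁, ∀ b ∈ K₂, trace (K₁ ∪ K₂) a b ≤ κ * esc K₁ a * esc K₂ b)
    (hκ₁ : κ * cap K₁ ≤ 1 / 2) (hκ₂ : κ * cap K₂ ≤ 1 / 2) :
    (fun B => capDrop K₁ B + capDrop K₂ B + interaction κ (capDrop K₁ B) (capDrop K₂ B)
      - capDrop (K₁ ∪ K₂) B) ∈ vcone (K₁ ∪ K₂) := by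
  set K := K₁ ∪ K₂ with hK
  have h1K : K₁ ⊆ K := Finset.subset_union_left
  have h2K : K₂ ⊆ K := Finset.subset_union_right
  have hD1 := flux_dominated hd hdisj hκ htr
  have hD2 : (fun B => capDrop K₂ B * (1 + κ * flux K₁ K B) - flux K₂ K B) ∈ vcone K := by
    have h := flux_dominated (K₁ := K₂) (K₂ := K₁) (κ := κ) hd hdisj.symm hκ fun b hb a ha => by
      rw [Finset.union_comm, ← hK, trace_symm hd (h2K hb) (h1K ha)]
      linarith [htr a ha b hb]
    rwa [Finset.union_comm] at h
  rw [← hK] at hD1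
  have hM1 := vcone_mono h1K (capDrop_mem_vcone hd K₁)
  have hM2 := vcone_mono h2K (capDrop_mem_vcone hd K₂)
  have hb1 := fun B => vcone_nonneg hM1 B
  have hb2 := fun B => vcone_nonneg hM2 B
  have hb1' := fun B => (vcone_le hM1 B).trans_eq (capDrop_empty K₁)
  have hb2' := fun B => (vcone_le hM2 B).trans_eq (capDrop_empty K₂)
  have hlt : ∀ B, 0 ≤ κ ^ 2 * capDrop K₁ B * capDrop K₂ B ∧
      κ ^ 2 * capDrop K₁ B * capDrop K₂ B ≤ 1 / 4 := fun B => by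
    have h1 := hb1 B
    have h2 := hb2 B
    refine ⟨by positivity, ?_⟩
    calc κ ^ 2 * capDrop K₁ B * capDrop K₂ B = (κ * capDrop K₁ B) * (κ * capDrop K₂ B) := by ring
      _ ≤ (κ * cap K₁) * (κ * cap K₂) := by
          have := hb1' B
          have := hb2' B
          have := cap_nonneg hd K₁
          gcongr
      _ ≤ 1 / 2 * (1 / 2) := by
          have := cap_nonneg hd K₂
          gcongr
      _ = 1 / 4 := by norm_num
  set g : Finset (Zd d) → ℝ := fun B => (1 - κ ^ 2 * capDrop K₁ B * capDrop K₂ B)⁻¹ with hg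
  have hgm : g ∈ vcone K := by
    refine cone_geom (mul_mem (cone_const_mul (by positivity) hM1) hM2) fun B => ?_
    rw [abs_of_nonneg (hlt B).1]
    linarith [(hlt B).2]
  have hN : (fun B => ∑ a ∈ K₁, (esc K₁ a - esc K a) * escVac K a B
      + ∑ a ∈ K₂, (esc K₂ a - esc K a) * escVac K a B) ∈ vcone K :=
    add_mem
      (vcone_sum K₁ fun a ha => cone_const_mul (sub_nonneg.mpr (esc_anti hd h1K a))
        (escVac_mem_vcone hd (h1K ha)))
      (vcone_sum K₂ fun a ha => cone_const_mul (sub_nonneg.mpr (esc_anti hd h2K a))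
        (escVac_mem_vcone hd (h2K ha)))
  have hD1' := mul_mem hgm (add_mem hD1 (mul_mem (cone_const_mul hκ hM1) hD2))
  have hD2' := mul_mem hgm (add_mem hD2 (mul_mem (cone_const_mul hκ hM2) hD1))
  have := add_mem hN (add_mem hD1' hD2')
  convert this using 1
  funext B
  have hg1 : g B * (1 - κ ^ 2 * capDrop K₁ B * capDrop K₂ B) = 1 :=
    inv_mul_cancel₀ (by linarith [(hlt B).2])
  have hNB : capDrop K B = ∑ a ∈ K₁, esc K a * escVac K a B + ∑ a ∈ K₂, esc K a * escVac K a B := by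
    rw [capDrop_eq hd, hK, Finset.sum_union hdisj]
  have hI : interaction κ (capDrop K₁ B) (capDrop K₂ B) = κ * capDrop K₁ B * capDrop K₂ B *
    (2 + κ * (capDrop K₁ B + capDrop K₂ B)) * g B := rfl
  simp only [Pi.add_apply, Pi.mul_apply, sub_mul, Finset.sum_sub_distrib, hNB, hI]
  rw [← flux, ← flux]
  generalize flux K₁ K B = w₁
  generalize flux K₂ K B = w₂
  generalize capDrop K₁ B = m₁ at *
  generalize capDrop K₂ B = m₂ at *
  generalize g B = γ at *
  linear_combination (w₁ + w₂ - m₁ - m₂) * hg1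

end Domination

section VacantLaw

/-- The points of `K` which are not vacant in the configuration `Y`. -/
def occ {α : Type*} (K : Finset α) (Y : α → Bool) : Finset α := K.filter fun x => Y x = false

lemma disjoint_occ_iff {α : Type*} {K B : Finset α} (hB : B ⊆ K) (Y : α → Bool) :
    Disjoint (occ K Y) B ↔ ∀ x ∈ B, Y x = true := by
  rw [Finset.disjoint_right]
  refine forall₂_congr fun x hx => ?_
  simp [occ, hB hx]

lemma measurableSet_vacant {α : Type*} (B : Finset α) :
    MeasurableSet {Y : α → Bool | ∀ x ∈ B, Y x = true} := by
  have : {Y : α → Bool | ∀ x ∈ B, Y x = true} = ⋂ x ∈ B, (fun Y => Y x) ⁻¹' {true} := by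
    ext Y; simp
  rw [this]
  exact Finset.measurableSet_biInter _ fun x _ =>
    (measurable_pi_apply x : Measurable fun Y : α → Bool => Y x) (measurableSet_singleton true)

lemma measurableSet_occ {α : Type*} (K : Finset α) (A : Finset α → Prop) :
    MeasurableSet {Y : α → Bool | A (occ K Y)} := by
  have h : Measurable fun Y : α → Bool => (fun x : K => Y x) :=
    measurable_pi_lambda _ fun x => measurable_pi_apply _
  have h2 : {Y : α → Bool | A (occ K Y)} = (fun Y : α → Bool => (fun x : K => Y x)) ⁻¹'
      {y | A (Finset.map (Function.Embedding.subtype _) (Finset.univ.filter fun x => y x = false))} := by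
    ext Y
    simp only [Set.mem_ofPred_eq, Set.mem_preimage]
    refine iff_of_eq (congrArg A ?_)
    ext x
    simp [occ, and_comm]
  rw [h2]
  exact h (Set.toFinite _).measurableSet

lemma measureReal_occ {α : Type*} [DecidableEq α] (Q : Measure (α → Bool)) [IsProbabilityMeasure Q]
    (K : Finset α) (A : Finset α → Prop) {F : Finset α → ℝ}
    (hF : ∀ B ⊆ K, Q.real {Y | ∀ x ∈ B, Y x = true} = F B) :
    Q.real {Y | A (occ K Y)} = ev K A F := by
  classical
  have hE : Set.indicator {Y : α → Bool | A (occ K Y)} (fun _ => (1 : ℝ))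
      = fun Y => ev K A (vac (occ K Y)) := funext fun Y => by
    rw [ev_vac (S := occ K Y) A (Finset.filter_subset _ _), Set.indicator_apply]
    rfl
  have hv : ∀ B ⊆ K, (fun Y => vac (occ K Y) B)
      = Set.indicator {Y : α → Bool | ∀ x ∈ B, Y x = true} fun _ => (1 : ℝ) := fun B hB => by
    classical
    funext Y
    simp only [vac, Set.indicator_apply]
    exact if_congr (disjoint_occ_iff hB Y) rfl rfl
  have hinteg : ∀ B ⊆ K, Integrable (fun Y => vac (occ K Y) B) Q := fun B hB => by
    rw [hv B hB]
    exact (integrable_const 1).indicator (measurableSet_vacant B)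
  have hsub : ∀ {S T : Finset α}, S ∈ K.powerset → T ∈ S.powerset → T ∪ K \ S ⊆ K :=
    fun hS hT => Finset.union_subset
      ((Finset.mem_powerset.mp hT).trans (Finset.mem_powerset.mp hS)) Finset.sdiff_subset
  rw [← integral_indicator_one (measurableSet_occ K A)]
  change ∫ Y, Set.indicator {Y : α → Bool | A (occ K Y)} (fun _ => (1 : ℝ)) Y ∂Q = _
  rw [hE]
  unfold ev
  rw [integral_finsetSum _ fun S hS => integrable_finsetSum _ fun T hT =>
    (hinteg _ (hsub (Finset.mem_filter.mp hS).1 hT)).const_mul _]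
  refine Finset.sum_congr rfl fun S hS => ?_
  rw [integral_finsetSum _ fun T hT =>
    (hinteg _ (hsub (Finset.mem_filter.mp hS).1 hT)).const_mul _]
  refine Finset.sum_congr rfl fun T hT => ?_
  have hB := hsub (Finset.mem_filter.mp hS).1 hT
  rw [integral_const_mul, hv _ hB, ← hF _ hB]
  exact congrArg _ (integral_indicator_one (measurableSet_vacant _))

variable {d : ℕ} [NeZero d] {P : Zd d → Measure (ℕ → Zd d)} {u : ℝ} {Q : Measure (Zd d → Bool)}

lemma IsVacantLaw.measureReal_vacant (hd : 3 ≤ d) (hP : IsSRW d P) (hQ : IsVacantLaw P u Q)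
    (B : Finset (Zd d)) : Q.real {Y | ∀ x ∈ B, Y x = true} = Real.exp (-(u * cap B)) := by
  rw [measureReal_def, hQ.2 B, ENNReal.toReal_ofReal (Real.exp_nonneg _), capa_eq_cap hd hP]

lemma IsVacantLaw.measureReal_occ (hd : 3 ≤ d) (hP : IsSRW d P) (hQ : IsVacantLaw P u Q)
    (K : Finset (Zd d)) (A : Finset (Zd d) → Prop) :
    Q.real {Y | A (occ K Y)} = ev K A fun B => Real.exp (u * (capDrop K B - cap K)) := by
  have := hQ.1
  refine RI.measureReal_occ Q K A fun B hB => ?_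
  rw [hQ.measureReal_vacant hd hP, capDrop, Finset.inter_eq_left.mpr hB]
  ring_nf

lemma IsVacantLaw.measureReal_translate (hd : 3 ≤ d) (hP : IsSRW d P) (hQ : IsVacantLaw P u Q)
    (K : Finset (Zd d)) (A : Finset (Zd d) → Prop) (a : Zd d) :
    Q.real {Y | A (occ K fun x => Y (x + a))} = Q.real {Y | A (occ K Y)} := by
  have := hQ.1
  have hm : Measurable fun (Y : Zd d → Bool) (x : Zd d) => Y (x + a) :=
    measurable_pi_lambda _ fun x => measurable_pi_apply _
  have hp : IsProbabilityMeasure (Q.map fun (Y : Zd d → Bool) (x : Zd d) => Y (x + a)) :=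
    Measure.isProbabilityMeasure_map hm.aemeasurable
  have h1 := RI.measureReal_occ (Q.map fun (Y : Zd d → Bool) (x : Zd d) => Y (x + a)) K A
    (F := fun B => Real.exp (-(u * cap B))) fun B hB => by
      rw [map_measureReal_apply hm (measurableSet_vacant B), ← cap_translate B a,
        ← hQ.measureReal_vacant hd hP]
      congr 1
      ext Y
      simp
  rw [map_measureReal_apply hm (measurableSet_occ K A)] at h1
  rw [RI.measureReal_occ Q K A fun B _ => hQ.measureReal_vacant hd hP B, ← h1]
  rfl

lemma occ_union_inter_left {α : Type*} [DecidableEq α] (K₁ K₂ : Finset α) (Y : α → Bool) :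
    occ (K₁ ∪ K₂) Y ∩ K₁ = occ K₁ Y := by
  ext x; simp [occ]; tauto

lemma occ_union_inter_right {α : Type*} [DecidableEq α] (K₁ K₂ : Finset α) (Y : α → Bool) :
    occ (K₁ ∪ K₂) Y ∩ K₂ = occ K₂ Y := by
  rw [Finset.union_comm, occ_union_inter_left]

/-- Increasing events in two disjoint sets whose traces interact weakly are almost independent, at
the price of an increase of the level. -/
lemma IsVacantLaw.measureReal_inter_le (hd : 3 ≤ d) (hP : IsSRW d P) (hQ : IsVacantLaw P u Q)
    {u' : ℝ} {Q' : Measure (Zd d → Bool)} (hQ' : IsVacantLaw P u' Q') (hu' : 0 ≤ u') (huu : u' ≤ u)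
    {K₁ K₂ : Finset (Zd d)} {κ : ℝ} (hdisj : Disjoint K₁ K₂) (hκ : 0 ≤ κ)
    (h₁ : 0 < cap K₁) (h₂ : 0 < cap K₂)
    (htr : ∀ a ∈ K₁, ∀ b ∈ K₂, trace (K₁ ∪ K₂) a b ≤ κ * esc K₁ a * esc K₂ b)
    (hκ₁ : κ * cap K₁ ≤ 1 / 2) (hκ₂ : κ * cap K₂ ≤ 1 / 2) {A₁ A₂ : Finset (Zd d) → Prop}
    (hA₁ : ∀ S T, A₁ S → A₁ (S ∪ T)) (hA₂ : ∀ S T, A₂ S → A₂ (S ∪ T)) :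
    Q'.real {Y | A₁ (occ K₁ Y) ∧ A₂ (occ K₂ Y)} ≤
      Q.real {Y | A₁ (occ K₁ Y)} * Q.real {Y | A₂ (occ K₂ Y)}
        + Real.exp (14 * u' * κ * cap K₁ * cap K₂ - (u - u') * cap K₁ / 2)
        + Real.exp (14 * u' * κ * cap K₁ * cap K₂ - (u - u') * cap K₂ / 2) := by
  have h := hQ'.measureReal_occ hd hP (K₁ ∪ K₂) fun S => A₁ (S ∩ K₁) ∧ A₂ (S ∩ K₂)
  simp only [occ_union_inter_left, occ_union_inter_right] at h
  rw [h, hQ.measureReal_occ hd hP K₁ A₁, hQ.measureReal_occ hd hP K₂ A₂]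
  have := decoupling hdisj hA₁ hA₂ hκ h₁ h₂ hκ₁ hκ₂ (capDrop_mem_vcone hd K₁)
    (capDrop_mem_vcone hd K₂) (capDrop_mem_vcone hd (K₁ ∪ K₂)) (capDrop_empty K₁)
    (capDrop_empty K₂) (capDrop_dominated hd hdisj hκ htr hκ₁ hκ₂) hu' huu
  rwa [capDrop_empty] at this

end VacantLaw

section Crossing

variable {d : ℕ}

/-- The supremum norm on `ℤ^d`. -/
def supn (x : Zd d) : ℕ := Finset.univ.sup fun i => (x i).natAbs

lemma supn_le_iff {x : Zd d} {r : ℕ} : supn x ≤ r ↔ ∀ i, |x i| ≤ (r : ℤ) := by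
  simp only [supn, Finset.sup_le_iff, Finset.mem_univ, true_implies]
  exact forall_congr' fun i => by rw [Int.abs_eq_natAbs, Nat.cast_le]

lemma abs_le_supn (x : Zd d) (i : Fin d) : |x i| ≤ (supn x : ℤ) := supn_le_iff.mp le_rfl i

lemma exists_abs_eq_supn [NeZero d] (x : Zd d) : ∃ i, |x i| = (supn x : ℤ) := by
  obtain ⟨i, -, hi⟩ := Finset.exists_mem_eq_sup Finset.univ ⟨0, Finset.mem_univ (0 : Fin d)⟩
    fun i => (x i).natAbs
  exact ⟨i, by rw [supn, hi, Int.natCast_natAbs]⟩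

lemma supn_le_add (x y z : Zd d) : supn (x - z) ≤ supn (x - y) + supn (y - z) := by
  refine supn_le_iff.mpr fun i => ?_
  have h1 := abs_le_supn (x - y) i
  have h2 := abs_le_supn (y - z) i
  simp only [Pi.sub_apply] at *
  push_cast
  rw [abs_le] at *
  constructor <;> linarith [h1.1, h1.2, h2.1, h2.2]

lemma supn_sub_comm (x y : Zd d) : supn (x - y) = supn (y - x) := by
  unfold supn
  congr 1
  funext i
  simp only [Pi.sub_apply]
  omega

/-- The ball of radius `r` around `x` in the supremum norm. -/
noncomputable def box (x : Zd d) (r : ℕ) : Finset (Zd d) :=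
  Fintype.piFinset fun i => Finset.Icc (x i - r) (x i + r)

lemma mem_box {x y : Zd d} {r : ℕ} : y ∈ box x r ↔ supn (y - x) ≤ r := by
  simp only [box, Fintype.mem_piFinset, Finset.mem_Icc, supn_le_iff, Pi.sub_apply, abs_le]
  exact forall_congr' fun i => ⟨fun h => by omega, fun h => by omega⟩

lemma card_box (x : Zd d) (r : ℕ) : (box x r).card = (2 * r + 1) ^ d := by
  rw [box, Fintype.card_piFinset, Finset.prod_congr rfl fun i _ => show _ = 2 * r + 1 by
    rw [Int.card_Icc]; omega]
  simp

lemma supn_le_of_starAdj {x y : Zd d} (z : Zd d) (h : starAdj x y) :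
    supn (y - z) ≤ supn (x - z) + 1 := by
  have h1 : supn (y - x) ≤ 1 := by
    rw [supn_sub_comm]
    exact supn_le_iff.mpr fun i => h.2 i
  linarith [supn_le_add y x z]

lemma mem_intBdry_iff [NeZero d] {x : Zd d} {r : ℕ} :
    x ∈ intBdry {x : Zd d | ∀ i, |x i| ≤ (r : ℤ)} ↔ supn x = r := by
  constructor
  · rintro ⟨h1, y, h2, h3⟩
    refine le_antisymm (supn_le_iff.mpr h1) ?_
    simp only [Set.mem_ofPred_eq, not_forall, not_le] at h2
    obtain ⟨i, hi⟩ := h2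
    have h4 : |x i - y i| ≤ 1 := h3 ▸
      Finset.single_le_sum (f := fun i => |x i - y i|) (fun _ _ => abs_nonneg _) (Finset.mem_univ i)
    have h5 := abs_le_supn x i
    zify
    have := abs_sub_abs_le_abs_sub (y i) (x i)
    rw [abs_sub_comm] at this
    omega
  · intro h
    refine ⟨supn_le_iff.mp h.le, ?_⟩
    obtain ⟨i, hi⟩ := exists_abs_eq_supn x
    rw [h] at hi
    rcases abs_cases (x i) with h1 | h1
    · refine ⟨nbr x (i, true), fun h2 => ?_, (adj_iff _ _).mpr ⟨_, rfl⟩⟩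
      have := h2 i
      simp [nbr_apply, abs_le] at this
      omega
    · refine ⟨nbr x (i, false), fun h2 => ?_, (adj_iff _ _).mpr ⟨_, rfl⟩⟩
      have := h2 i
      simp [nbr_apply, abs_le] at this
      omega

/-- The set `A` contains a planar `*`-path from the ball of radius `L` around `x` to the sphere of
radius `3 * L` around `x`. -/
def crossing (L : ℕ) (x : Zd d) (A : Set (Zd d)) : Prop :=
  ∃ (N : ℕ) (w : ℕ → Zd d), supn (w 0 - x) ≤ L ∧ supn (w N - x) = 3 * L ∧
    (∀ k ≤ N, inPlane (w k) ∧ w k ∈ A) ∧ ∀ k < N, starAdj (w k) (w (k + 1))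

lemma crossing.mono {L : ℕ} {x : Zd d} {A B : Set (Zd d)} (hAB : A ⊆ B) (h : crossing L x A) :
    crossing L x B := by
  obtain ⟨N, w, h0, hN, hA, hw⟩ := h
  exact ⟨N, w, h0, hN, fun k hk => ⟨(hA k hk).1, hAB (hA k hk).2⟩, hw⟩

lemma exists_first_hit {f : ℕ → ℕ} {N r : ℕ} (h0 : f 0 ≤ r) (hN : r ≤ f N)
    (hf : ∀ k < N, f (k + 1) ≤ f k + 1) : ∃ k ≤ N, f k = r ∧ ∀ j ≤ k, f j ≤ r := by
  classical
  have hex : ∃ k, r ≤ f k := ⟨N, hN⟩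
  have hlt : ∀ j < Nat.find hex, f j < r := fun j hj => not_le.mp (Nat.find_min hex hj)
  have hle : Nat.find hex ≤ N := Nat.find_min' hex hN
  have heq : f (Nat.find hex) = r := by
    refine le_antisymm ?_ (Nat.find_spec hex)
    rcases Nat.eq_zero_or_pos (Nat.find hex) with h | h
    · rwa [h]
    · obtain ⟨j, hj⟩ := Nat.exists_eq_succ_of_ne_zero h.ne'
      have h1 := hlt j (by omega)
      have h2 := hf j (by omega)
      rw [hj]
      exact h2.trans h1
  refine ⟨_, hle, heq, fun j hj => ?_⟩
  rcases hj.lt_or_eq with h | h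
  · exact (hlt j h).le
  · rw [h, heq]

lemma crossing_of_path {L N : ℕ} {x : Zd d} {A : Set (Zd d)} {w : ℕ → Zd d}
    (h0 : supn (w 0 - x) ≤ L) (hN : 3 * L ≤ supn (w N - x))
    (hA : ∀ k ≤ N, inPlane (w k) ∧ w k ∈ A) (hw : ∀ k < N, starAdj (w k) (w (k + 1))) :
    crossing L x (A ∩ box x (3 * L)) := by
  obtain ⟨k, hk, hkr, hle⟩ := exists_first_hit (f := fun k => supn (w k - x)) (r := 3 * L)
    (by linarith) hN fun k hk => supn_le_of_starAdj x (hw k hk)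
  exact ⟨k, w, h0, hkr, fun j hj => ⟨(hA j (hj.trans hk)).1, (hA j (hj.trans hk)).2,
    Finset.mem_coe.mpr (mem_box.mpr (hle j hj))⟩, fun j hj => hw j (by omega)⟩

lemma crossing_occ_iff {L : ℕ} {x : Zd d} {Y : Zd d → Bool} :
    crossing L x (occ (box x (3 * L)) Y) ↔ crossing L x {y | Y y = false} := by
  refine ⟨crossing.mono fun y hy => ?_, fun ⟨N, w, h0, hN, hA, hw⟩ =>
    (crossing_of_path h0 hN.ge hA hw).mono fun y hy => ?_⟩
  · exact (Finset.mem_filter.mp (Finset.mem_coe.mp hy)).2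
  · exact Finset.mem_coe.mpr (Finset.mem_filter.mpr ⟨hy.2, hy.1⟩)

lemma mem_qEvent_iff [NeZero d] {L : ℕ} {Y : Zd d → Bool} :
    Y ∈ qEvent d L ↔ crossing L (0 : Zd d) (occ (box 0 (3 * L)) Y) := by
  rw [crossing_occ_iff]
  have h : ∀ x : Zd d, x ∈ intBdry {x : Zd d | ∀ i, |x i| ≤ (3 * L : ℤ)} ↔ supn x = 3 * L :=
    fun x => by rw [← mem_intBdry_iff]; push_cast; rfl
  constructor
  · rintro ⟨N, w, h0, hN, hA, hw⟩
    exact ⟨N, w, by rw [sub_zero]; exact supn_le_iff.mpr h0.2, by rw [sub_zero]; exact (h _).mp hN,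
      hA, hw⟩
  · rintro ⟨N, w, h0, hN, hA, hw⟩
    rw [sub_zero] at h0 hN
    exact ⟨N, w, ⟨(hA 0 (Nat.zero_le _)).1, supn_le_iff.mp h0⟩, (h _).mpr hN, hA, hw⟩

lemma inPlane.add {x y : Zd d} (hx : inPlane x) (hy : inPlane y) : inPlane (x + y) :=
  fun i hi => by simp [hx i hi, hy i hi]

lemma inPlane.sub {x y : Zd d} (hx : inPlane x) (hy : inPlane y) : inPlane (x - y) :=
  fun i hi => by simp [hx i hi, hy i hi]

lemma starAdj_add_right {x y : Zd d} (a : Zd d) : starAdj (x + a) (y + a) ↔ starAdj x y := by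
  simp [starAdj]

lemma crossing_translate {L : ℕ} {x : Zd d} (hx : inPlane x) {A : Set (Zd d)} :
    crossing L (0 : Zd d) {y | y + x ∈ A} ↔ crossing L x A := by
  constructor
  · rintro ⟨N, w, h0, hN, hA, hw⟩
    exact ⟨N, fun k => w k + x, by simpa using h0, by simpa using hN,
      fun k hk => ⟨(hA k hk).1.add hx, (hA k hk).2⟩,
      fun k hk => (starAdj_add_right x).mpr (hw k hk)⟩
  · rintro ⟨N, w, h0, hN, hA, hw⟩
    refine ⟨N, fun k => w k - x, by simpa using h0, by simpa using hN,
      fun k hk => ⟨(hA k hk).1.sub hx, by simpa using (hA k hk).2⟩, fun k hk => ?_⟩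
    rw [← starAdj_add_right x]
    simpa using hw k hk

lemma IsVacantLaw.measureReal_crossing [NeZero d] {P : Zd d → Measure (ℕ → Zd d)} {u : ℝ}
    {Q : Measure (Zd d → Bool)} (hd : 3 ≤ d) (hP : IsSRW d P) (hQ : IsVacantLaw P u Q) {x : Zd d}
    (hx : inPlane x) (L : ℕ) :
    Q.real {Y | crossing L x (occ (box x (3 * L)) Y)} = Q.real (qEvent d L) := by
  have h := hQ.measureReal_translate hd hP (box 0 (3 * L)) (fun S => crossing L (0 : Zd d) S) x
  have h1 : {Y : Zd d → Bool | crossing L (0 : Zd d) (occ (box 0 (3 * L)) fun y => Y (y + x))}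
      = {Y | crossing L x (occ (box x (3 * L)) Y)} := by
    ext Y
    simp only [Set.mem_ofPred_eq, crossing_occ_iff]
    exact crossing_translate (A := {y | Y y = false}) hx
  have h2 : {Y : Zd d → Bool | crossing L (0 : Zd d) (occ (box 0 (3 * L)) Y)} = qEvent d L := by
    ext Y
    exact mem_qEvent_iff.symm
  rw [h1, h2] at h
  exact h

/-- The planar points of `L ℤ^d` on the sphere of radius `m L`. -/
noncomputable def centers (d L m : ℕ) : Finset (Zd d) :=
  (Finset.range 2 ×ˢ ({1, -1} : Finset ℤ) ×ˢ Finset.Icc (-(m : ℤ)) m).image fun p i =>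
    if (i : ℕ) = p.1 then p.2.1 * (m * L) else if (i : ℕ) < 2 then p.2.2 * L else 0

lemma card_centers_le (d L m : ℕ) : (centers d L m).card ≤ 4 * (2 * m + 1) := by
  refine Finset.card_image_le.trans ?_
  rw [Finset.card_product, Finset.card_product, Finset.card_range, Int.card_Icc]
  have : ({1, -1} : Finset ℤ).card = 2 := rfl
  rw [this]
  omega

lemma inPlane_of_mem_centers {L m : ℕ} {x : Zd d} (hx : x ∈ centers d L m) : inPlane x := by
  simp only [centers, Finset.mem_image, Finset.mem_product, Finset.mem_range] at hx
  obtain ⟨p, hp, rfl⟩ := hx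
  intro i hi
  simp only
  rw [if_neg (by omega), if_neg (by omega)]

lemma supn_of_mem_centers (hd : 3 ≤ d) {L m : ℕ} {x : Zd d} (hx : x ∈ centers d L m) :
    supn x = m * L := by
  simp only [centers, Finset.mem_image, Finset.mem_product, Finset.mem_range, Finset.mem_insert,
    Finset.mem_singleton, Finset.mem_Icc, Prod.exists] at hx
  obtain ⟨j, s, t, ⟨hj, hs, ht⟩, rfl⟩ := hx
  have hs1 : |s * (m * L : ℤ)| = m * L := by
    rw [abs_mul, abs_of_nonneg (by positivity : (0 : ℤ) ≤ m * L)]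
    rcases hs with rfl | rfl <;> simp
  refine le_antisymm (supn_le_iff.mpr fun i => ?_) ?_
  · push_cast
    split_ifs
    · exact hs1.le
    · rw [abs_mul, Nat.abs_cast]
      exact mul_le_mul_of_nonneg_right (abs_le.mpr ht) (by positivity)
    · rw [abs_zero]; positivity
  · have h := abs_le_supn (fun i : Fin d => if (i : ℕ) = j then s * (m * L) else
      if (i : ℕ) < 2 then t * L else 0) ⟨j, by omega⟩
    simp only [if_true, hs1] at h
    exact_mod_cast h

lemma exists_center (hd : 3 ≤ d) {L m : ℕ} (hL : 0 < L) (hm : 0 < m) {x : Zd d} (hp : inPlane x)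
    (hx : supn x = m * L) : ∃ y ∈ centers d L m, supn (x - y) ≤ L := by
  have : NeZero d := ⟨by omega⟩
  obtain ⟨i, hi⟩ := exists_abs_eq_supn x
  rw [hx] at hi
  have hi2 : (i : ℕ) < 2 := by
    by_contra h
    rw [hp i (by omega), abs_zero] at hi
    have : 0 < m * L := by positivity
    omega
  have hL' : (0 : ℤ) < L := by exact_mod_cast hL
  set j : Fin d := ⟨1 - i, by omega⟩ with hj
  have hxj := abs_le_supn x j
  rw [hx] at hxj
  push_cast at hxj hi
  refine ⟨_, Finset.mem_image_of_mem _ (a := ((i : ℕ), Int.sign (x i), x j / L)) ?_, ?_⟩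
  · simp only [Finset.mem_product, Finset.mem_range, Finset.mem_insert, Finset.mem_singleton,
      Finset.mem_Icc]
    refine ⟨hi2, ?_, ?_, ?_⟩
    · have : x i ≠ 0 := fun h => by
        rw [h, abs_zero] at hi
        have : (0 : ℤ) < m * L := by positivity
        omega
      rcases lt_or_gt_of_ne this with h | h
      · exact Or.inr (Int.sign_eq_neg_one_of_neg h)
      · exact Or.inl (Int.sign_eq_one_of_pos h)
    · rw [Int.le_ediv_iff_mul_le hL']
      linarith [(abs_le.mp hxj).1]
    · exact (Int.ediv_le_ediv hL' (abs_le.mp hxj).2).trans_eq (Int.mul_ediv_cancel _ hL'.ne')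
  · refine supn_le_iff.mpr fun k => ?_
    simp only [Pi.sub_apply]
    split_ifs with h1 h2
    · have : k = i := Fin.ext h1
      rw [this, ← hi, Int.sign_mul_abs, sub_self, abs_zero]
      exact hL'.le
    · have : k = j := Fin.ext (by simp only [hj]; omega)
      rw [this, abs_le]
      have h3 := Int.mul_ediv_add_emod (x j) L
      have h4 := Int.emod_nonneg (x j) hL'.ne'
      have h5 := Int.emod_lt_of_pos (x j) hL'
      constructor <;> nlinarith
    · rw [hp k (by omega)]
      simp

lemma exists_crossing_centers (hd : 3 ≤ d) {L m : ℕ} (hL : 0 < L) (hm : 3 ≤ m)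
    {A : Set (Zd d)} (h : crossing (m * L) 0 A) :
    ∃ x ∈ centers d L m, ∃ y ∈ centers d L (2 * m), crossing L x A ∧ crossing L y A := by
  obtain ⟨N, w, h0, hN, hA, hw⟩ := h
  simp only [sub_zero] at h0 hN
  have key : ∀ r, 0 < r → m ≤ r → r ≤ 2 * m → ∃ x ∈ centers d L r, crossing L x A := by
    intro r hr0 hmr hr
    obtain ⟨k, hk, hkr, -⟩ := exists_first_hit (f := fun k => supn (w k)) (r := r * L)
      (h0.trans (Nat.mul_le_mul_right L hmr)) (by nlinarith)
      fun k hk => by simpa using supn_le_of_starAdj 0 (hw k hk)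
    obtain ⟨x, hx, hwx⟩ := exists_center hd hL hr0 (hA k hk).1 hkr
    refine ⟨x, hx, (crossing_of_path (N := N - k) (w := fun j => w (k + j)) hwx ?_
      (fun j hj => hA _ (by omega)) (fun j hj => hw _ (by omega))).mono Set.inter_subset_left⟩
    rw [show k + (N - k) = N by omega]
    have h1 := supn_le_add (w N) x 0
    rw [sub_zero, sub_zero, hN, supn_of_mem_centers hd hx] at h1
    nlinarith [Nat.mul_le_mul_right L hm, Nat.mul_le_mul_right L hr]
  obtain ⟨x, hx, hx'⟩ := key m (by omega) le_rfl (by omega)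
  obtain ⟨y, hy, hy'⟩ := key (2 * m) (by omega) (by omega) le_rfl
  exact ⟨x, hx, y, hy, hx', hy'⟩

end Crossing

section BoxCapacity

variable {d : ℕ}

lemma supn_sq_le_nsq [NeZero d] (x : Zd d) : (supn x : ℝ) ^ 2 ≤ nsq x := by
  obtain ⟨i, hi⟩ := exists_abs_eq_supn x
  refine le_trans (le_of_eq ?_) (sq_le_nsq x i)
  rw [← sq_abs (x i : ℝ), ← Int.cast_abs, hi, Int.cast_natCast]

lemma nsq_le (x : Zd d) : nsq x ≤ d * (supn x : ℝ) ^ 2 := by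
  have h : ∀ i ∈ Finset.univ, ((x i : ℝ)) ^ 2 ≤ (supn x : ℝ) ^ 2 := fun i _ => by
    have h : |(x i : ℝ)| ≤ (supn x : ℝ) := by exact_mod_cast abs_le_supn x i
    exact sq_le_sq' (by linarith [(abs_le.mp h).1]) (abs_le.mp h).2
  exact (Finset.sum_le_card_nsmul _ _ _ h).trans_eq (by simp)

lemma inv_sqrt_pow_le {q r : ℝ} (hr : 0 < r) (h : r ^ 2 ≤ q) (k : ℕ) :
    (√q)⁻¹ ^ k ≤ r⁻¹ ^ k := by
  have := Real.le_sqrt_of_sq_le h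
  gcongr

lemma le_inv_sqrt_pow {q r : ℝ} (hq : 0 < q) (hr : 0 ≤ r) (h : q ≤ r ^ 2) (k : ℕ) :
    r⁻¹ ^ k ≤ (√q)⁻¹ ^ k := by
  have h1 := Real.sqrt_le_iff.mpr ⟨hr, h⟩
  have h2 := Real.sqrt_pos.mpr hq
  gcongr

lemma green_le_supn (hd : 3 ≤ d) :
    ∃ C : ℝ, 0 < C ∧ ∀ (x : Zd d) (r : ℝ), 0 < r → r ≤ supn x → green x ≤ C * r⁻¹ ^ (d - 2) := by
  have : NeZero d := ⟨by omega⟩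
  obtain ⟨a, C, ha, hC, h⟩ := green_le_bump hd
  refine ⟨C, hC, fun x r hr hx => (h x).trans (mul_le_mul_of_nonneg_left ?_ hC.le)⟩
  refine inv_sqrt_pow_le hr ?_ _
  have h1 := supn_sq_le_nsq x
  have h2 : r ^ 2 ≤ (supn x : ℝ) ^ 2 := by gcongr
  linarith

lemma sum_esc_mul_sum_green [NeZero d] (hd : 3 ≤ d) (K B : Finset (Zd d)) :
    ∑ c ∈ K, esc K c * ∑ z ∈ B, green (c - z) = ∑ z ∈ B, hit K z := by
  simp only [hit_eq_sum_green hd K, Finset.mul_sum]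
  rw [Finset.sum_comm]
  exact Finset.sum_congr rfl fun z _ => Finset.sum_congr rfl fun c _ => by rw [green_sub_comm]

lemma sum_green_sub_avg (hd : 3 ≤ d) (B : Finset (Zd d)) (x : Zd d) :
    avg (fun y => ∑ z ∈ B, green (y - z)) x = ∑ z ∈ B, green (x - z) - if x ∈ B then 1 else 0 := by
  rw [avg_sum, eq_sub_iff_add_eq, ← eq_sub_iff_add_eq', ← Finset.sum_sub_distrib,
    Finset.sum_congr rfl fun z _ => green_sub_avg hd z x]
  simp

lemma avg_nsq_sub [NeZero d] (x y : Zd d) : avg (fun y => nsq (y - x)) y = nsq (y - x) + 1 := by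
  simp only [sub_eq_add_neg]
  rw [avg_translate nsq (-x) y, avg_nsq]

lemma cap_box_le (hd : 3 ≤ d) : ∃ C : ℝ, 0 < C ∧ ∀ r : ℕ, 1 ≤ r → ∀ x : Zd d,
    cap (box x r) ≤ C * (r : ℝ) ^ (d - 2) := by
  have : NeZero d := ⟨by omega⟩
  have hd0 : (3 : ℝ) ≤ d := by exact_mod_cast hd
  refine ⟨(5 * d) ^ d / d, by positivity, fun r hr x => ?_⟩
  have hr' : (1 : ℝ) ≤ r := by exact_mod_cast hr
  set B := box x (2 * d * r) with hB
  set M : ℝ := 2 * d * r ^ 2 with hM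
  have hW : ∀ y : Zd d, nsq (y - x) < M → y ∈ B := fun y hy => by
    rw [hB, mem_box]
    have h1 := supn_sq_le_nsq (y - x)
    by_contra h2
    have h3 : (2 * d * r : ℝ) < supn (y - x) := by exact_mod_cast not_le.mp h2
    have h4 : (2 * d * r : ℝ) ^ 2 < (supn (y - x) : ℝ) ^ 2 := by gcongr
    nlinarith [mul_pos (by positivity : (0 : ℝ) < 2 * d) (by positivity : (0 : ℝ) < r ^ 2)]
  have hmax : ∀ y ∈ {y : Zd d | nsq (y - x) < M},
      max (M - nsq (y - x)) 0 - ∑ z ∈ B, green (y - z) ≤ 0 := by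
    refine max_principle (fun ε _ => ?_) (fun y hy => ?_) fun y hy _ => ?_
    · exact (B.finite_toSet).subset fun y hy => hW y hy.1
    · rw [avg_sub, sum_green_sub_avg hd, if_pos (hW y hy)]
      have h1 := avg_mono (f := fun y => M - nsq (y - x)) (g := fun y => max (M - nsq (y - x)) 0)
        (fun y => le_max_left _ _) y
      rw [avg_sub, avg_const, avg_nsq_sub] at h1
      rw [max_eq_left (sub_nonneg.mpr (le_of_lt hy))]
      linarith
    · rw [max_eq_right (sub_nonpos.mpr (not_lt.mp hy))]
      have := Finset.sum_nonneg fun z (_ : z ∈ B) => green_nonneg (y - z)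
      linarith
  have hK : ∀ y ∈ box x r, d * (r : ℝ) ^ 2 ≤ ∑ z ∈ B, green (y - z) := fun y hy => by
    have h1 : (supn (y - x) : ℝ) ≤ r := by exact_mod_cast mem_box.mp hy
    have h2 : nsq (y - x) ≤ d * (r : ℝ) ^ 2 := (nsq_le _).trans (by gcongr)
    have h3 := hmax y (by
      simp only [Set.mem_ofPred_eq]
      have : (0 : ℝ) < d * r ^ 2 := by positivity
      linarith)
    have h4 := le_max_left (M - nsq (y - x)) 0
    linarith
  have h5 : cap (box x r) * (d * (r : ℝ) ^ 2) ≤ (5 * d * r : ℝ) ^ d := by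
    calc cap (box x r) * (d * (r : ℝ) ^ 2)
        = ∑ c ∈ box x r, esc (box x r) c * (d * (r : ℝ) ^ 2) := by rw [cap, Finset.sum_mul]
      _ ≤ ∑ c ∈ box x r, esc (box x r) c * ∑ z ∈ B, green (c - z) :=
          Finset.sum_le_sum fun c hc => mul_le_mul_of_nonneg_left (hK c hc) (esc_nonneg hd _ _)
      _ = ∑ z ∈ B, hit (box x r) z := sum_esc_mul_sum_green hd _ _
      _ ≤ ∑ z ∈ B, 1 := Finset.sum_le_sum fun z _ => hit_le_one hd _ z
      _ = (2 * (2 * d * r) + 1 : ℝ) ^ d := by simp [hB, card_box]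
      _ ≤ (5 * d * r : ℝ) ^ d := by gcongr; nlinarith
  have h6 : (r : ℝ) ^ d = r ^ (d - 2) * r ^ 2 := by rw [← pow_add]; congr 1; omega
  rw [mul_pow, h6, ← le_div_iff₀ (by positivity)] at h5
  refine h5.trans (le_of_eq ?_)
  field_simp

lemma le_cap_box (hd : 3 ≤ d) : ∃ c Λ : ℝ, 0 < c ∧ 0 < Λ ∧ ∀ r : ℕ, Λ ≤ r → ∀ x : Zd d,
    c * (r : ℝ) ^ (d - 2) ≤ cap (box x r) := by
  have : NeZero d := ⟨by omega⟩
  have hd0 : (3 : ℝ) ≤ d := by exact_mod_cast hd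
  obtain ⟨C, hC, hbump⟩ := bump_sub_avg_ge hd
  set γ : ℝ := (d + 2 : ℝ)⁻¹ ^ (d - 2) * (1 / 4 / (d + 2) ^ 2) with hγ
  have hγ0 : 0 < γ := by positivity
  refine ⟨γ, 4 * C + 3, hγ0, by positivity, fun r hr x => ?_⟩
  have hr' : (3 : ℝ) ≤ r := by linarith
  have hrC : 4 * C ≤ (r : ℝ) ^ 2 := by nlinarith
  have hr2 : (3 : ℝ) ≤ (r : ℝ) ^ 2 := by nlinarith
  set K := box x r with hK
  set f : Zd d → ℝ := fun y => bump ((r : ℝ) ^ 2) (y - x) with hf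
  have hfavg : ∀ y, avg f y = avg (bump ((r : ℝ) ^ 2)) (y - x) := fun y => by
    simp only [hf, sub_eq_add_neg]
    rw [avg_translate]
  have hf1 : ∀ y, (√(nsq (y - x) + r ^ 2 + 1))⁻¹ ^ (d - 2) *
      ((r ^ 2 / 4) / (nsq (y - x) + r ^ 2 + 1) ^ 2) ≤ f y - avg f y := fun y => by
    rw [hfavg]
    refine le_trans ?_ (hbump _ hr2 (y - x))
    gcongr
    nlinarith
  set η : ℝ := γ * (r : ℝ)⁻¹ ^ (d - 2) * ((r : ℝ) ^ 2)⁻¹ with hη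
  have hη0 : 0 < η := by positivity
  have hfK : ∀ y, (if y ∈ K then η else 0) ≤ f y - avg f y := fun y => by
    have hn := nsq_nonneg (y - x)
    refine le_trans ?_ (hf1 y)
    split_ifs with hy
    · have h1 : (supn (y - x) : ℝ) ≤ r := by exact_mod_cast mem_box.mp hy
      have h2 : nsq (y - x) ≤ d * (r : ℝ) ^ 2 := (nsq_le _).trans (by gcongr)
      have h3 : nsq (y - x) + r ^ 2 + 1 ≤ (d + 2) * (r : ℝ) ^ 2 := by nlinarith
      have h4 : ((d + 2) * r : ℝ)⁻¹ ^ (d - 2) ≤ (√(nsq (y - x) + r ^ 2 + 1))⁻¹ ^ (d - 2) :=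
        le_inv_sqrt_pow (by positivity) (by positivity) (by nlinarith) _
      calc η = ((d + 2) * r : ℝ)⁻¹ ^ (d - 2) * ((r ^ 2 / 4) / ((d + 2) * (r : ℝ) ^ 2) ^ 2) := by
            rw [hη, hγ, mul_inv, mul_pow]; field_simp
        _ ≤ _ := by gcongr
    · positivity
  set H : Zd d → ℝ := fun y => ∑ z ∈ K, green (y - z) with hH
  have hHt : Tendsto (fun y => η * H y) cofinite (nhds 0) := by
    have := (tendsto_finsetSum K fun z _ => green_sub_tendsto hd z).const_mul η
    simpa using this
  have hmax : ∀ y, η * H y - f y ≤ 0 := by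
    refine max_principle_compl ∅ (fun y => ?_) hHt (by simp) fun y _ => ?_
    · have := bump_nonneg ((r : ℝ) ^ 2) (y - x)
      simp only [hf]; linarith
    · rw [avg_sub, avg_const_mul, hH, sum_green_sub_avg hd]
      have := hfK y
      split_ifs at this ⊢ <;> nlinarith
  have hHle : ∀ y, H y ≤ (r : ℝ) ^ 2 / γ := fun y => by
    have h1 : f y ≤ (r : ℝ)⁻¹ ^ (d - 2) :=
      inv_sqrt_pow_le (by positivity) (by linarith [nsq_nonneg (y - x)]) _
    have h2 : η * H y ≤ (r : ℝ)⁻¹ ^ (d - 2) := by linarith [hmax y]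
    rw [← le_div_iff₀' hη0] at h2
    refine h2.trans (le_of_eq ?_)
    rw [hη]; field_simp
  have h5 : (r : ℝ) ^ d ≤ cap K * (r ^ 2 / γ) := by
    calc (r : ℝ) ^ d ≤ (2 * r + 1 : ℝ) ^ d := by gcongr; linarith
      _ = ∑ z ∈ K, 1 := by simp [hK, card_box]
      _ = ∑ z ∈ K, hit K z := Finset.sum_congr rfl fun z hz => (hit_of_mem hz).symm
      _ = ∑ c ∈ K, esc K c * H c := (sum_esc_mul_sum_green hd K K).symm
      _ ≤ ∑ c ∈ K, esc K c * (r ^ 2 / γ) :=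
          Finset.sum_le_sum fun c _ => mul_le_mul_of_nonneg_left (hHle c) (esc_nonneg hd _ _)
      _ = cap K * (r ^ 2 / γ) := by rw [cap, Finset.sum_mul]
  have h6 : (r : ℝ) ^ d = r ^ (d - 2) * r ^ 2 := by rw [← pow_add]; congr 1; omega
  rw [h6, ← mul_div_assoc, le_div_iff₀ hγ0] at h5
  have h7 : (0 : ℝ) < (r : ℝ) ^ 2 := by positivity
  nlinarith

end BoxCapacity

section TraceBound

variable {d : ℕ}

lemma hit_box_le_half (hd : 3 ≤ d) : ∃ Λ : ℝ, 0 < Λ ∧ ∀ r : ℕ, Λ ≤ r → ∀ x y : Zd d,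
    2 * (d + 1) * r < supn (y - x) → hit (box x r) y ≤ 1 / 2 := by
  have : NeZero d := ⟨by omega⟩
  obtain ⟨C, hC, hbump⟩ := bump_sub_avg_ge hd
  have hd0 : (3 : ℝ) ≤ d := by exact_mod_cast hd
  set a : ℝ := 2 * C + 3 with ha
  refine ⟨a, by positivity, fun r hr x y hy => ?_⟩
  have hr' : (3 : ℝ) ≤ r := by linarith
  set β : ℝ := ((d + 1) * r : ℝ)⁻¹ ^ (d - 2) with hβ
  have hβ0 : 0 < β := by positivity
  have hsup : ∀ z, avg (bump a) z ≤ bump a z := fun z => by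
    have hz := nsq_nonneg z
    have h1 := hbump a (by linarith) z
    have h2 : (0 : ℝ) ≤ (√(nsq z + a + 1))⁻¹ ^ (d - 2) *
        (((d - 2) / 2 * (a + 1) - C) / (nsq z + a + 1) ^ 2) := by
      have : 0 ≤ ((d : ℝ) - 2) / 2 * (a + 1) - C := by nlinarith
      positivity
    linarith
  have h := hit_le_of_superharmonic hd (box x r) (f := fun z => β⁻¹ * bump a (z - x))
    (fun z => mul_nonneg (inv_nonneg.mpr hβ0.le) (bump_nonneg a _)) (fun z => by
      rw [avg_const_mul]
      refine mul_le_mul_of_nonneg_left ?_ (inv_nonneg.mpr hβ0.le)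
      simp only [sub_eq_add_neg]
      rw [avg_translate]
      exact hsup _) (fun z hz => by
      rw [← div_eq_inv_mul, one_le_div hβ0]
      have h1 : (supn (z - x) : ℝ) ≤ r := by exact_mod_cast mem_box.mp hz
      have h2 : nsq (z - x) ≤ d * (r : ℝ) ^ 2 := (nsq_le _).trans (by gcongr)
      refine le_inv_sqrt_pow (by linarith [nsq_nonneg (z - x)]) (by positivity) ?_ _
      nlinarith [mul_nonneg (by positivity : (0 : ℝ) ≤ d ^ 2 + d) (sq_nonneg (r : ℝ))]) y
  refine h.trans ?_
  have hy' : (2 * (d + 1) * r : ℝ) ≤ supn (y - x) := by exact_mod_cast hy.le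
  have h1 : bump a (y - x) ≤ (2 * ((d + 1) * r) : ℝ)⁻¹ ^ (d - 2) := by
    refine inv_sqrt_pow_le (by positivity) ?_ _
    have h2 : (2 * ((d + 1) * r) : ℝ) ^ 2 ≤ (supn (y - x) : ℝ) ^ 2 := by
      rw [← mul_assoc]; gcongr
    linarith [supn_sq_le_nsq (y - x)]
  rw [mul_inv, mul_pow, ← hβ] at h1
  have h2 : (2 : ℝ)⁻¹ ^ (d - 2) ≤ 1 / 2 := by
    calc (2 : ℝ)⁻¹ ^ (d - 2) ≤ (2 : ℝ)⁻¹ ^ 1 :=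
          pow_le_pow_of_le_one (by norm_num) (by norm_num) (by omega)
      _ = 1 / 2 := by norm_num
  rw [← div_eq_inv_mul, div_le_iff₀ hβ0]
  exact h1.trans (mul_le_mul_of_nonneg_right h2 hβ0.le)

lemma supn_nbr_le (a x : Zd d) (p : Fin d × Bool) : supn (nbr a p - x) ≤ supn (a - x) + 1 := by
  have h : supn (nbr a p - a) ≤ 1 := supn_le_iff.mpr fun i => by
    rw [Pi.sub_apply, nbr_apply]
    split_ifs <;> simp
  linarith [supn_le_add (nbr a p) a x]

/-- A function which is subharmonic in an annulus around a box, nonpositive on the box and at most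
`m` on the outer boundary of the annulus is controlled near the box by the escape probabilities. -/
lemma avg_le_of_subharmonic (hd : 3 ≤ d) {x : Zd d} {r R : ℕ} (hrR : r < R) {f : Zd d → ℝ} {m : ℝ}
    (hm : 0 ≤ m) (hhit : ∀ y, R < supn (y - x) → hit (box x r) y ≤ 1 / 2)
    (hf : ∀ y, r < supn (y - x) → supn (y - x) ≤ R → f y ≤ avg f y)
    (h0 : ∀ y ∈ box x r, f y ≤ 0) (hR : ∀ y, supn (y - x) = R + 1 → f y ≤ m) {a : Zd d}
    (ha : a ∈ box x r) : avg f a ≤ 2 * m * esc (box x r) a := by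
  have : NeZero d := ⟨by omega⟩
  set V := box x r with hV
  have hbox : ∀ y ∈ V, f y - 2 * m * (1 - hit V y) ≤ 0 := fun y hy => by
    rw [hit_of_mem hy]
    linarith [h0 y hy]
  have hW : ∀ y ∈ {y : Zd d | r < supn (y - x) ∧ supn (y - x) ≤ R},
      f y - 2 * m * (1 - hit V y) ≤ 0 := by
    refine max_principle (fun ε _ => (box x R).finite_toSet.subset fun y hy =>
      Finset.mem_coe.mpr (mem_box.mpr hy.1.2)) (fun y hy => ?_) fun y hy hz => ?_
    · have hyV : y ∉ V := fun h => absurd (mem_box.mp h) (not_le.mpr hy.1)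
      rw [avg_sub, avg_const_mul, avg_sub, avg_const, ← hit_of_notMem hd hyV]
      linarith [hf y hy.1 hy.2]
    · by_cases hyr : supn (y - x) ≤ r
      · exact hbox y (mem_box.mpr hyr)
      · have hyR : R < supn (y - x) := by
          by_contra h
          exact hy ⟨not_le.mp hyr, not_lt.mp h⟩
        obtain ⟨z, hz, i, hi⟩ := hz
        have h1 : supn (y - x) ≤ supn (z - x) + 1 := by
          rcases hi with rfl | rfl
          · exact supn_nbr_le z x (i, true)
          · exact supn_nbr_le z x (i, false)
        have h2 := hR y (by have := hz.2; omega)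
        have h3 := hhit y hyR
        nlinarith
  have hall : ∀ p, f (nbr a p) ≤ 2 * m * (1 - hit V (nbr a p)) := fun p => by
    have h1 := supn_nbr_le a x p
    have h2 := mem_box.mp ha
    by_cases h : nbr a p ∈ V
    · linarith [hbox _ h]
    · have h3 : ¬ supn (nbr a p - x) ≤ r := fun h4 => h (mem_box.mpr h4)
      linarith [hW (nbr a p) ⟨not_le.mp h3, by omega⟩]
  have h4 : avg f a ≤ avg (fun y => 2 * m * (1 - hit V y)) a := by
    rw [avg_eq_sum_nbr, avg_eq_sum_nbr]
    gcongr with p _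
    exact hall p
  rwa [avg_const_mul, avg_sub, avg_const, avg_hit, sub_sub_cancel] at h4

lemma trace_le_of_green_le (hd : 3 ≤ d) {x₁ x₂ : Zd d} {r R : ℕ} {m : ℝ} (hrR : r < R)
    (hm : 0 ≤ m) (hhit : ∀ x y : Zd d, R < supn (y - x) → hit (box x r) y ≤ 1 / 2)
    (hsep : 2 * R + 2 < supn (x₁ - x₂))
    (hgreen : ∀ y z, supn (y - x₁) = R + 1 → supn (z - x₂) = R + 1 → green (z - y) ≤ m)
    {a b : Zd d} (ha : a ∈ box x₁ r) (hb : b ∈ box x₂ r) :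
    trace (box x₁ r ∪ box x₂ r) a b ≤ 4 * m * esc (box x₁ r) a * esc (box x₂ r) b := by
  have : NeZero d := ⟨by omega⟩
  set K₁ := box x₁ r with hK₁
  set K₂ := box x₂ r with hK₂
  set K := K₁ ∪ K₂ with hK
  have hbK : b ∈ K := Finset.mem_union_right _ hb
  have hfar : ∀ y, supn (y - x₁) ≤ R + 1 → supn (y - x₂) ≤ R → False := fun y h1 h2 => by
    rw [supn_sub_comm] at h1
    have := supn_le_add x₁ y x₂
    omega
  have houter : ∀ z, supn (z - x₁) = R + 1 → hitAt K b z ≤ 2 * m * esc K₂ b := fun z hz => by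
    have hzK : z ∉ K := fun h => by
      rcases Finset.mem_union.mp h with h | h
      · have := mem_box.mp h; omega
      · exact hfar z hz.le ((mem_box.mp h).trans hrR.le)
    set φ : Zd d → ℝ := fun y => green (y - z) - ∑ c ∈ K, green (c - z) * hitAt K c y with hφ
    have hφavg : ∀ y, y ≠ z → avg φ y
        = green (y - z) - ∑ c ∈ K, green (c - z) * avg (hitAt K c) y := fun y hy => by
      have h1 := green_sub_avg hd z y
      rw [if_neg hy, sub_eq_zero] at h1
      rw [hφ, avg_sub, avg_sum, ← h1]
      simp only [avg_const_mul]
    have hφle : ∀ y, φ y ≤ green (y - z) := fun y =>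
      sub_le_self _ (Finset.sum_nonneg fun c _ => mul_nonneg (green_nonneg _) (hitAt_nonneg _ _ _))
    have h2 := avg_le_of_subharmonic hd hrR hm (hhit x₂) (f := φ) (fun y hy1 hy2 => ?_)
      (fun y hy => ?_) (fun y hy => (hφle y).trans (hgreen z y hz hy)) hb
    · rw [hφavg b fun h => hzK (h ▸ hbK)] at h2
      rw [hitAt_eq_sum_green hd hbK]
      refine le_trans (le_of_eq ?_) h2
      simp only [sub_mul, Finset.sum_sub_distrib, ite_mul, one_mul, zero_mul,
        Finset.sum_ite_eq', if_pos hbK]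
      rw [green_sub_comm]
      congr 1
      refine Finset.sum_congr rfl fun c hc => ?_
      rw [trace_symm hd hc hbK, green_sub_comm, mul_comm]
      rfl
    · have hyz : y ≠ z := fun h => hfar y (h ▸ hz.le) hy2
      have hyK : y ∉ K := fun h => by
        rcases Finset.mem_union.mp h with h | h
        · exact hfar y ((mem_box.mp h).trans (by omega)) hy2
        · have := mem_box.mp h; omega
      rw [hφavg y hyz]
      refine le_of_eq ?_
      simp only [hφ]
      congr 1
      exact Finset.sum_congr rfl fun c hc => by rw [hitAt_of_notMem hd hc hyK]
    · have hyK : y ∈ K := Finset.mem_union_right _ hy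
      simp only [hφ, hitAt_of_mem _ hyK, mul_ite, mul_one, mul_zero, Finset.sum_ite_eq, if_pos hyK,
        sub_self, le_refl]
  have h3 := avg_le_of_subharmonic hd hrR (mul_nonneg (mul_nonneg zero_le_two hm) (esc_nonneg hd K₂ b))
    (hhit x₁) (f := hitAt K b) (fun y hy1 hy2 => ?_) (fun y hy => ?_) houter ha
  · refine le_trans h3 (le_of_eq ?_)
    ring
  · refine (hitAt_of_notMem hd hbK fun h => ?_).le
    rcases Finset.mem_union.mp h with h | h
    · have := mem_box.mp h; omega
    · exact hfar y (by omega) ((mem_box.mp h).trans hrR.le)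
  · rw [hitAt_of_mem _ (Finset.mem_union_left _ hy), if_neg]
    rintro rfl
    exact hfar y ((mem_box.mp hy).trans (by omega)) ((mem_box.mp hb).trans hrR.le)

lemma trace_box_le (hd : 3 ≤ d) : ∃ C Λ : ℝ, 0 < C ∧ 0 < Λ ∧ ∀ (r : ℕ) (k : ℝ), Λ ≤ r → Λ ≤ k →
    ∀ x₁ x₂ : Zd d, k * r ≤ supn (x₁ - x₂) → ∀ a ∈ box x₁ r, ∀ b ∈ box x₂ r,
      trace (box x₁ r ∪ box x₂ r) a b ≤
        C * ((k * r : ℝ))⁻¹ ^ (d - 2) * esc (box x₁ r) a * esc (box x₂ r) b := by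
  obtain ⟨C, hC, hgreen⟩ := green_le_supn hd
  obtain ⟨Λ, hΛ, hhit⟩ := hit_box_le_half hd
  refine ⟨4 * (C * 2 ^ (d - 2)), Λ + (8 * (d + 1) + 4), by positivity, by positivity,
    fun r k hr hk x₁ x₂ hsep a ha b hb => ?_⟩
  have hr1 : 1 ≤ r := by
    have : (1 : ℝ) ≤ r := by linarith [(by positivity : (0 : ℝ) ≤ 8 * (d + 1))]
    exact_mod_cast this
  have hr0 : (0 : ℝ) < r := by exact_mod_cast hr1
  have hd0 : (0 : ℝ) ≤ 8 * (d + 1) + 4 := by positivity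
  have hk1 : (8 * (d + 1) + 4 : ℝ) < k := by linarith
  have hkr : (8 * (d + 1) + 4 : ℝ) * r < k * r := by gcongr
  have hkr0 : (0 : ℝ) < k * r := (mul_nonneg hd0 hr0.le).trans_lt hkr
  have hsep' : (8 * (d + 1) + 4) * r < supn (x₁ - x₂) := by exact_mod_cast hkr.trans_le hsep
  have hrR : r < 2 * (d + 1) * r := by nlinarith
  have h := trace_le_of_green_le hd (R := 2 * (d + 1) * r) (m := C * (k * r / 2 : ℝ)⁻¹ ^ (d - 2)) hrR
    (by positivity)
    (fun x y h => hhit r (by linarith) x y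
      (by exact_mod_cast h))
    (by nlinarith) (fun y z hy hz => hgreen _ _ (by positivity) ?_) ha hb
  · refine h.trans (le_of_eq ?_)
    rw [div_eq_mul_inv (k * r : ℝ), mul_inv, inv_inv, mul_pow]
    ring
  · have h1 := supn_le_add x₁ y x₂
    have h2 := supn_le_add y z x₂
    rw [supn_sub_comm] at hy
    rw [supn_sub_comm y z] at h2
    have h3 : supn (x₁ - x₂) ≤ supn (z - y) * 2 := by nlinarith
    have h4 : (supn (x₁ - x₂) : ℝ) ≤ supn (z - y) * 2 := by exact_mod_cast h3
    linarith

end TraceBound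

section Induction

variable {d : ℕ}

lemma le_Lseq (L0 n : ℕ) : L0 ≤ Lseq L0 n := by
  induction n with
  | zero => exact le_rfl
  | succ n ih => exact ih.trans (Nat.le_mul_of_pos_left _ (Nat.succ_pos _))

lemma rpow_le_ellOf {L : ℕ} : (L : ℝ) ^ ((1 : ℝ) / 100) ≤ ellOf L := by
  have h := (Nat.lt_floor_add_one ((L : ℝ) ^ ((1 : ℝ) / 100))).le
  refine h.trans ?_
  unfold ellOf
  push_cast
  linarith [(Nat.cast_nonneg _ : (0 : ℝ) ≤ (⌊(L : ℝ) ^ ((1 : ℝ) / 100)⌋₊ : ℝ))]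

lemma le_ellOf {L : ℕ} {Λ : ℝ} (hΛ : 0 ≤ Λ) (h : Λ ^ 100 ≤ L) : Λ ≤ ellOf L := by
  refine le_trans ?_ rpow_le_ellOf
  calc Λ = (Λ ^ 100) ^ ((1 : ℝ) / 100) := by
        rw [← Real.rpow_natCast Λ 100, ← Real.rpow_mul hΛ]; norm_num
    _ ≤ (L : ℝ) ^ ((1 : ℝ) / 100) := Real.rpow_le_rpow (by positivity) h (by norm_num)

lemma measureReal_qEvent_mul_le (hd : 3 ≤ d) (Q' : Measure (Zd d → Bool))
    [IsProbabilityMeasure Q'] {L k : ℕ} (hL : 0 < L) (hk : 3 ≤ k) {B : ℝ}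
    (hB : ∀ x y : Zd d, inPlane x → inPlane y → k * L ≤ supn (x - y) →
      Q'.real {Y | crossing L x (occ (box x (3 * L)) Y) ∧ crossing L y (occ (box y (3 * L)) Y)}
        ≤ B) :
    Q'.real (qEvent d (k * L)) ≤ 240 * (k : ℝ) ^ 2 * B := by
  have : NeZero d := ⟨by omega⟩
  have hB0 : 0 ≤ B := by
    obtain ⟨x, hx⟩ : (centers d L k).Nonempty := by
      refine Finset.Nonempty.image ⟨(0, 1, 0), ?_⟩ _
      simp
    refine measureReal_nonneg.trans (hB x 0 (inPlane_of_mem_centers hx) (fun _ _ => rfl) ?_)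
    rw [sub_zero, supn_of_mem_centers hd hx]
  have hsub : qEvent d (k * L) ⊆ ⋃ p ∈ centers d L k ×ˢ centers d L (2 * k),
      {Y | crossing L p.1 (occ (box p.1 (3 * L)) Y) ∧
        crossing L p.2 (occ (box p.2 (3 * L)) Y)} := fun Y hY => by
    rw [mem_qEvent_iff, crossing_occ_iff] at hY
    obtain ⟨x, hx, y, hy, h1, h2⟩ := exists_crossing_centers hd hL hk hY
    simp only [Set.mem_iUnion]
    exact ⟨(x, y), Finset.mem_product.mpr ⟨hx, hy⟩, crossing_occ_iff.mpr h1, crossing_occ_iff.mpr h2⟩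
  have hcard : ((centers d L k ×ˢ centers d L (2 * k)).card : ℝ) ≤ 240 * (k : ℝ) ^ 2 := by
    have h1 := Nat.mul_le_mul (card_centers_le d L k) (card_centers_le d L (2 * k))
    rw [← Finset.card_product] at h1
    have h2 : (centers d L k ×ˢ centers d L (2 * k)).card ≤ 240 * k ^ 2 := by nlinarith
    exact_mod_cast h2
  calc Q'.real (qEvent d (k * L)) ≤ _ := measureReal_mono hsub (measure_ne_top _ _)
    _ ≤ _ := measureReal_biUnion_finset_le _ _
    _ ≤ ∑ p ∈ centers d L k ×ˢ centers d L (2 * k), B := Finset.sum_le_sum fun p hp => by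
        obtain ⟨h1, h2⟩ := Finset.mem_product.mp hp
        refine hB _ _ (inPlane_of_mem_centers h1) (inPlane_of_mem_centers h2) ?_
        have h3 := supn_le_add p.2 p.1 0
        rw [sub_zero, sub_zero, supn_of_mem_centers hd h1, supn_of_mem_centers hd h2,
          supn_sub_comm] at h3
        nlinarith
    _ = (centers d L k ×ˢ centers d L (2 * k)).card * B := by rw [Finset.sum_const, nsmul_eq_mul]
    _ ≤ 240 * (k : ℝ) ^ 2 * B := mul_le_mul_of_nonneg_right hcard hB0

/-- Crossing events of two distant boxes are almost independent after a change of the level. -/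
lemma exists_crossing_decoupling (hd : 3 ≤ d) : ∃ c0 c2 Λ : ℝ, 0 < c0 ∧ 0 < c2 ∧ 0 < Λ ∧
    ∀ L k : ℕ, Λ ≤ L → Λ ≤ k → ∀ u u' : ℝ, 0 < u' → u' ≤ (1 + c0 / (k : ℝ) ^ (d - 2))⁻¹ * u →
      ∀ P : Zd d → Measure (ℕ → Zd d), IsSRW d P → ∀ Q Q' : Measure (Zd d → Bool),
        IsVacantLaw P u Q → IsVacantLaw P u' Q' →
          ∀ x y : Zd d, inPlane x → inPlane y → k * L ≤ supn (x - y) →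
            Q'.real {Y | crossing L x (occ (box x (3 * L)) Y) ∧
                crossing L y (occ (box y (3 * L)) Y)} ≤
              Q.real (qEvent d L) ^ 2 + 2 * Real.exp (-(c2 * (u - u') * (L : ℝ) ^ (d - 2))) := by
  have : NeZero d := ⟨by omega⟩
  obtain ⟨C₁, hC₁, hcap⟩ := cap_box_le hd
  obtain ⟨c, Λ₁, hc, hΛ₁, hcap'⟩ := le_cap_box hd
  obtain ⟨C₂, Λ₂, hC₂, hΛ₂, htr⟩ := trace_box_le hd
  set C : ℝ := C₂ * 3 ^ (d - 2) * C₁ with hC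
  have hC0 : 0 < C := by positivity
  refine ⟨56 * C, c * 3 ^ (d - 2) / 4, Λ₁ + 3 * Λ₂ + 2 * C + 10, by positivity, by positivity,
    by positivity, fun L k hL hk u u' hu' huu P hP Q Q' hQ hQ' x y hx hy hxy => ?_⟩
  have hL0 : (0 : ℝ) < L := by linarith
  have hk0 : (1 : ℝ) ≤ k := by linarith
  have hL1 : 1 ≤ L := by exact_mod_cast hL0
  have hcap_le : ∀ z : Zd d, cap (box z (3 * L)) ≤ C₁ * (3 * L : ℝ) ^ (d - 2) := fun z => by
    exact_mod_cast hcap (3 * L) (by omega) z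
  have hle_cap : ∀ z : Zd d, c * (3 * L : ℝ) ^ (d - 2) ≤ cap (box z (3 * L)) := fun z => by
    exact_mod_cast hcap' (3 * L) (by push_cast; linarith) z
  have hcap_pos : ∀ z : Zd d, 0 < cap (box z (3 * L)) := fun z =>
    (by positivity : (0 : ℝ) < c * (3 * L : ℝ) ^ (d - 2)).trans_le (hle_cap z)
  set κ : ℝ := C₂ * (k / 3 * (3 * L : ℕ) : ℝ)⁻¹ ^ (d - 2) with hκ
  have hκ0 : 0 ≤ κ := by positivity
  have hκcap : ∀ z : Zd d, κ * cap (box z (3 * L)) ≤ C / (k : ℝ) ^ (d - 2) := fun z => by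
    refine (mul_le_mul_of_nonneg_left (hcap_le z) hκ0).trans (le_of_eq ?_)
    rw [hκ, hC, show (k / 3 * (3 * L : ℕ) : ℝ) = k * L by push_cast; ring, mul_inv, mul_pow, mul_pow]
    have : (k : ℝ) ≠ 0 := by positivity
    simp only [inv_pow]
    field_simp
  have hκhalf : ∀ z : Zd d, κ * cap (box z (3 * L)) ≤ 1 / 2 := fun z => by
    refine (hκcap z).trans ?_
    rw [div_le_iff₀ (by positivity)]
    have : (k : ℝ) ≤ (k : ℝ) ^ (d - 2) := le_self_pow₀ hk0 (by omega)
    linarith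
  have hdisj : Disjoint (box x (3 * L)) (box y (3 * L)) := by
    rw [Finset.disjoint_left]
    intro z hz1 hz2
    have h1 := mem_box.mp hz1
    have h2 := mem_box.mp hz2
    rw [supn_sub_comm] at h1
    have h3 := supn_le_add x z y
    have h4 : (10 : ℝ) ≤ k := by linarith
    have h5 : 10 ≤ k := by exact_mod_cast h4
    have h6 := Nat.mul_le_mul_right L h5
    omega
  have htr' := htr (3 * L) (k / 3) (by push_cast; linarith) (by linarith) x y (by
    have : (k * L : ℝ) ≤ supn (x - y) := by exact_mod_cast hxy
    push_cast
    linarith)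
  have hlevel : u' * (56 * C / (k : ℝ) ^ (d - 2)) ≤ u - u' := by
    rw [← div_eq_inv_mul, le_div_iff₀ (by positivity)] at huu
    linarith
  have huu' : 0 ≤ u - u' := le_trans (by positivity) hlevel
  have hexp : ∀ z z' : Zd d, 14 * u' * κ * cap (box z (3 * L)) * cap (box z' (3 * L))
      - (u - u') * cap (box z (3 * L)) / 2
        ≤ -(c * 3 ^ (d - 2) / 4 * (u - u') * (L : ℝ) ^ (d - 2)) := fun z z' => by
    have h1 : 14 * u' * (κ * cap (box z' (3 * L))) ≤ (u - u') / 4 := by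
      have := mul_le_mul_of_nonneg_left (hκcap z') (by positivity : 0 ≤ 14 * u')
      refine this.trans ?_
      have h2 : u' * (56 * C / (k : ℝ) ^ (d - 2)) = 4 * (14 * u' * (C / (k : ℝ) ^ (d - 2))) := by ring
      linarith
    have h3 := mul_le_mul_of_nonneg_right h1 (hcap_pos z).le
    have h4 := mul_le_mul_of_nonneg_left (hle_cap z) huu'
    rw [mul_pow] at h4
    linarith
  have hmono : ∀ (z : Zd d) (S T : Finset (Zd d)), crossing L z S →
      crossing L z (S ∪ T : Finset (Zd d)) := fun z S T h =>
    h.mono (Finset.coe_subset.mpr Finset.subset_union_left)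
  have h := hQ.measureReal_inter_le hd hP hQ' hu'.le (by linarith) hdisj hκ0 (hcap_pos x)
    (hcap_pos y) htr' (hκhalf x) (hκhalf y) (A₁ := fun S => crossing L x S)
    (A₂ := fun S => crossing L y S) (hmono x) (hmono y)
  rw [hQ.measureReal_crossing hd hP hx, hQ.measureReal_crossing hd hP hy] at h
  have h1 := Real.exp_le_exp.mpr (hexp x y)
  have h2 := Real.exp_le_exp.mpr (hexp y x)
  rw [show 14 * u' * κ * cap (box y (3 * L)) * cap (box x (3 * L))
    = 14 * u' * κ * cap (box x (3 * L)) * cap (box y (3 * L)) by ring] at h2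
  linarith

end Induction

end RI

/-- **The induction step** (Proposition 2.1).
There exist constants `c, c₀, c₁, c₂ > 0` depending only on `d` such that, for every
integer `L₀ ≥ c`, every `n ≥ 0` and all levels `0 < u' ≤ (1 + c₀/ℓ_n^{d-2})⁻¹ u`,
`q_{n+1}(u') ≤ c₁ ℓ_n² (q_n(u)² + u' L_n^{-2} + exp(-c₂ (u - u') L_n^{d-2}))`,
with `q_{n+1}(u')` and `q_n(u)` computed with respect to any vacant-set laws at levels
`u'` and `u` respectively. -/
theorem induction_step (d : ℕ) (hd : 3 ≤ d) :
    ∃ c c0 c1 c2 : ℝ, 0 < c ∧ 0 < c0 ∧ 0 < c1 ∧ 0 < c2 ∧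
      ∀ L0 : ℕ, c ≤ (L0 : ℝ) → ∀ n : ℕ, ∀ u u' : ℝ, 0 < u' →
        u' ≤ (1 + c0 / (ellOf (Lseq L0 n) : ℝ) ^ (d - 2))⁻¹ * u →
        ∀ (P : Zd d → Measure (ℕ → Zd d)), IsSRW d P →
          ∀ Q Q' : Measure (Zd d → Bool),
            IsVacantLaw P u Q → IsVacantLaw P u' Q' →
            (Q' (qEvent d (Lseq L0 (n + 1)))).toReal ≤
              c1 * (ellOf (Lseq L0 n) : ℝ) ^ 2 *
                ((Q (qEvent d (Lseq L0 n))).toReal ^ 2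
                  + u' * ((Lseq L0 n : ℝ) ^ 2)⁻¹
                  + Real.exp (-(c2 * (u - u') * (Lseq L0 n : ℝ) ^ (d - 2)))) := by
  obtain ⟨c0, c2, Λ, hc0, hc2, hΛ, h⟩ := exists_crossing_decoupling hd
  refine ⟨Λ + (Λ + 3) ^ 100, c0, 480, c2, by positivity, hc0, by norm_num, hc2,
    fun L0 hL0 n u u' hu' huu P hP Q Q' hQ hQ' => ?_⟩
  set L := Lseq L0 n with hL
  have hLL : (L0 : ℝ) ≤ L := by exact_mod_cast le_Lseq L0 n
  have hpow : (0 : ℝ) < (Λ + 3) ^ 100 := by positivity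
  have hΛL : Λ ≤ L := by linarith
  have hell : Λ + 3 ≤ ellOf L := le_ellOf (by positivity) (by linarith)
  have hell3 : 3 ≤ ellOf L := by
    have : (3 : ℝ) ≤ ellOf L := by linarith
    exact_mod_cast this
  have hLpos : 0 < L := by
    have : (0 : ℝ) < L := by linarith
    exact_mod_cast this
  have := hQ'.1
  have h1 := measureReal_qEvent_mul_le hd Q' hLpos hell3
    (h L (ellOf L) hΛL (by linarith) u u' hu' huu P hP Q Q' hQ hQ')
  refine h1.trans ?_
  have h2 : 0 ≤ u' * ((L : ℝ) ^ 2)⁻¹ := by positivity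
  have h3 : 0 ≤ Q.real (qEvent d L) ^ 2 := by positivity
  have h4 : (0 : ℝ) ≤ (ellOf L : ℝ) ^ 2 := by positivity
  change _ ≤ 480 * (ellOf L : ℝ) ^ 2 * (Q.real (qEvent d L) ^ 2 + _ + _)
  nlinarith
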